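/- arXiv:1304.7876 — 3 statements merged into one kernel-verified Lean document; each statement's English description precedes it below -/
import Mathlib

section
/- Let b be the multiplicative arithmetic function on nonzero ideals (g) of F_q[X] defined by b(g) = ∏_{(P) | (g)} (1 + |P|^{−1})^{−1}. Then the Dirichlet series G(s) = Σ_{(g) ≠ 0} b(g)|g|^{−s} satisfies G(s) = (ζ_q(s)/ζ_q(2s)) H(s), where ζ_q(s) = Σ_{(g)≠0} |g|^{−s} = (1 − q^{1−s})^{−1} and H(s) = ∏_{(P)} (1 − |P|^{−s}(1 − |P|^{1−s} − |P|^{−s}) / ((|P|+1)(1 − |P|^{−2s}))), with H(s) convergent for Re(s) > 1/2. In particular G has a simple pole at s = 1 with residue H(1)/(ζ_q(2) log q), where H(1) = ∏_{(P)} (1 + 1/((|P|+1)(|P|^2−1))). -/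
open Polynomial UniqueFactorizationMonoid Filter

/-- `|g| = q^{deg g}` as a real number. -/
noncomputable def polyAbs (K : Type) [Field K] [Fintype K] (g : K[X]) : ℝ :=
  (Fintype.card K : ℝ) ^ g.natDegree

open Classical in
/-- `b(g) = ∏_{(P) | (g)} (1 + |P|⁻¹)⁻¹`, product over the monic irreducible
divisors of `g`. -/
noncomputable def bMultOrd (K : Type) [Field K] [Fintype K] (g : K[X]) : ℝ :=
  ∏ P ∈ (normalizedFactors g).toFinset, (1 + (polyAbs K P)⁻¹)⁻¹

/-- The Dirichlet series `G(s) = Σ_{(g) ≠ 0} b(g) |g|^{−s}`, summed over monic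
polynomials. -/
noncomputable def GseriesOrd (K : Type) [Field K] [Fintype K] (s : ℂ) : ℂ :=
  ∑' g : {g : K[X] // g.Monic}, (bMultOrd K g.1 : ℂ) * (polyAbs K g.1 : ℂ) ^ (-s)

/-- The Euler factor of `H(s)` at a prime `P`:
`1 − |P|^{−s}(1 − |P|^{1−s} − |P|^{−s}) / ((|P|+1)(1 − |P|^{−2s}))`. -/
noncomputable def HtermOrd (K : Type) [Field K] [Fintype K] (s : ℂ) (P : K[X]) : ℂ :=
  1 - (polyAbs K P : ℂ) ^ (-s) *
      (1 - (polyAbs K P : ℂ) ^ ((1 : ℂ) - s) - (polyAbs K P : ℂ) ^ (-s)) /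
      (((polyAbs K P : ℂ) + 1) * (1 - (polyAbs K P : ℂ) ^ (-(2 : ℂ) * s)))

/-- `H(s) = ∏_{(P)} (1 − |P|^{−s}(1 − |P|^{1−s} − |P|^{−s})/((|P|+1)(1 − |P|^{−2s})))`. -/
noncomputable def HprodOrd (K : Type) [Field K] [Fintype K] (s : ℂ) : ℂ :=
  ∏' P : {P : K[X] // P.Monic ∧ Irreducible P}, HtermOrd K s P.1

/-- `H(1) = ∏_{(P)} (1 + 1/((|P|+1)(|P|²−1)))`. -/
noncomputable def Hone (K : Type) [Field K] [Fintype K] : ℝ :=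
  ∏' P : {P : K[X] // P.Monic ∧ Irreducible P},
    (1 + ((polyAbs K P.1 + 1) * ((polyAbs K P.1) ^ 2 - 1))⁻¹)

theorem hasSum_finsupp_prod_support_subset {ι : Type*} {f : ι → ℕ → ℂ} (h0 : ∀ i, f i 0 = 1)
    (hs : ∀ i, Summable fun k => ‖f i k‖) (S : Finset ι) :
    (Summable fun x : {x : ι →₀ ℕ // x.support ⊆ S} => ‖x.1.prod f‖) ∧
      HasSum (fun x : {x : ι →₀ ℕ // x.support ⊆ S} => x.1.prod f)
        (∏ i ∈ S, ∑' k, f i k) := by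
  classical
  induction S using Finset.induction_on with
  | empty =>
    let _ : Unique {x : ι →₀ ℕ // x.support ⊆ (∅ : Finset ι)} :=
      { default := ⟨0, by simp⟩
        uniq := fun x => Subtype.ext (by simpa using x.2) }
    refine ⟨(hasSum_unique _).summable, ?_⟩
    have h := hasSum_unique (fun x : {x : ι →₀ ℕ // x.support ⊆ (∅ : Finset ι)} => x.1.prod f)
    rwa [show (default : {x : ι →₀ ℕ // x.support ⊆ (∅ : Finset ι)}).1.prod f = _ from
      Finsupp.prod_zero_index] at h
  | insert a S ha ih =>
    let e : ℕ × {x : ι →₀ ℕ // x.support ⊆ S} ≃ {x : ι →₀ ℕ // x.support ⊆ insert a S} :=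
      { toFun := fun y => ⟨Finsupp.single a y.1 + y.2.1, by
          intro i hi
          have := y.2.2
          rcases Finset.mem_union.1 (Finsupp.support_add hi) with h | h
          · have := Finsupp.support_single_subset h
            simp_all
          · exact Finset.mem_insert_of_mem (this h)⟩
        invFun := fun x => (x.1 a, ⟨x.1.erase a, by
          rw [Finsupp.support_erase]
          intro i hi
          have := x.2 (Finset.mem_of_mem_erase hi)
          simp_all⟩)
        left_inv := by
          rintro ⟨k, x, hx⟩
          have hxa : x a = 0 := by
            by_contra h
            exact ha (hx (Finsupp.mem_support_iff.2 h))
          simp [hxa, Finsupp.erase_add]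
        right_inv := by
          rintro ⟨x, hx⟩
          exact Subtype.ext (Finsupp.single_add_erase a x) }
    have he : ∀ y, (e y).1.prod f = f a y.1 * y.2.1.prod f := by
      rintro ⟨k, x, hx⟩
      change (Finsupp.single a k + x).prod f = _
      rw [Finsupp.prod_add_index_of_disjoint, Finsupp.prod_single_index (h0 a)]
      rw [Finset.disjoint_left]
      intro i hi hi'
      have := Finsupp.support_single_subset hi
      simp only [Finset.mem_singleton] at this
      exact ha (this ▸ hx hi')
    clear_value e
    constructor
    · rw [← e.summable_iff]
      simp only [Function.comp_def, he]
      exact (hs a).mul_norm (f := f a) (g := fun y : {x : ι →₀ ℕ // x.support ⊆ S} => y.1.prod f)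
        ih.1
    · rw [← e.hasSum_iff, Finset.prod_insert ha]
      simp only [Function.comp_def, he]
      have hmul := summable_mul_of_summable_norm (f := f a)
        (g := fun y : {x : ι →₀ ℕ // x.support ⊆ S} => y.1.prod f) (hs a) ih.1
      have h1 : HasSum (f a) (∑' k, f a k) := (hs a).of_norm.hasSum
      have h2 : HasSum (fun y : {x : ι →₀ ℕ // x.support ⊆ S} => y.1.prod f)
        (∏ i ∈ S, ∑' k, f i k) := ih.2
      have h3 := HasSum.mul h1 h2
      exact h3 hmul

/-- The Euler product of an absolutely summable multiplicative family of finitely supported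
exponents. -/
theorem hasProd_tsum_of_summable_finsupp_prod {ι : Type*} {f : ι → ℕ → ℂ} (h0 : ∀ i, f i 0 = 1)
    (hs : Summable fun x : ι →₀ ℕ => ‖x.prod f‖) :
    HasProd (fun i => ∑' k, f i k) (∑' x : ι →₀ ℕ, x.prod f) := by
  classical
  have hs1 : ∀ i, Summable fun k => ‖f i k‖ := fun i => by
    simpa [Function.comp_def, Finsupp.prod_single_index (h0 i)] using
      hs.comp_injective (Finsupp.single_injective (M := ℕ) i)
  have key : ∀ S : Finset ι, ∏ i ∈ S, ∑' k, f i k =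
      ∑' x, Set.indicator {x : ι →₀ ℕ | x.support ⊆ S} (fun x => x.prod f) x := fun S => by
    rw [← (hasSum_finsupp_prod_support_subset h0 hs1 S).2.tsum_eq]
    exact tsum_subtype {x : ι →₀ ℕ | x.support ⊆ S} (fun x => x.prod f)
  change Tendsto (fun S : Finset ι => ∏ i ∈ S, ∑' k, f i k) atTop _
  simp only [key]
  refine tendsto_tsum_of_dominated_convergence hs (fun x => ?_)
    (Eventually.of_forall fun S x => norm_indicator_le_norm_self _ _)
  refine tendsto_const_nhds.congr' ?_
  filter_upwards [eventually_ge_atTop x.support] with S hS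
  rw [Set.indicator_of_mem]
  exact hS

theorem hasSum_pow_natDegree_monic {K : Type} [Field K] [Fintype K] {w : ℂ}
    (hw : Fintype.card K * ‖w‖ < 1) :
    (Summable fun g : {g : K[X] // g.Monic} => ‖w ^ g.1.natDegree‖) ∧
      HasSum (fun g : {g : K[X] // g.Monic} => w ^ g.1.natDegree)
        (1 - Fintype.card K * w)⁻¹ := by
  let e : (Σ n : ℕ, (Fin n → K)) ≃ {g : K[X] // g.Monic} :=
    (Equiv.sigmaCongrRight fun n =>
      ((monicEquivDegreeLT n).trans (degreeLTEquiv K n).toEquiv).symm.trans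
        ((Equiv.subtypeSubtypeEquivSubtypeInter _ _).symm)).trans
      (Equiv.sigmaFiberEquiv fun g : {g : K[X] // g.Monic} => g.1.natDegree)
  have he : ∀ y, (e y).1.natDegree = y.1 := fun y =>
    (((monicEquivDegreeLT y.1).trans (degreeLTEquiv K y.1).toEquiv).symm y.2).2.2
  have hsum : Summable fun y : (Σ n : ℕ, (Fin n → K)) => ‖w ^ y.1‖ := by
    rw [summable_sigma_of_nonneg (fun _ => norm_nonneg _)]
    refine ⟨fun n => (hasSum_fintype _).summable, ?_⟩
    have : Summable fun n : ℕ => ((Fintype.card K : ℝ) * ‖w‖) ^ n :=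
      summable_geometric_of_lt_one (by positivity) hw
    simpa [tsum_fintype, mul_pow] using this
  constructor
  · rw [← e.summable_iff]
    simpa only [Function.comp_def, he] using hsum
  · rw [← e.hasSum_iff]
    simp only [Function.comp_def, he]
    have h1 : HasSum (fun n : ℕ => ((Fintype.card K : ℂ) * w) ^ n)
        (1 - Fintype.card K * w)⁻¹ :=
      hasSum_geometric_of_norm_lt_one (by simpa using hw)
    have h2 := hsum.of_norm.hasSum.sigma (fun n => hasSum_fintype _)
    simp only [Finset.sum_const, Finset.card_univ, Fintype.card_fun, Fintype.card_fin,
      nsmul_eq_mul, Nat.cast_pow, ← mul_pow] at h2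
    rw [← h2.unique h1]
    exact hsum.of_norm.hasSum

open Classical in
theorem normalizedFactors_finsupp_prod {K : Type} [Field K]
    (x : {P : K[X] // P.Monic ∧ Irreducible P} →₀ ℕ) :
    normalizedFactors (x.prod fun P k => P.1 ^ k) = (Finsupp.toMultiset x).map Subtype.val := by
  have h : x.prod (fun P k => P.1 ^ k) = ((Finsupp.toMultiset x).map Subtype.val).prod := by
    rw [Finsupp.toMultiset_map, Finsupp.prod_toMultiset, Finsupp.prod_mapDomain_index] <;>
      simp [pow_add]
  rw [h, normalizedFactors_prod_eq, Multiset.map_map]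
  · exact Multiset.map_congr rfl fun P _ => P.2.1.normalize_eq_self
  · intro a ha
    obtain ⟨P, -, rfl⟩ := Multiset.mem_map.1 ha
    exact P.2.2

open Classical in
/-- Unique factorization of monic polynomials over a field. -/
noncomputable def finsuppEquivMonic (K : Type) [Field K] :
    ({P : K[X] // P.Monic ∧ Irreducible P} →₀ ℕ) ≃ {g : K[X] // g.Monic} where
  toFun x := ⟨x.prod fun P k => P.1 ^ k, monic_prod_of_monic _ _ fun P _ => P.2.1.pow _⟩
  invFun g := Multiset.toFinsupp ((normalizedFactors g.1).pmap Subtype.mk fun P hP =>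
    ⟨by
      have h := irreducible_of_normalized_factor P hP
      rw [← normalize_normalized_factor P hP]
      exact monic_normalize h.ne_zero, irreducible_of_normalized_factor P hP⟩)
  left_inv x := by
    apply (Multiset.toFinsupp (α := {P : K[X] // P.Monic ∧ Irreducible P})).symm.injective
    apply Multiset.map_injective Subtype.val_injective
    simp only [AddEquiv.symm_apply_apply, Multiset.map_pmap, Multiset.pmap_eq_map, Multiset.map_id']
    exact normalizedFactors_finsupp_prod x
  right_inv g := by
    apply Subtype.ext
    have h : ∀ m : Multiset {P : K[X] // P.Monic ∧ Irreducible P},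
        (Multiset.toFinsupp m).prod (fun P k => P.1 ^ k) = (m.map Subtype.val).prod := fun m => by
      conv_rhs => rw [← Multiset.toFinsupp_toMultiset m]
      rw [Finsupp.toMultiset_map, Finsupp.prod_toMultiset, Finsupp.prod_mapDomain_index] <;>
        simp [pow_add]
    refine (h _).trans ?_
    rw [Multiset.map_pmap, Multiset.pmap_eq_map, Multiset.map_id',
      prod_normalizedFactors_eq, g.2.normalize_eq_self]
    exact g.2.ne_zero

theorem pow_natDegree_finsuppEquivMonic {K : Type} [Field K] (w : ℂ)
    (x : {P : K[X] // P.Monic ∧ Irreducible P} →₀ ℕ) :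
    w ^ (finsuppEquivMonic K x).1.natDegree = x.prod fun P k => (w ^ P.1.natDegree) ^ k := by
  change w ^ (x.prod fun P k => P.1 ^ k).natDegree = _
  rw [Finsupp.prod, natDegree_prod_of_monic _ _ fun P _ => P.2.1.pow _,
    ← Finset.prod_pow_eq_pow_sum]
  refine Finset.prod_congr rfl fun P _ => ?_
  rw [P.2.1.natDegree_pow, mul_comm, pow_mul]

open Classical in
theorem bMultOrd_finsuppEquivMonic {K : Type} [Field K] [Fintype K]
    (x : {P : K[X] // P.Monic ∧ Irreducible P} →₀ ℕ) :
    bMultOrd K (finsuppEquivMonic K x).1 = ∏ P ∈ x.support, (1 + (polyAbs K P.1)⁻¹)⁻¹ := by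
  change bMultOrd K (x.prod fun P k => P.1 ^ k) = _
  rw [bMultOrd, normalizedFactors_finsupp_prod, Multiset.toFinset_map,
    Finsupp.toFinset_toMultiset, Finset.prod_image fun _ _ _ _ h => Subtype.ext h]

theorem polyAbs_pos {K : Type} [Field K] [Fintype K] (g : K[X]) : 0 < polyAbs K g :=
  pow_pos (Nat.cast_pos.2 Fintype.card_pos) _

theorem polyAbs_cpow {K : Type} [Field K] [Fintype K] (g : K[X]) (s : ℂ) :
    (polyAbs K g : ℂ) ^ s = ((Fintype.card K : ℂ) ^ s) ^ g.natDegree := by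
  rw [polyAbs, ← Complex.cpow_nat_mul, Complex.natCast_cpow_natCast_mul]
  norm_cast

theorem bMultOrd_nonneg {K : Type} [Field K] [Fintype K] (g : K[X]) : 0 ≤ bMultOrd K g :=
  Finset.prod_nonneg fun P _ => inv_nonneg.2 (by have := polyAbs_pos P; positivity)

theorem bMultOrd_le_one {K : Type} [Field K] [Fintype K] (g : K[X]) : bMultOrd K g ≤ 1 :=
  Finset.prod_le_one (fun P _ => inv_nonneg.2 (by have := polyAbs_pos P; positivity))
    fun P _ => inv_le_one_of_one_le₀ (by have := inv_pos.2 (polyAbs_pos P); linarith)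

theorem norm_pow_natDegree_lt_one {K : Type} [Field K] [Fintype K] {w : ℂ}
    (hw : Fintype.card K * ‖w‖ < 1) {P : K[X]} (hP : Irreducible P) :
    ‖w ^ P.natDegree‖ < 1 := by
  rw [norm_pow]
  refine pow_lt_one₀ (norm_nonneg _) ?_ hP.natDegree_pos.ne'
  have : (1 : ℝ) ≤ Fintype.card K := by exact_mod_cast Fintype.card_pos (α := K)
  nlinarith [norm_nonneg w]

/-- The Euler product of the zeta function of `K[X]`. -/
theorem hasProd_one_sub_pow_natDegree_inv {K : Type} [Field K] [Fintype K] {w : ℂ}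
    (hw : Fintype.card K * ‖w‖ < 1) :
    HasProd (fun P : {P : K[X] // P.Monic ∧ Irreducible P} => (1 - w ^ P.1.natDegree)⁻¹)
      (1 - Fintype.card K * w)⁻¹ := by
  obtain ⟨hs, hsum⟩ := hasSum_pow_natDegree_monic hw
  rw [← (finsuppEquivMonic K).summable_iff] at hs
  rw [← (finsuppEquivMonic K).hasSum_iff] at hsum
  simp only [Function.comp_def, pow_natDegree_finsuppEquivMonic] at hs hsum
  have h := hasProd_tsum_of_summable_finsupp_prod
    (f := fun (P : {P : K[X] // P.Monic ∧ Irreducible P}) k => (w ^ P.1.natDegree) ^ k)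
    (fun P => pow_zero _) hs
  rw [hsum.tsum_eq] at h
  simpa only [fun P : {P : K[X] // P.Monic ∧ Irreducible P} =>
    tsum_geometric_of_norm_lt_one (norm_pow_natDegree_lt_one hw P.2.2)] using h

/-- The Euler product of the Dirichlet series with coefficients `bMultOrd K`. -/
theorem hasProd_tsum_bMultOrd_mul_pow {K : Type} [Field K] [Fintype K] {w : ℂ}
    (hw : Fintype.card K * ‖w‖ < 1) :
    HasProd (fun P : {P : K[X] // P.Monic ∧ Irreducible P} =>
        1 + (1 + (polyAbs K P.1 : ℂ)⁻¹)⁻¹ * (w ^ P.1.natDegree / (1 - w ^ P.1.natDegree)))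
      (∑' g : {g : K[X] // g.Monic}, (bMultOrd K g.1 : ℂ) * w ^ g.1.natDegree) := by
  set f : {P : K[X] // P.Monic ∧ Irreducible P} → ℕ → ℂ := fun P k =>
    if k = 0 then 1 else (1 + (polyAbs K P.1 : ℂ)⁻¹)⁻¹ * (w ^ P.1.natDegree) ^ k with hf
  have hs : Summable fun g : {g : K[X] // g.Monic} =>
      ‖(bMultOrd K g.1 : ℂ) * w ^ g.1.natDegree‖ := by
    refine (hasSum_pow_natDegree_monic hw).1.of_nonneg_of_le (fun _ => norm_nonneg _) fun g => ?_
    rw [norm_mul, Complex.norm_real, Real.norm_of_nonneg (bMultOrd_nonneg _)]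
    exact mul_le_of_le_one_left (norm_nonneg _) (bMultOrd_le_one _)
  have hterm : ∀ x, (bMultOrd K (finsuppEquivMonic K x).1 : ℂ) *
      w ^ (finsuppEquivMonic K x).1.natDegree = x.prod f := fun x => by
    rw [pow_natDegree_finsuppEquivMonic, bMultOrd_finsuppEquivMonic, Finsupp.prod, Finsupp.prod]
    push_cast
    rw [← Finset.prod_mul_distrib]
    refine Finset.prod_congr rfl fun P hP => ?_
    rw [hf]
    simp only [if_neg (Finsupp.mem_support_iff.1 hP)]
  rw [← (finsuppEquivMonic K).summable_iff] at hs
  rw [← (finsuppEquivMonic K).tsum_eq]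
  simp only [Function.comp_def, hterm] at hs ⊢
  have h := hasProd_tsum_of_summable_finsupp_prod (f := f) (fun P => if_pos rfl) hs
  convert! h using 2 with P
  have hu := norm_pow_natDegree_lt_one hw P.2.2
  have h1 := ((hasSum_geometric_of_norm_lt_one hu).mul_left (w ^ P.1.natDegree)).mul_left
    (1 + (polyAbs K P.1 : ℂ)⁻¹)⁻¹
  have h2 : HasSum (fun k => f P (k + 1))
      ((1 + (polyAbs K P.1 : ℂ)⁻¹)⁻¹ * (w ^ P.1.natDegree * (1 - w ^ P.1.natDegree)⁻¹)) := by
    simpa [hf, pow_succ'] using h1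
  have h3 := (hasSum_nat_add_iff 1).1 h2
  rw [h3.tsum_eq]
  simp [hf, div_eq_mul_inv, add_comm]

theorem norm_natCast_cpow_neg {K : Type} [Field K] [Fintype K] (s : ℂ) :
    ‖(Fintype.card K : ℂ) ^ (-s)‖ = (Fintype.card K : ℝ) ^ (-s.re) := by
  rw [Complex.norm_natCast_cpow_of_pos Fintype.card_pos, Complex.neg_re]

theorem card_mul_rpow_neg_lt_one {K : Type} [Field K] [Fintype K] {σ : ℝ} (hσ : 1 < σ) :
    (Fintype.card K : ℝ) * (Fintype.card K : ℝ) ^ (-σ) < 1 := by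
  have h : (1 : ℝ) < Fintype.card K := by exact_mod_cast Fintype.one_lt_card (α := K)
  rw [← Real.rpow_one_add' (by positivity) (by linarith)]
  exact Real.rpow_lt_one_of_one_lt_of_neg h (by linarith)

theorem summable_polyAbs_rpow {K : Type} [Field K] [Fintype K] {σ : ℝ} (hσ : 1 < σ) :
    Summable fun P : {P : K[X] // P.Monic ∧ Irreducible P} => polyAbs K P.1 ^ (-σ) := by
  have hw : (Fintype.card K : ℝ) * ‖(Fintype.card K : ℂ) ^ (-(σ : ℂ))‖ < 1 := by
    rw [norm_natCast_cpow_neg]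
    exact card_mul_rpow_neg_lt_one hσ
  refine ((hasSum_pow_natDegree_monic hw).1.comp_injective
    (i := fun P : {P : K[X] // P.Monic ∧ Irreducible P} => (⟨P.1, P.2.1⟩ : {g : K[X] // g.Monic}))
    fun P Q h => Subtype.ext (Subtype.mk.inj h)).congr fun P => ?_
  rw [Function.comp_apply, ← polyAbs_cpow,
    Complex.norm_cpow_eq_rpow_re_of_pos (polyAbs_pos _)]
  simp

theorem card_le_polyAbs {K : Type} [Field K] [Fintype K] {P : K[X]} (hP : Irreducible P) :
    (Fintype.card K : ℝ) ≤ polyAbs K P := by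
  refine le_self_pow₀ ?_ hP.natDegree_pos.ne'
  exact_mod_cast Fintype.card_pos (α := K)

/-- The Euler factor of `H(s)` in terms of `|P|` and `u = |P|^{-s}`. -/
theorem HtermOrd_eq {K : Type} [Field K] [Fintype K] (s : ℂ) (P : K[X]) :
    HtermOrd K s P = 1 + -((polyAbs K P : ℂ) ^ (-s) *
      (1 - (polyAbs K P : ℂ) * (polyAbs K P : ℂ) ^ (-s) - (polyAbs K P : ℂ) ^ (-s)) /
      (((polyAbs K P : ℂ) + 1) * (1 - ((polyAbs K P : ℂ) ^ (-s)) ^ 2))) := by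
  have h0 : (polyAbs K P : ℂ) ≠ 0 := by exact_mod_cast (polyAbs_pos P).ne'
  rw [HtermOrd, sub_eq_add_neg, sub_eq_add_neg (1 : ℂ) s, Complex.cpow_add _ _ h0,
    Complex.cpow_one, ← Complex.cpow_nat_mul]
  push_cast
  rw [neg_mul_comm]

theorem norm_HtermOrd_sub_one_le {K : Type} [Field K] [Fintype K] {σ : ℝ} (hσ : 1 / 2 < σ)
    {s : ℂ} (hs : σ ≤ s.re) {P : K[X]} (hP : Irreducible P) :
    ‖HtermOrd K s P - 1‖ ≤ 2 * (polyAbs K P ^ (-(1 + σ)) + polyAbs K P ^ (-(2 * σ)) +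
      polyAbs K P ^ (-(1 + 2 * σ))) := by
  set p := polyAbs K P with hp
  have hq : (2 : ℝ) ≤ Fintype.card K := by exact_mod_cast Fintype.one_lt_card (α := K)
  have hp2 : 2 ≤ p := hq.trans (card_le_polyAbs hP)
  have hp0 : 0 < p := by linarith
  have hr : ‖(p : ℂ) ^ (-s)‖ ≤ p ^ (-σ) := by
    rw [Complex.norm_cpow_eq_rpow_re_of_pos hp0]
    exact Real.rpow_le_rpow_of_exponent_le (by linarith) (by simpa using hs)
  have e1 : p ^ (-(1 + σ)) = p ^ (-σ) / p := by
    rw [neg_add', sub_eq_add_neg, Real.rpow_add hp0, Real.rpow_neg_one, div_eq_inv_mul]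
  have e2 : p ^ (-(2 * σ)) = (p ^ (-σ)) ^ 2 := by
    rw [← Real.rpow_mul_natCast hp0.le]
    congr 1
    push_cast
    ring
  have e3 : p ^ (-(1 + 2 * σ)) = (p ^ (-σ)) ^ 2 / p := by
    rw [neg_add', sub_eq_add_neg, Real.rpow_add hp0, Real.rpow_neg_one, e2, div_eq_inv_mul]
  have hρ : (p ^ (-σ)) ^ 2 ≤ 1 / 2 := by
    rw [← e2]
    calc p ^ (-(2 * σ)) ≤ p ^ (-1 : ℝ) :=
          Real.rpow_le_rpow_of_exponent_le (by linarith) (by linarith)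
      _ ≤ 1 / 2 := by
          rw [Real.rpow_neg_one, inv_eq_one_div]
          exact one_div_le_one_div_of_le two_pos hp2
  rw [HtermOrd_eq, ← hp, add_sub_cancel_left, norm_neg, norm_div, norm_mul, norm_mul, e1, e2, e3]
  set u := (p : ℂ) ^ (-s)
  set ρ := p ^ (-σ)
  have hρ0 : 0 ≤ ρ := (norm_nonneg u).trans hr
  have hd1 : p ≤ ‖(p : ℂ) + 1‖ := by
    rw [← Complex.ofReal_one, ← Complex.ofReal_add, Complex.norm_real, Real.norm_of_nonneg] <;>
      linarith
  have hd2 : 1 / 2 ≤ ‖1 - u ^ 2‖ := by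
    have h1 := norm_sub_norm_le (1 : ℂ) (u ^ 2)
    rw [norm_one, norm_pow] at h1
    have h2 : ‖u‖ ^ 2 ≤ ρ ^ 2 := pow_le_pow_left₀ (norm_nonneg _) hr 2
    linarith
  have hn : ‖1 - (p : ℂ) * u - u‖ ≤ 1 + p * ρ + ρ := by
    refine (norm_sub_le _ _).trans ?_
    gcongr
    refine (norm_sub_le _ _).trans ?_
    rw [norm_one, norm_mul, Complex.norm_real, Real.norm_of_nonneg hp0.le]
    gcongr
  calc ‖u‖ * ‖1 - (p : ℂ) * u - u‖ / (‖(p : ℂ) + 1‖ * ‖1 - u ^ 2‖)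
      ≤ ρ * (1 + p * ρ + ρ) / (p * (1 / 2)) := by gcongr
    _ = 2 * (ρ / p + ρ ^ 2 + ρ ^ 2 / p) := by field_simp

theorem summable_HtermOrd_bound {K : Type} [Field K] [Fintype K] {σ : ℝ} (hσ : 1 / 2 < σ) :
    Summable fun P : {P : K[X] // P.Monic ∧ Irreducible P} =>
      2 * (polyAbs K P.1 ^ (-(1 + σ)) + polyAbs K P.1 ^ (-(2 * σ)) +
        polyAbs K P.1 ^ (-(1 + 2 * σ))) :=
  (((summable_polyAbs_rpow (by linarith)).add (summable_polyAbs_rpow (by linarith))).add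
    (summable_polyAbs_rpow (by linarith))).mul_left 2

theorem summable_norm_HtermOrd_sub_one {K : Type} [Field K] [Fintype K] {s : ℂ}
    (hs : 1 / 2 < s.re) :
    Summable fun P : {P : K[X] // P.Monic ∧ Irreducible P} => ‖HtermOrd K s P.1 - 1‖ :=
  (summable_HtermOrd_bound hs).of_nonneg_of_le (fun _ => norm_nonneg _)
    fun P => norm_HtermOrd_sub_one_le hs le_rfl P.2.2

theorem multipliable_HtermOrd {K : Type} [Field K] [Fintype K] {s : ℂ} (hs : 1 / 2 < s.re) :
    Multipliable fun P : {P : K[X] // P.Monic ∧ Irreducible P} => HtermOrd K s P.1 := by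
  simpa using multipliable_one_add_of_summable (summable_norm_HtermOrd_sub_one hs)

theorem HtermOrd_one {K : Type} [Field K] [Fintype K] {P : K[X]} (hP : Irreducible P) :
    HtermOrd K 1 P = ((1 + ((polyAbs K P + 1) * (polyAbs K P ^ 2 - 1))⁻¹ : ℝ) : ℂ) := by
  have hq : (2 : ℝ) ≤ Fintype.card K := by exact_mod_cast Fintype.one_lt_card (α := K)
  have hp2 : 2 ≤ polyAbs K P := hq.trans (card_le_polyAbs hP)
  rw [HtermOrd_eq, Complex.cpow_neg_one]
  norm_cast
  have h1 : polyAbs K P ^ 2 - 1 ≠ 0 := by nlinarith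
  have h3 : 1 - (polyAbs K P)⁻¹ ^ 2 = (polyAbs K P ^ 2 - 1) / polyAbs K P ^ 2 := by
    field_simp
  rw [h3]
  field_simp
  ring

theorem HprodOrd_one {K : Type} [Field K] [Fintype K] : HprodOrd K 1 = (Hone K : ℂ) := by
  have hsum : Summable fun P : {P : K[X] // P.Monic ∧ Irreducible P} =>
      ‖((polyAbs K P.1 + 1) * (polyAbs K P.1 ^ 2 - 1))⁻¹‖ := by
    refine (summable_norm_HtermOrd_sub_one (K := K) (s := 1) (by norm_num)).congr fun P => ?_
    rw [HtermOrd_one P.2.2, ← Complex.ofReal_one, ← Complex.ofReal_sub, Complex.norm_real,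
      add_sub_cancel_left]
  rw [HprodOrd, Hone]
  refine Eq.trans ?_ ((multipliable_one_add_of_summable hsum).map_tprod Complex.ofRealHom
    Complex.continuous_ofReal).symm
  exact tprod_congr fun P => HtermOrd_one P.2.2

theorem GseriesOrd_eq {K : Type} [Field K] [Fintype K] {s : ℂ} (hs : 1 < s.re) :
    GseriesOrd K s = (1 - (Fintype.card K : ℂ) ^ ((1 : ℂ) - s))⁻¹ /
      (1 - (Fintype.card K : ℂ) ^ ((1 : ℂ) - 2 * s))⁻¹ * HprodOrd K s := by
  have hq0 : (Fintype.card K : ℂ) ≠ 0 := by exact_mod_cast Fintype.card_ne_zero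
  have hq : (2 : ℝ) ≤ Fintype.card K := by exact_mod_cast Fintype.one_lt_card (α := K)
  set w := (Fintype.card K : ℂ) ^ (-s) with hw_def
  have hw : Fintype.card K * ‖w‖ < 1 := by
    rw [norm_natCast_cpow_neg]
    exact card_mul_rpow_neg_lt_one hs
  have hw1 : ‖w‖ ≤ 1 := by nlinarith [norm_nonneg w]
  have hw2 : Fintype.card K * ‖w ^ 2‖ < 1 := by
    rw [norm_pow]
    nlinarith [norm_nonneg w]
  have e1 : (Fintype.card K : ℂ) ^ ((1 : ℂ) - s) = Fintype.card K * w := by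
    rw [sub_eq_add_neg, Complex.cpow_add _ _ hq0, Complex.cpow_one]
  have e2 : (Fintype.card K : ℂ) ^ ((1 : ℂ) - 2 * s) = Fintype.card K * w ^ 2 := by
    rw [sub_eq_add_neg, Complex.cpow_add _ _ hq0, Complex.cpow_one, hw_def,
      ← Complex.cpow_nat_mul]
    push_cast
    rw [neg_mul_eq_mul_neg]
  have hG : GseriesOrd K s =
      ∑' g : {g : K[X] // g.Monic}, (bMultOrd K g.1 : ℂ) * w ^ g.1.natDegree :=
    tsum_congr fun g => by rw [polyAbs_cpow]
  have hne : 1 - (Fintype.card K : ℂ) * w ^ 2 ≠ 0 := by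
    intro h
    rw [sub_eq_zero] at h
    have := congrArg norm h
    rw [norm_one, norm_mul, Complex.norm_natCast] at this
    linarith
  have h1 := (hasProd_tsum_bMultOrd_mul_pow hw).mul (hasProd_one_sub_pow_natDegree_inv hw2)
  have h2 := (multipliable_HtermOrd (K := K) (s := s) (by linarith)).hasProd.mul
    (hasProd_one_sub_pow_natDegree_inv hw)
  have h3 := h1.unique (Eq.subst (motive := fun f => HasProd f _) (funext fun P => ?_) h2)
  · rw [e1, e2, hG, HprodOrd, div_mul_eq_mul_div, mul_comm _ (tprod _), ← h3,
      mul_div_cancel_right₀ _ (inv_ne_zero hne)]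
  · have hu := norm_pow_natDegree_lt_one hw P.2.2
    have hp0 := polyAbs_pos P.1
    have hp1 : (polyAbs K P.1 : ℂ) ≠ 0 := by exact_mod_cast hp0.ne'
    have hp2 : (polyAbs K P.1 : ℂ) + 1 ≠ 0 := by
      exact_mod_cast (by linarith : polyAbs K P.1 + 1 ≠ 0)
    rw [HtermOrd_eq, polyAbs_cpow, ← hw_def, pow_right_comm w 2]
    set u := w ^ P.1.natDegree
    set p := (polyAbs K P.1 : ℂ)
    have hu1 : 1 - u ≠ 0 := fun h => by
      rw [← sub_eq_zero.1 h, norm_one] at hu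
      exact lt_irrefl _ hu
    have hu2 : 1 + u ≠ 0 := fun h => by
      rw [← neg_eq_of_add_eq_zero_right h, norm_neg, norm_one] at hu
      exact lt_irrefl _ hu
    have hb : (1 + p⁻¹)⁻¹ = p / (p + 1) := by
      field_simp
    rw [hb, show 1 - u ^ 2 = (1 - u) * (1 + u) by ring]
    field_simp
    ring

theorem tendsto_HprodOrd_one {K : Type} [Field K] [Fintype K] :
    Tendsto (fun t : ℝ => HprodOrd K (t : ℂ)) (nhdsWithin 1 (Set.Ioi (1 : ℝ)))
      (nhds (Hone K : ℂ)) := by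
  have hq : (2 : ℝ) ≤ Fintype.card K := by exact_mod_cast Fintype.one_lt_card (α := K)
  have hofReal : Tendsto (fun t : ℝ => (t : ℂ)) (nhdsWithin 1 (Set.Ioi (1 : ℝ))) (nhds 1) :=
    (Complex.continuous_ofReal.tendsto' 1 1 Complex.ofReal_one).mono_left nhdsWithin_le_nhds
  have h := tendsto_tprod_one_add_of_dominated_convergence
    (𝓕 := nhdsWithin 1 (Set.Ioi (1 : ℝ)))
    (f := fun (t : ℝ) (P : {P : K[X] // P.Monic ∧ Irreducible P}) => HtermOrd K (t : ℂ) P.1 - 1)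
    (g := fun P => HtermOrd K 1 P.1 - 1)
    (summable_HtermOrd_bound (K := K) (σ := 1) (by norm_num)) (fun P => ?_) ?_
  · simp only [add_sub_cancel] at h
    rw [← HprodOrd_one]
    exact h
  · refine Tendsto.sub_const ?_ 1
    refine Tendsto.comp (g := fun s => HtermOrd K s P.1) (ContinuousAt.tendsto ?_) hofReal
    have hp2 : 2 ≤ polyAbs K P.1 := hq.trans (card_le_polyAbs P.2.2)
    have hp0 : (polyAbs K P.1 : ℂ) ≠ 0 := by exact_mod_cast (polyAbs_pos P.1).ne'
    have hcont : Continuous fun s : ℂ => (polyAbs K P.1 : ℂ) ^ (-s) :=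
      continuous_const.cpow continuous_neg fun _ => Complex.ofReal_mem_slitPlane.2 (polyAbs_pos _)
    simp only [HtermOrd_eq]
    refine continuousAt_const.add (ContinuousAt.neg (ContinuousAt.div ?_ ?_ ?_))
    · fun_prop
    · exact (continuous_const.mul (continuous_const.sub (hcont.pow 2))).continuousAt
    · rw [Complex.cpow_neg_one]
      norm_cast
      have : (polyAbs K P.1)⁻¹ ^ 2 < 1 :=
        pow_lt_one₀ (by positivity) (inv_lt_one_of_one_lt₀ (by linarith)) two_ne_zero
      exact mul_ne_zero (by linarith) (by linarith)
  · filter_upwards [self_mem_nhdsWithin] with t ht P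
    exact norm_HtermOrd_sub_one_le (by norm_num) (by simpa using (Set.mem_Ioi.1 ht).le) P.2.2

/-- The zeta function `(1 - q^{1-s})⁻¹` has residue `(log q)⁻¹` at `s = 1`. -/
theorem tendsto_sub_one_mul_one_sub_cpow_inv {q : ℕ} (hq : 2 ≤ q) :
    Tendsto (fun t : ℝ => ((t : ℂ) - 1) * (1 - (q : ℂ) ^ ((1 : ℂ) - t))⁻¹)
      (nhdsWithin 1 (Set.Ioi (1 : ℝ))) (nhds (Real.log q : ℂ)⁻¹) := by
  have hq0 : (q : ℂ) ≠ 0 := by exact_mod_cast (by omega : q ≠ 0)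
  have hlog : (Real.log q : ℂ) ≠ 0 := by
    exact_mod_cast (Real.log_pos (by exact_mod_cast hq)).ne'
  have hd : HasDerivAt (fun z : ℂ => 1 - (q : ℂ) ^ ((1 : ℂ) - z)) (Real.log q : ℂ) 1 := by
    have h := (((hasDerivAt_id (1 : ℂ)).const_sub 1).const_cpow (c := (q : ℂ))
      (Or.inl hq0)).const_sub 1
    simpa [Complex.natCast_log] using h
  have hofReal : Tendsto (fun t : ℝ => (t : ℂ)) (nhdsWithin 1 (Set.Ioi (1 : ℝ)))
      (nhdsWithin 1 {1}ᶜ) := by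
    refine tendsto_nhdsWithin_iff.2 ⟨(Complex.continuous_ofReal.tendsto' 1 1
      Complex.ofReal_one).mono_left nhdsWithin_le_nhds, ?_⟩
    filter_upwards [self_mem_nhdsWithin] with t ht
    simpa using (Set.mem_Ioi.1 ht).ne'
  refine (((hasDerivAt_iff_tendsto_slope.1 hd).comp hofReal).inv₀ hlog).congr fun t => ?_
  simp [slope_def_field, div_eq_mul_inv]

/-- The Dirichlet series `G(s) = Σ b(g)|g|^{−s}` with
`b(g) = ∏_{(P)|(g)} (1+|P|⁻¹)⁻¹` satisfies `G(s) = (ζ_q(s)/ζ_q(2s)) H(s)`, where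
`H(s)` converges for `Re(s) > 1/2`; in particular `G` has a simple pole at `s = 1`
with residue `H(1)/(ζ_q(2) log q)`. -/
theorem Gseries_eq_zeta_ratio_mul_H (q : ℕ) (K : Type) [Field K] [Fintype K]
    (hK : Fintype.card K = q) :
    (∀ s : ℂ, 1 < s.re →
        GseriesOrd K s = (1 - (q : ℂ) ^ ((1 : ℂ) - s))⁻¹ /
          (1 - (q : ℂ) ^ ((1 : ℂ) - 2 * s))⁻¹ * HprodOrd K s) ∧
    (∀ s : ℂ, (1 : ℝ) / 2 < s.re →
        Multipliable (fun P : {P : K[X] // P.Monic ∧ Irreducible P} =>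
          HtermOrd K s P.1)) ∧
    Tendsto (fun t : ℝ => ((t : ℂ) - 1) * GseriesOrd K (t : ℂ))
      (nhdsWithin 1 (Set.Ioi (1 : ℝ)))
      (nhds ((Hone K : ℂ) / ((1 - (q : ℂ)⁻¹)⁻¹ * (Real.log q : ℂ)))) := by
  subst hK
  refine ⟨fun s hs => GseriesOrd_eq hs, fun s hs => multipliable_HtermOrd hs, ?_⟩
  have hq0 : (Fintype.card K : ℂ) ≠ 0 := by exact_mod_cast Fintype.card_ne_zero
  have hz : Tendsto (fun t : ℝ => 1 - (Fintype.card K : ℂ) ^ ((1 : ℂ) - 2 * (t : ℂ)))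
      (nhdsWithin 1 (Set.Ioi (1 : ℝ))) (nhds (1 - (Fintype.card K : ℂ)⁻¹)) := by
    refine (Continuous.tendsto' ?_ 1 _ ?_).mono_left nhdsWithin_le_nhds
    · exact continuous_const.sub (Continuous.const_cpow (by fun_prop) (Or.inl hq0))
    · norm_num [Complex.cpow_neg_one]
  have h := ((tendsto_sub_one_mul_one_sub_cpow_inv (Fintype.one_lt_card (α := K))).mul hz).mul
    (tendsto_HprodOrd_one (K := K))
  convert! h.congr' ?_ using 2
  · rw [div_eq_mul_inv, mul_inv, inv_inv]
    ring
  · filter_upwards [self_mem_nhdsWithin] with t ht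
    rw [GseriesOrd_eq (by simpa using Set.mem_Ioi.1 ht), div_inv_eq_mul]
    ring
end

section
/- Fix α ∈ P^1(F_{q^k}) of degree u over F_q and β ∈ P^1(F_{q^u}). For the full family F_d^{full} of coprime pairs of degree-d homogeneous polynomials, the proportion |F_d^{full}(α,β)|/|F_d^{full}| equals q^{−u}/(1 + q^{−u}) + O(q^{(ε−1)d + u}) if β = ∞, and q^{−u}/(1 + q^{−u}) + O(q^{(ε−1)d}) if β ∈ F_{q^u}. -/
namespace MvPolynomial

/-- The `K`-algebra map `X i ↦ X i * T`, whose `T`-coefficients are homogeneous components. -/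
noncomputable def homogenizeHom (σ K : Type*) [CommRing K] :
    MvPolynomial σ K →ₐ[K] Polynomial (MvPolynomial σ K) :=
  aeval fun i => Polynomial.C (X i) * Polynomial.X

theorem coeff_homogenizeHom {σ K : Type*} [CommRing K] (f : MvPolynomial σ K) (n : ℕ) :
    (homogenizeHom σ K f).coeff n = homogeneousComponent n f := by
  classical
  induction f using MvPolynomial.induction_on' with
  | add p q hp hq => simp [hp, hq]
  | monomial s r =>
    have h : homogenizeHom σ K (monomial s r) =
        Polynomial.C (monomial s r) * Polynomial.X ^ s.degree := by
      rw [homogenizeHom, aeval_monomial, monomial_eq, Finsupp.prod, Finsupp.prod,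
        Finsupp.degree_apply, ← Finset.prod_pow_eq_pow_sum, map_mul,
        map_prod, mul_assoc, ← Finset.prod_mul_distrib]
      simp [mul_pow, IsScalarTower.algebraMap_apply K (MvPolynomial σ K)
        (Polynomial (MvPolynomial σ K)), algebraMap_eq]
    rw [h, Polynomial.coeff_C_mul_X_pow]
    split_ifs with hn
    · exact (homogeneousComponent_eq_self (isHomogeneous_monomial r hn.symm)).symm
    · rw [homogeneousComponent_of_mem (isHomogeneous_monomial r rfl), if_neg]
      exact fun h => hn h

theorem IsHomogeneous.exists_of_mul {σ K : Type*} [Field K] {f g : MvPolynomial σ K} {n : ℕ}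
    (h : (f * g).IsHomogeneous n) (hfg : f * g ≠ 0) :
    ∃ i j, i + j = n ∧ f.IsHomogeneous i ∧ g.IsHomogeneous j := by
  classical
  set φ := homogenizeHom σ K
  have hcoeff : ∀ (p : MvPolynomial σ K) s, coeff s p = coeff s ((φ p).coeff s.degree) := by
    intro p s
    rw [coeff_homogenizeHom, coeff_homogeneousComponent, if_pos rfl]
  have hne : ∀ p : MvPolynomial σ K, p ≠ 0 → φ p ≠ 0 := by
    intro p hp h0
    apply hp
    ext s
    rw [hcoeff, h0]
    simp
  have hf := hne f (left_ne_zero_of_mul hfg)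
  have hg := hne g (right_ne_zero_of_mul hfg)
  have hφ : φ f * φ g = Polynomial.C (f * g) * Polynomial.X ^ n := by
    rw [← map_mul]
    ext1 m
    rw [coeff_homogenizeHom, Polynomial.coeff_C_mul_X_pow, homogeneousComponent_of_mem h]
  have h1 := Polynomial.natDegree_mul hf hg
  have h2 := Polynomial.natTrailingDegree_mul hf hg
  rw [hφ, Polynomial.natDegree_C_mul_X_pow _ _ hfg] at h1
  rw [hφ, Polynomial.C_mul_X_pow_eq_monomial, Polynomial.natTrailingDegree_monomial hfg] at h2
  have h3 := Polynomial.natTrailingDegree_le_natDegree (φ f)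
  have h4 := Polynomial.natTrailingDegree_le_natDegree (φ g)
  have key : ∀ p : MvPolynomial σ K, (φ p).natTrailingDegree = (φ p).natDegree →
      p.IsHomogeneous (φ p).natDegree := by
    intro p hp s hs
    have hs' : (φ p).coeff s.degree ≠ 0 := by
      intro h0
      rw [hcoeff, h0] at hs
      simp at hs
    have h5 := Polynomial.natTrailingDegree_le_of_ne_zero hs'
    have h6 := Polynomial.le_natDegree_of_ne_zero hs'
    have : s.degree = (φ p).natDegree := by omega
    rw [← this, Finsupp.degree_eq_weight_one]
    rfl
  exact ⟨_, _, h1.symm, key f (by omega), key g (by omega)⟩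

end MvPolynomial

theorem IsRelPrime.dvd_of_dvd_mul_of_dvd_mul {R : Type*} [CommRing R] [IsDomain R]
    [UniqueFactorizationMonoid R] {D E g h : R} (hgh : IsRelPrime g h)
    (hg : D ∣ E * g) (hh : D ∣ E * h) : D ∣ E := by
  classical
  let _ := UniqueFactorizationMonoid.toGCDMonoid R
  have h1 := dvd_gcd hg hh
  have h2 := gcd_mul_left' E g h
  have h3 := gcd_isUnit_iff_isRelPrime.mpr hgh
  exact (h1.trans h2.dvd).trans ((associated_mul_unit_left E _ h3).dvd)

namespace MvPolynomial

theorem finite_setOf_isHomogeneous (K : Type*) [Field K] [Finite K] (d : ℕ) :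
    {f : MvPolynomial (Fin 2) K | f.IsHomogeneous d}.Finite := by
  have : Module.Finite K (homogeneousSubmodule (Fin 2) K d) :=
    Module.Finite.iff_fg.mpr (homogeneousSubmodule_fg _ _ d)
  have : Finite (homogeneousSubmodule (Fin 2) K d) := Module.finite_of_finite K
  exact Set.toFinite (homogeneousSubmodule (Fin 2) K d : Set (MvPolynomial (Fin 2) K))

/-- The binary forms of degree `d` over a finite field. -/
noncomputable def binaryForms (K : Type*) [Field K] [Finite K] (d : ℕ) :
    Finset (MvPolynomial (Fin 2) K) :=
  (finite_setOf_isHomogeneous K d).toFinset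

@[simp]
theorem mem_binaryForms {K : Type*} [Field K] [Finite K] {d : ℕ} {f : MvPolynomial (Fin 2) K} :
    f ∈ binaryForms K d ↔ f.IsHomogeneous d := by
  simp [binaryForms]

open Classical in
/-- The coprime pairs of binary forms of degree `d` over a finite field. -/
noncomputable def coprimeForms (K : Type*) [Field K] [Finite K] (d : ℕ) :
    Finset (MvPolynomial (Fin 2) K × MvPolynomial (Fin 2) K) :=
  {x ∈ binaryForms K d ×ˢ binaryForms K d | IsRelPrime x.1 x.2}

theorem mem_coprimeForms {K : Type*} [Field K] [Finite K] {d : ℕ}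
    {x : MvPolynomial (Fin 2) K × MvPolynomial (Fin 2) K} :
    x ∈ coprimeForms K d ↔ x.1.IsHomogeneous d ∧ x.2.IsHomogeneous d ∧ IsRelPrime x.1 x.2 := by
  simp [coprimeForms, and_assoc]

theorem card_binaryForms (K : Type*) [Field K] [Fintype K] (d : ℕ) :
    (binaryForms K d).card = Fintype.card K ^ (d + 1) := by
  have h1 : (binaryForms K d).card = Nat.card (homogeneousSubmodule (Fin 2) K d) :=
    (Nat.subtype_card _ fun x => by simp).symm
  let S : Set (Fin 2 →₀ ℕ) := {s | s.degree = d}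
  have e1 : S ≃ Finset.HasAntidiagonal.antidiagonal d :=
    { toFun := fun s => ⟨(s.1 0, s.1 1), by
        have := s.2
        simp only [S, Set.mem_ofPred_eq, Finsupp.degree_eq_sum, Fin.sum_univ_two] at this
        simpa using this⟩
      invFun := fun x => ⟨Finsupp.equivFunOnFinite.symm ![x.1.1, x.1.2], by
        have := Finset.HasAntidiagonal.mem_antidiagonal.mp x.2
        simpa [S, Finsupp.degree_eq_sum, Fin.sum_univ_two] using this⟩
      left_inv := fun s => by
        ext i
        fin_cases i <;> simp
      right_inv := fun x => by simp }
  have : Finite S := Finite.of_equiv _ e1.symm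
  have := Fintype.ofFinite S
  rw [h1, homogeneousSubmodule_eq_finsupp_supported]
  have e2 := (AddMonoidAlgebra.supportedEquivFinsupp S : _ ≃ₗ[K] (S →₀ K)).toEquiv
  rw [Nat.card_congr e2, Nat.card_congr Finsupp.equivFunOnFinite, Nat.card_fun, Nat.card_congr e1,
    Nat.card_eq_fintype_card, Nat.card_eq_fintype_card, Fintype.card_coe,
    Finset.Nat.card_antidiagonal]

open Classical in
theorem card_nonzero_pairs_eq_sum_coprimeForms (K : Type*) [Field K] [Fintype K] (d : ℕ)
    (Q : MvPolynomial (Fin 2) K × MvPolynomial (Fin 2) K → Prop) :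
    ({x ∈ binaryForms K d ×ˢ binaryForms K d | x ≠ 0 ∧ Q x}).card * (Fintype.card K - 1) =
      ∑ e ∈ Finset.HasAntidiagonal.antidiagonal d,
        ({y ∈ (binaryForms K e.1).erase 0 ×ˢ coprimeForms K e.2 |
          Q (y.1 * y.2.1, y.1 * y.2.2)}).card := by
  rw [← Finset.card_sigma]
  let f : (Σ _ : ℕ × ℕ, MvPolynomial (Fin 2) K × MvPolynomial (Fin 2) K × MvPolynomial (Fin 2) K) →
      MvPolynomial (Fin 2) K × MvPolynomial (Fin 2) K :=
    fun z => (z.2.1 * z.2.2.1, z.2.1 * z.2.2.2)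
  rw [Finset.card_eq_sum_card_fiberwise (f := f)
    (t := {x ∈ binaryForms K d ×ˢ binaryForms K d | x ≠ 0 ∧ Q x})]
  · rw [Finset.sum_const_nat (m := Fintype.card K - 1)]
    rintro ⟨a, b⟩ hx
    simp only [Finset.mem_filter, Finset.mem_product, mem_binaryForms] at hx
    obtain ⟨⟨ha, hb⟩, hne, hQ⟩ := hx
    obtain ⟨g, h, D, hgh, rfl, rfl⟩ : ∃ g h D : MvPolynomial (Fin 2) K,
        IsRelPrime g h ∧ D * g = a ∧ D * h = b := by
      by_cases hb0 : b = 0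
      · have ha0 : a ≠ 0 := fun h => hne (by simp [h, hb0])
        exact UniqueFactorizationMonoid.exists_reduced_factors a ha0 b
      · exact UniqueFactorizationMonoid.exists_reduced_factors' a b hb0
    have hD : D ≠ 0 := by
      rintro rfl
      simp at hne
    obtain ⟨i, j, hij, hDi, hgj, hhj⟩ : ∃ i j, i + j = d ∧ D.IsHomogeneous i ∧
        g.IsHomogeneous j ∧ h.IsHomogeneous j := by
      have key : ∀ g h : MvPolynomial (Fin 2) K, g ≠ 0 → (D * g).IsHomogeneous d →
          (D * h).IsHomogeneous d →
          ∃ i j, i + j = d ∧ D.IsHomogeneous i ∧ g.IsHomogeneous j ∧ h.IsHomogeneous j := by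
        intro g h hg h1 h2
        obtain ⟨i, j, hij, hi, hj⟩ := h1.exists_of_mul (mul_ne_zero hD hg)
        refine ⟨i, j, hij, hi, hj, ?_⟩
        by_cases hh : h = 0
        · rw [hh]
          exact isHomogeneous_zero _ _ _
        · obtain ⟨i', j', hij', hi', hj'⟩ := h2.exists_of_mul (mul_ne_zero hD hh)
          have := hi.inj_right hi' hD
          rwa [show j = j' by omega]
      by_cases hg : g = 0
      · have hh : h ≠ 0 := by
          rintro rfl
          simp [hg] at hne
        obtain ⟨i, j, h1, h2, h3, h4⟩ := key h g hh hb ha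
        exact ⟨i, j, h1, h2, h4, h3⟩
      · exact key g h hg ha hb
    rw [← Fintype.card_units, ← Finset.card_univ]
    symm
    refine Finset.card_nbij
      (fun c : Kˣ => ⟨(i, j), C (c : K) * D, C ((c⁻¹ : Kˣ) : K) * g, C ((c⁻¹ : Kˣ) : K) * h⟩)
      ?_ ?_ ?_
    · intro c _
      have hc : (C (c : K) : MvPolynomial (Fin 2) K) * C ((c⁻¹ : Kˣ) : K) = 1 := by
        rw [← C_mul]
        simp
      have e : ∀ p : MvPolynomial (Fin 2) K,
          C (c : K) * D * (C ((c⁻¹ : Kˣ) : K) * p) = D * p := by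
        intro p
        linear_combination D * p * hc
      have hu : IsUnit (C ((c⁻¹ : Kˣ) : K) : MvPolynomial (Fin 2) K) := (c⁻¹).isUnit.map C
      simp only [Finset.mem_filter, Finset.mem_sigma, Finset.HasAntidiagonal.mem_antidiagonal,
        Finset.mem_product,
        Finset.mem_erase, mem_binaryForms, mem_coprimeForms, f, e, Finset.mem_coe]
      refine ⟨⟨hij, ⟨⟨mul_ne_zero ?_ hD, hDi.C_mul _⟩, hgj.C_mul _, hhj.C_mul _, ?_⟩, hQ⟩, trivial⟩
      · simp
      · exact (isRelPrime_mul_unit_left_left hu).mpr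
          ((isRelPrime_mul_unit_left_right hu).mpr hgh)
    · intro c _ c' _ hcc
      simp only [Sigma.mk.injEq, heq_eq_eq, Prod.mk.injEq, true_and] at hcc
      exact Units.ext (C_injective _ _ (mul_right_cancel₀ hD hcc.1))
    · rintro ⟨⟨i', j'⟩, D', g', h'⟩ hz
      simp only [Finset.coe_filter, Finset.mem_sigma, Finset.HasAntidiagonal.mem_antidiagonal,
        Finset.mem_product,
        Finset.mem_erase, mem_binaryForms, mem_coprimeForms, f, Set.mem_ofPred_eq, ne_eq,
        Finset.mem_filter, Prod.mk.injEq] at hz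
      obtain ⟨⟨hij', ⟨⟨hD'0, hD'⟩, hg', hh', hgh'⟩, -⟩, hg, hh⟩ := hz
      have hass : Associated D D' := associated_of_dvd_dvd
        (hgh'.dvd_of_dvd_mul_of_dvd_mul ⟨g, hg⟩ ⟨h, hh⟩)
        (hgh.dvd_of_dvd_mul_of_dvd_mul ⟨g', hg.symm⟩ ⟨h', hh.symm⟩)
      obtain ⟨v, hv⟩ := hass
      obtain ⟨c, hc, hcv⟩ := isUnit_iff_eq_C_of_isReduced.mp v.isUnit
      obtain ⟨c, rfl⟩ := hc
      have hi : i = i' := by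
        refine hDi.inj_right ?_ hD
        have : D = C ((c⁻¹ : Kˣ) : K) * D' := by
          rw [← hv, hcv, mul_left_comm, ← C_mul]
          simp
        rw [this]
        exact hD'.C_mul _
      have hj : j = j' := by omega
      have hD'' : D' = C (c : K) * D := by rw [← hv, hcv, mul_comm]
      have e : ∀ p p' : MvPolynomial (Fin 2) K, D' * p' = D * p →
          C ((c⁻¹ : Kˣ) : K) * p = p' := by
        intro p p' hp
        have hc : (C (c : K) : MvPolynomial (Fin 2) K) * C ((c⁻¹ : Kˣ) : K) = 1 := by
          rw [← C_mul]
          simp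
        apply mul_left_cancel₀ hD'0
        rw [hp, hD'']
        linear_combination D * p * hc
      refine ⟨c, by simp, ?_⟩
      simp only [e g g' hg, e h h' hh, ← hD'', hi, hj]
  · rintro ⟨⟨i, j⟩, D, g, h⟩ hz
    simp only [Finset.coe_sigma, Set.mem_sigma_iff, Finset.mem_coe,
      Finset.HasAntidiagonal.mem_antidiagonal,
      Finset.mem_filter, Finset.mem_product, Finset.mem_erase, mem_binaryForms,
      mem_coprimeForms] at hz
    obtain ⟨hij, ⟨⟨hD0, hD⟩, hg, hh, hgh⟩, hQ⟩ := hz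
    simp only [Finset.coe_filter, Finset.mem_product, mem_binaryForms, Set.mem_ofPred_eq, f]
    refine ⟨⟨hij ▸ hD.mul hg, hij ▸ hD.mul hh⟩, ?_, hQ⟩
    intro h0
    simp only [Prod.mk_eq_zero, mul_eq_zero, hD0, false_or] at h0
    rw [h0.1, h0.2] at hgh
    exact not_isUnit_zero (hgh dvd_rfl dvd_rfl)

end MvPolynomial

section Evaluation

open MvPolynomial

/-- The `K`-span of `1, a, …, a ^ (n - 1)`. -/
def powersSpan (K : Type*) {L : Type*} [Field K] [Field L] [Algebra K L] (a : L) (n : ℕ) :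
    Submodule K L :=
  Submodule.span K (Set.range fun i : Fin n => a ^ (i : ℕ))

variable {K L : Type*} [Field K] [Field L] [Algebra K L]

theorem pow_mem_powersSpan (a : L) {n i : ℕ} (h : i < n) : a ^ i ∈ powersSpan K a n :=
  Submodule.subset_span ⟨⟨i, h⟩, rfl⟩

theorem card_powersSpan_of_le [Fintype K] [Finite L] (a : L) {n : ℕ} (h : n ≤ (minpoly K a).natDegree) :
    Nat.card (powersSpan K a n) = Fintype.card K ^ n := by
  have hli : LinearIndependent K fun i : Fin n => a ^ (i : ℕ) :=
    (linearIndependent_pow (K := K) a).comp (Fin.castLE h) (Fin.castLE_injective h)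
  rw [Module.natCard_eq_pow_finrank (K := K), powersSpan, finrank_span_eq_card hli,
    Nat.card_eq_fintype_card, Fintype.card_fin]

theorem powersSpan_eq_adjoin [Finite L] (a : L) {n : ℕ} (h : (minpoly K a).natDegree ≤ n) :
    powersSpan K a n = Subalgebra.toSubmodule (Algebra.adjoin K {a}) := by
  have hle : ∀ n, powersSpan K a n ≤ Subalgebra.toSubmodule (Algebra.adjoin K {a}) := by
    intro n
    rw [powersSpan, Submodule.span_le]
    rintro _ ⟨i, rfl⟩
    exact pow_mem (Algebra.subset_adjoin (Set.mem_singleton a)) _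
  have hint : IsIntegral K a := IsIntegral.of_finite K a
  have hfin : Module.finrank K (powersSpan K a (minpoly K a).natDegree) =
      Module.finrank K (Subalgebra.toSubmodule (Algebra.adjoin K {a})) := by
    rw [powersSpan, finrank_span_eq_card (linearIndependent_pow (K := K) a), Fintype.card_fin]
    exact ((Algebra.adjoin.powerBasis hint).finrank.trans
      (Algebra.adjoin.powerBasis_dim hint)).symm
  refine le_antisymm (hle n) ?_
  rw [← Submodule.eq_of_le_of_finrank_eq (hle _) hfin]
  refine Submodule.span_mono ?_
  rintro _ ⟨i, rfl⟩
  exact ⟨⟨i, i.2.trans_le h⟩, rfl⟩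

theorem card_powersSpan [Fintype K] [Finite L] (a : L) (n : ℕ) :
    Nat.card (powersSpan K a n) = Fintype.card K ^ min n (minpoly K a).natDegree := by
  rcases le_total n (minpoly K a).natDegree with h | h
  · rw [min_eq_left h, card_powersSpan_of_le a h]
  · rw [min_eq_right h, ← card_powersSpan_of_le a le_rfl, powersSpan_eq_adjoin a h,
      powersSpan_eq_adjoin a le_rfl]

theorem map_aeval_homogeneousSubmodule {v : Fin 2 → L} {a γ : L}
    (hv : v = ![γ * a, γ] ∨ v = ![γ, γ * a]) (d : ℕ) :
    (homogeneousSubmodule (Fin 2) K d).map (aeval v).toLinearMap =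
      (powersSpan K a (d + 1)).map (LinearMap.mulLeft K (γ ^ d)) := by
  apply le_antisymm
  · rw [Submodule.map_le_iff_le_comap]
    intro f hf
    rw [Submodule.mem_comap, AlgHom.toLinearMap_apply, f.as_sum, map_sum]
    refine Submodule.sum_mem _ fun s hs => ?_
    have hd : s 0 + s 1 = d := by
      have := hf (mem_support_iff.mp hs)
      rw [← this]
      simp [Finsupp.weight_apply, Finsupp.sum_fintype, Fin.sum_univ_two]
    rw [aeval_monomial, Finsupp.prod_fintype _ _ (fun _ => pow_zero _), Fin.prod_univ_two,
      ← Algebra.smul_def]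
    refine Submodule.smul_mem _ _ ?_
    rcases hv with rfl | rfl
    · refine ⟨a ^ s 0, pow_mem_powersSpan a (by omega), ?_⟩
      simp [← hd]
      ring
    · refine ⟨a ^ s 1, pow_mem_powersSpan a (by omega), ?_⟩
      simp [← hd]
      ring
  · rw [powersSpan, Submodule.map_span, Submodule.span_le]
    rintro _ ⟨_, ⟨⟨i, hi⟩, rfl⟩, rfl⟩
    obtain ⟨j, rfl⟩ : ∃ j, d = i + j := ⟨d - i, by omega⟩
    rcases hv with rfl | rfl
    · refine ⟨X 0 ^ i * X 1 ^ j, (isHomogeneous_X_pow 0 i).mul (isHomogeneous_X_pow 1 j), ?_⟩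
      simp
      ring
    · refine ⟨X 1 ^ i * X 0 ^ j, (isHomogeneous_X_pow 1 i).mul (isHomogeneous_X_pow 0 j), ?_⟩
      simp
      ring

theorem card_map_mulLeft {c : L} (hc : c ≠ 0) (W : Submodule K L) :
    Nat.card (W.map (LinearMap.mulLeft K c)) = Nat.card W :=
  (Nat.card_congr (W.equivMapOfInjective _ (mul_right_injective₀ hc)).toEquiv).symm

theorem card_ker_mul_card_map {E : Type*} [AddCommGroup E] [Module K E] (S : Submodule K E)
    (l : E →ₗ[K] L) :
    Nat.card {x // x ∈ S ∧ l x = 0} * Nat.card (S.map l) = Nat.card S := by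
  let m : S →ₗ[K] L := l.comp S.subtype
  have h1 : S.map l = LinearMap.range m := by
    rw [LinearMap.range_comp, Submodule.range_subtype]
  have e : {x // x ∈ S ∧ l x = 0} ≃ LinearMap.ker m :=
    { toFun := fun x => ⟨⟨x.1, x.2.1⟩, x.2.2⟩
      invFun := fun x => ⟨x.1.1, x.1.2, x.2⟩
      left_inv := fun _ => rfl
      right_inv := fun _ => rfl }
  rw [h1, Nat.card_congr e, ← Nat.card_congr m.quotKerEquivRange.toEquiv, mul_comm,
    mul_comm, ← Submodule.card_eq_card_quotient_mul_card]

open Classical in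
theorem card_forms_aeval_eq_zero [Fintype K] [Finite L] {v : Fin 2 → L} {a γ : L} (hγ : γ ≠ 0)
    (hv : v = ![γ * a, γ] ∨ v = ![γ, γ * a]) (d : ℕ) :
    ({f ∈ binaryForms K d | aeval v f = 0}).card =
      Fintype.card K ^ (d + 1 - (minpoly K a).natDegree) := by
  have h := card_ker_mul_card_map (homogeneousSubmodule (Fin 2) K d) (aeval v).toLinearMap
  rw [map_aeval_homogeneousSubmodule hv, card_map_mulLeft (pow_ne_zero d hγ), card_powersSpan,
    Nat.subtype_card (p := fun x => x ∈ homogeneousSubmodule (Fin 2) K d ∧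
      (aeval v).toLinearMap x = 0) ({f ∈ binaryForms K d | aeval v f = 0}) (by simp),
    Nat.subtype_card (binaryForms K d) (by simp), card_binaryForms] at h
  have hq : 0 < Fintype.card K := Fintype.card_pos
  apply Nat.eq_of_mul_eq_mul_right (pow_pos hq (min (d + 1) (minpoly K a).natDegree))
  rw [h, ← pow_add]
  congr 1
  omega

open Classical in
theorem card_pairs_linear_relation [Fintype K] [Finite L] {v : Fin 2 → L} {a γ c₁ c₂ : L} (hγ : γ ≠ 0)
    (hv : v = ![γ * a, γ] ∨ v = ![γ, γ * a]) (hc₁ : c₁ ∈ Algebra.adjoin K {a})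
    (hc₂ : c₂ ∈ Algebra.adjoin K {a}) (hc : c₁ = -1 ∨ c₂ = 1) {d : ℕ}
    (hd : (minpoly K a).natDegree ≤ d + 1) :
    ({x ∈ binaryForms K d ×ˢ binaryForms K d | c₁ * aeval v x.1 + c₂ * aeval v x.2 = 0}).card =
      Fintype.card K ^ (2 * d + 2 - (minpoly K a).natDegree) := by
  set H := homogeneousSubmodule (Fin 2) K d
  let l : MvPolynomial (Fin 2) K × MvPolynomial (Fin 2) K →ₗ[K] L :=
    ((LinearMap.mulLeft K c₁).comp (aeval v).toLinearMap).coprod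
      ((LinearMap.mulLeft K c₂).comp (aeval v).toLinearMap)
  have hl : ∀ x, l x = c₁ * aeval v x.1 + c₂ * aeval v x.2 := fun x => rfl
  have himg := map_aeval_homogeneousSubmodule (K := K) hv d
  rw [powersSpan_eq_adjoin a hd] at himg
  have hmem : ∀ y, y ∈ H.map (aeval v).toLinearMap ↔
      ∃ w ∈ Algebra.adjoin K {a}, γ ^ d * w = y := by
    intro y
    rw [himg]
    rfl
  have hmap : (H.prod H).map l = H.map (aeval v).toLinearMap := by
    apply le_antisymm
    · rintro _ ⟨x, ⟨hx1, hx2⟩, rfl⟩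
      obtain ⟨w1, hw1, e1⟩ := (hmem _).mp ⟨_, hx1, rfl⟩
      obtain ⟨w2, hw2, e2⟩ := (hmem _).mp ⟨_, hx2, rfl⟩
      rw [AlgHom.toLinearMap_apply] at e1 e2
      rw [hmem, hl, ← e1, ← e2]
      exact ⟨c₁ * w1 + c₂ * w2, add_mem (mul_mem hc₁ hw1) (mul_mem hc₂ hw2), by ring⟩
    · rintro _ ⟨f, hf, rfl⟩
      rcases hc with rfl | rfl
      · exact ⟨(-f, 0), ⟨H.neg_mem hf, H.zero_mem⟩, by simp [hl]⟩
      · exact ⟨(0, f), ⟨H.zero_mem, hf⟩, by simp [hl]⟩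
  have h := card_ker_mul_card_map (H.prod H) l
  rw [hmap, himg, card_map_mulLeft (pow_ne_zero d hγ), ← powersSpan_eq_adjoin a le_rfl,
    card_powersSpan, min_self,
    Nat.subtype_card (p := fun x => x ∈ H.prod H ∧ l x = 0)
      ({x ∈ binaryForms K d ×ˢ binaryForms K d | c₁ * aeval v x.1 + c₂ * aeval v x.2 = 0})
      (by simp [H, hl]),
    Nat.subtype_card (binaryForms K d ×ˢ binaryForms K d) (by simp [H]),
    Finset.card_product, card_binaryForms] at h
  have hq : 0 < Fintype.card K := Fintype.card_pos
  apply Nat.eq_of_mul_eq_mul_right (pow_pos hq (minpoly K a).natDegree)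
  rw [h, ← pow_add, ← pow_add]
  congr 1
  omega

end Evaluation

section Recurrence

open PowerSeries

/-- If the counts of coprime pairs (`N`), of coprime pairs on a linear condition (`M`) and of all
nonzero pairs on that condition (`T`) are related by splitting off greatest common divisors, then
`M d - N d / (q ^ u + 1)` is periodic in `d ≥ 1`. -/
theorem periodic_error_of_convolution_identities {q : ℝ} (hq : 2 ≤ q) {u : ℕ} (hu : 1 ≤ u)
    {A B N M T : ℕ → ℝ}
    (hA : ∀ d, A d = q ^ (d + 1) - 1) (hB : ∀ d, B d = q ^ (d + 1 - u) - 1)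
    (hN : ∀ d, (q ^ (2 * d + 2) - 1) * (q - 1) =
      ∑ e ∈ Finset.HasAntidiagonal.antidiagonal d, A e.1 * N e.2)
    (hM : ∀ d, T d * (q - 1) = ∑ e ∈ Finset.HasAntidiagonal.antidiagonal d,
      (A e.1 * M e.2 + B e.1 * N e.2 - B e.1 * M e.2))
    (hT : ∀ d, u ≤ d + 1 → T d = q ^ (2 * d + 2 - u) - 1) :
    (∀ d, q ^ d ≤ N d) ∧
      ∀ m, M (m + 1 + u) - N (m + 1 + u) / (q ^ u + 1) = M (m + 1) - N (m + 1) / (q ^ u + 1) := by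
  have hq1 : q - 1 ≠ 0 := by linarith
  have hC : (PowerSeries.C (q - 1) : PowerSeries ℝ) ≠ 0 := by
    intro h
    apply hq1
    simpa using congrArg constantCoeff h
  let E : PowerSeries ℝ := 1 - PowerSeries.C (1 + q) * X + PowerSeries.C q * (X * X)
  have hE : ∀ (F : ℕ → ℝ) n, coeff (n + 2) (PowerSeries.mk F * E) =
      F (n + 2) - (1 + q) * F (n + 1) + q * F n := by
    intro F n
    have : PowerSeries.mk F * E = PowerSeries.mk F - PowerSeries.C (1 + q) * (X * PowerSeries.mk F)
        + PowerSeries.C q * (X * (X * PowerSeries.mk F)) := by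
      simp only [E]
      ring
    rw [this, map_add, map_sub, coeff_C_mul, coeff_C_mul, coeff_succ_X_mul, coeff_succ_X_mul,
      coeff_succ_X_mul, coeff_mk, coeff_mk, coeff_mk]
  have hE1 : ∀ (F : ℕ → ℝ), coeff 1 (PowerSeries.mk F * E) = F 1 - (1 + q) * F 0 := by
    intro F
    have : PowerSeries.mk F * E = PowerSeries.mk F - PowerSeries.C (1 + q) * (X * PowerSeries.mk F)
        + PowerSeries.C q * (X * (X * PowerSeries.mk F)) := by
      simp only [E]
      ring
    rw [this, map_add, map_sub, coeff_C_mul, coeff_C_mul, coeff_mk, ← zero_add 1,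
      coeff_succ_X_mul, coeff_succ_X_mul, coeff_zero_X_mul, coeff_mk]
    simp
  have hE0 : ∀ (F : ℕ → ℝ), coeff 0 (PowerSeries.mk F * E) = F 0 := by
    intro F
    simp [E]
  have hAE : PowerSeries.mk A * E = PowerSeries.C (q - 1) := by
    ext n
    rcases n with _ | _ | n
    · rw [hE0, hA]
      simp
    · rw [hE1, hA, hA, coeff_C]
      simp
      ring
    · rw [hE, hA, hA, hA, coeff_C]
      simp
      ring
  have hB' : PowerSeries.mk B = X ^ u * PowerSeries.mk A := by
    ext n
    rw [coeff_X_pow_mul', coeff_mk, hB]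
    split_ifs with h
    · rw [coeff_mk, hA, show n + 1 - u = n - u + 1 by omega]
    · rw [show n + 1 - u = 0 by omega]
      simp
  have hN' : PowerSeries.mk N = PowerSeries.mk (fun d => q ^ (2 * d + 2) - 1) * E := by
    have h1 : PowerSeries.mk A * PowerSeries.mk N =
        PowerSeries.C (q - 1) * PowerSeries.mk (fun d => q ^ (2 * d + 2) - 1) := by
      ext n
      rw [coeff_mul, coeff_C_mul, coeff_mk, mul_comm, hN]
      simp only [coeff_mk]
    apply mul_left_cancel₀ hC
    linear_combination E * h1 - PowerSeries.mk N * hAE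
  have hM' : PowerSeries.mk M - X ^ u * PowerSeries.mk M + X ^ u * PowerSeries.mk N =
      PowerSeries.mk T * E := by
    have h1 : PowerSeries.mk A * PowerSeries.mk M + PowerSeries.mk B * PowerSeries.mk N -
        PowerSeries.mk B * PowerSeries.mk M = PowerSeries.C (q - 1) * PowerSeries.mk T := by
      ext n
      rw [map_sub, map_add, coeff_mul, coeff_mul, coeff_mul, coeff_C_mul, coeff_mk, mul_comm, hM,
        ← Finset.sum_add_distrib, ← Finset.sum_sub_distrib]
      simp only [coeff_mk]
    rw [hB'] at h1
    apply mul_left_cancel₀ hC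
    linear_combination E * h1 - (PowerSeries.mk M - X ^ u * PowerSeries.mk M +
      X ^ u * PowerSeries.mk N) * hAE
  have N0 : N 0 = q ^ 2 - 1 := by
    have := congrArg (coeff 0) hN'
    rwa [coeff_mk, hE0] at this
  have Ns : ∀ d, N (d + 1) = (q ^ 2 - 1) * (q - 1) * q ^ (2 * d + 1) := by
    intro d
    have := congrArg (coeff (d + 1)) hN'
    rcases d with _ | d
    · rw [coeff_mk, hE1] at this
      rw [this]
      ring
    · rw [coeff_mk, hE] at this
      rw [this]
      ring
  have hqu : q ^ u + 1 ≠ 0 := by positivity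
  refine ⟨?_, ?_⟩
  · intro d
    rcases d with _ | d
    · rw [N0]
      nlinarith
    · rw [Ns]
      have h1 : 1 ≤ (q ^ 2 - 1) * (q - 1) := by nlinarith
      have h2 : q ^ (d + 1) ≤ q ^ (2 * d + 1) := pow_le_pow_right₀ (by linarith) (by omega)
      have h3 : 0 < q ^ (2 * d + 1) := by positivity
      nlinarith
  · intro m
    have h1 := congrArg (coeff (m + 1 + u)) hM'
    obtain ⟨n, hn⟩ : ∃ n, m + 1 + u = n + 2 := ⟨m + u - 1, by omega⟩
    rw [map_add, map_sub, coeff_X_pow_mul, coeff_X_pow_mul, coeff_mk, coeff_mk, coeff_mk, hn, hE,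
      hT _ (by omega), hT _ (by omega), hT _ (by omega), ← hn,
      show 2 * (m + 1 + u) + 2 - u = 2 * m + 4 + u by omega,
      show 2 * (n + 1) + 2 - u = 2 * m + 2 + u by omega,
      show 2 * n + 2 - u = 2 * m + u by omega] at h1
    have h2 : N (m + 1 + u) = q ^ (2 * u) * N (m + 1) := by
      rw [show m + 1 + u = m + u + 1 by omega, Ns, Ns]
      ring
    have h3 := Ns m
    rw [h2]
    field_simp
    have h4 : M (m + 1 + u) = M (m + 1) - N (m + 1) + q ^ u * N (m + 1) := by
      rw [h3] at h1 ⊢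
      linear_combination h1
    rw [h4]
    ring

theorem exists_bound_of_eventually_periodic {u : ℕ} (hu : 1 ≤ u) (δ : ℕ → ℝ)
    (h : ∀ m, δ (m + 1 + u) = δ (m + 1)) : ∃ C, 0 < C ∧ ∀ d, |δ d| ≤ C := by
  refine ⟨1 + ∑ i ∈ Finset.range (u + 1), |δ i|, ?_, ?_⟩
  · have : 0 ≤ ∑ i ∈ Finset.range (u + 1), |δ i| := Finset.sum_nonneg fun _ _ => abs_nonneg _
    linarith
  · intro d
    induction d using Nat.strong_induction_on with
    | _ d ih =>
      by_cases hd : d < u + 1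
      · have := Finset.single_le_sum (f := fun i => |δ i|) (fun i _ => abs_nonneg (δ i))
          (Finset.mem_range.mpr hd)
        linarith
      · obtain ⟨m, rfl⟩ : ∃ m, d = m + 1 + u := ⟨d - 1 - u, by omega⟩
        rw [h]
        exact ih _ (by omega)

end Recurrence

section Proportion

open MvPolynomial

theorem card_filter_product_or {α β : Type*} [DecidableEq α] [DecidableEq β] (s : Finset α)
    (t : Finset β) (P : α → Prop) (R : β → Prop) [DecidablePred P] [DecidablePred R] :
    ({y ∈ s ×ˢ t | P y.1 ∨ R y.2}).card + (s.filter P).card * (t.filter R).card =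
      s.card * (t.filter R).card + (s.filter P).card * t.card := by
  have h1 : ({y ∈ s ×ˢ t | P y.1 ∨ R y.2}) = s ×ˢ t.filter R ∪ s.filter P ×ˢ t := by
    ext y
    simp only [Finset.mem_filter, Finset.mem_product, Finset.mem_union]
    tauto
  have h2 : s.filter P ×ˢ t.filter R = (s ×ˢ t.filter R) ∩ (s.filter P ×ˢ t) := by
    ext y
    simp only [Finset.mem_filter, Finset.mem_product, Finset.mem_inter]
    tauto
  rw [← Finset.card_product, ← Finset.card_product, ← Finset.card_product, h1, h2,
    Finset.card_union_add_card_inter]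

open Classical in
theorem exists_bound_coprimeForms_proportion {K L : Type*} [Field K] [Fintype K] [Field L]
    [Finite L] [Algebra K L] {v : Fin 2 → L} {a γ c₁ c₂ : L} (hγ : γ ≠ 0)
    (hv : v = ![γ * a, γ] ∨ v = ![γ, γ * a]) (hc₁ : c₁ ∈ Algebra.adjoin K {a})
    (hc₂ : c₂ ∈ Algebra.adjoin K {a}) (hc : c₁ = -1 ∨ c₂ = 1) :
    ∃ C : ℝ, 0 < C ∧ ∀ d : ℕ,
      |(({x ∈ coprimeForms K d | c₁ * aeval v x.1 + c₂ * aeval v x.2 = 0}).card : ℝ) /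
          (coprimeForms K d).card -
        1 / ((Fintype.card K : ℝ) ^ (minpoly K a).natDegree + 1)| ≤
      C / (Fintype.card K : ℝ) ^ d := by
  set q := Fintype.card K with hq
  set u := (minpoly K a).natDegree with hu
  have hq2 : 2 ≤ q := Fintype.one_lt_card
  have hu1 : 1 ≤ u := minpoly.natDegree_pos (IsIntegral.of_finite K a)
  let φ : MvPolynomial (Fin 2) K × MvPolynomial (Fin 2) K → L :=
    fun x => c₁ * aeval v x.1 + c₂ * aeval v x.2
  have cast_sub : ((q - 1 : ℕ) : ℝ) = (q : ℝ) - 1 := by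
    rw [Nat.cast_sub (by omega), Nat.cast_one]
  have herase : ∀ (s : Finset (MvPolynomial (Fin 2) K)), 0 ∈ s →
      ((s.erase 0).card : ℝ) = s.card - 1 := by
    intro s hs
    rw [Finset.card_erase_of_mem hs, Nat.cast_sub (Finset.card_pos.mpr ⟨_, hs⟩), Nat.cast_one]
  have hpairs : ∀ (s : Finset (MvPolynomial (Fin 2) K × MvPolynomial (Fin 2) K)), 0 ∈ s →
      ((s.erase 0).card : ℝ) = s.card - 1 := by
    intro s hs
    rw [Finset.card_erase_of_mem hs, Nat.cast_sub (Finset.card_pos.mpr ⟨_, hs⟩), Nat.cast_one]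
  obtain ⟨hN, hper⟩ := periodic_error_of_convolution_identities (q := q) (by exact_mod_cast hq2) hu1
    (A := fun d => ((binaryForms K d).erase 0).card)
    (B := fun d => (((binaryForms K d).erase 0).filter fun f => aeval v f = 0).card)
    (N := fun d => (coprimeForms K d).card)
    (M := fun d => ((coprimeForms K d).filter fun x => φ x = 0).card)
    (T := fun d => ({x ∈ binaryForms K d ×ˢ binaryForms K d | x ≠ 0 ∧ φ x = 0}).card)
    (by
      intro d
      rw [herase _ (by simp [isHomogeneous_zero]), card_binaryForms]
      push_cast
      rfl)
    (by
      intro d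
      rw [Finset.filter_erase, herase _ (by simp [isHomogeneous_zero]),
        card_forms_aeval_eq_zero hγ hv]
      push_cast
      rfl)
    (by
      intro d
      have h : ((binaryForms K d ×ˢ binaryForms K d).erase 0).card * (q - 1) =
          ∑ e ∈ Finset.HasAntidiagonal.antidiagonal d,
            ((binaryForms K e.1).erase 0).card * (coprimeForms K e.2).card := by
        have h := card_nonzero_pairs_eq_sum_coprimeForms K d (fun _ => True)
        simp only [Finset.filter_true, Finset.card_product] at h
        rw [← h]
        congr 2
        ext x
        simp [and_comm]
      have h := congrArg (Nat.cast : ℕ → ℝ) h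
      rw [Nat.cast_mul, hpairs _ (by simp [isHomogeneous_zero]), Finset.card_product,
        card_binaryForms, cast_sub] at h
      push_cast at h
      rw [← h]
      ring)
    (by
      intro d
      have h := congrArg (Nat.cast : ℕ → ℝ)
        (card_nonzero_pairs_eq_sum_coprimeForms K d (fun x => φ x = 0))
      rw [Nat.cast_mul, cast_sub, Nat.cast_sum] at h
      rw [h]
      refine Finset.sum_congr rfl fun e _ => ?_
      have h1 := congrArg (Nat.cast : ℕ → ℝ) (card_filter_product_or ((binaryForms K e.1).erase 0)
        (coprimeForms K e.2) (fun f => aeval v f = 0) (fun x => φ x = 0))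
      have h2 : ∀ y : MvPolynomial (Fin 2) K × MvPolynomial (Fin 2) K × MvPolynomial (Fin 2) K,
          φ (y.1 * y.2.1, y.1 * y.2.2) = 0 ↔ aeval v y.1 = 0 ∨ φ y.2 = 0 := by
        intro y
        rw [← mul_eq_zero]
        simp only [φ, map_mul]
        ring_nf
      simp only [h2]
      push_cast at h1
      linarith)
    (by
      intro d hd
      have h0 : ({x ∈ binaryForms K d ×ˢ binaryForms K d | x ≠ 0 ∧ φ x = 0}) =
          ({x ∈ binaryForms K d ×ˢ binaryForms K d | φ x = 0}).erase 0 := by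
        ext x
        simp only [Finset.mem_filter, Finset.mem_erase]
        tauto
      rw [h0, hpairs _ (by simp [isHomogeneous_zero, φ]),
        card_pairs_linear_relation hγ hv hc₁ hc₂ hc hd]
      push_cast
      rfl)
  obtain ⟨C, hC, hb⟩ := exists_bound_of_eventually_periodic hu1
    (fun d => (((coprimeForms K d).filter fun x => φ x = 0).card : ℝ) -
      (coprimeForms K d).card / ((q : ℝ) ^ u + 1)) hper
  refine ⟨C, hC, fun d => ?_⟩
  have hqd : (0 : ℝ) < (q : ℝ) ^ d := by positivity
  have hNd := hN d
  have hNpos := hqd.trans_le hNd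
  have h1 := hb d
  calc _ = |(((coprimeForms K d).filter fun x => φ x = 0).card : ℝ) -
          (coprimeForms K d).card / ((q : ℝ) ^ u + 1)| / (coprimeForms K d).card := by
        nth_rewrite 3 [← abs_of_pos hNpos]
        rw [← abs_div, sub_div, div_div_cancel_left' hNpos.ne', one_div]
    _ ≤ C / (q : ℝ) ^ d := by gcongr

end Proportion

open Classical MvPolynomial in
/-- For the full family of coprime pairs of homogeneous degree-`d` polynomials, and
`α ∈ P¹(F_{q^k})` of degree `u`, the proportion of pairs with `g/h` taking the value
`β` at `α` is `q^{−u}/(1+q^{−u}) + O(q^{(ε−1)d+u})` for `β = ∞`, and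
`q^{−u}/(1+q^{−u}) + O(q^{(ε−1)d})` for `β ∈ F_{q^u}`. -/
theorem full_family_value_proportion (p q k u : ℕ) (hp : p.Prime) (hodd : Odd p)
    (hq : ∃ a : ℕ, 0 < a ∧ q = p ^ a)
    (K L : Type) [Field K] [Fintype K] [Field L] [Fintype L] [Algebra K L]
    (hK : Fintype.card K = q) (hL : Fintype.card L = q ^ k)
    (αX αZ : L) (hα : (αX, αZ) ≠ 0)
    (hu : u = if αZ = 0 then 1 else (minpoly K (αX / αZ)).natDegree) :
    (∀ ε : ℝ, 0 < ε → ∃ C : ℝ, 0 < C ∧ ∀ d : ℕ,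
      |(Nat.card {gh : MvPolynomial (Fin 2) K × MvPolynomial (Fin 2) K //
            gh.1.IsHomogeneous d ∧ gh.2.IsHomogeneous d ∧ IsRelPrime gh.1 gh.2 ∧
            aeval ![αX, αZ] gh.2 = 0} : ℝ) /
          (Nat.card {gh : MvPolynomial (Fin 2) K × MvPolynomial (Fin 2) K //
            gh.1.IsHomogeneous d ∧ gh.2.IsHomogeneous d ∧ IsRelPrime gh.1 gh.2} : ℝ)
          - (q : ℝ) ^ (-(u : ℝ)) / (1 + (q : ℝ) ^ (-(u : ℝ)))|
        ≤ C * (q : ℝ) ^ ((ε - 1) * d + u)) ∧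
    (∀ β : L, β ∈ Algebra.adjoin K ({αX / αZ} : Set L) →
      ∀ ε : ℝ, 0 < ε → ∃ C : ℝ, 0 < C ∧ ∀ d : ℕ,
      |(Nat.card {gh : MvPolynomial (Fin 2) K × MvPolynomial (Fin 2) K //
            gh.1.IsHomogeneous d ∧ gh.2.IsHomogeneous d ∧ IsRelPrime gh.1 gh.2 ∧
            β * aeval ![αX, αZ] gh.2 - aeval ![αX, αZ] gh.1 = 0} : ℝ) /
          (Nat.card {gh : MvPolynomial (Fin 2) K × MvPolynomial (Fin 2) K //
            gh.1.IsHomogeneous d ∧ gh.2.IsHomogeneous d ∧ IsRelPrime gh.1 gh.2} : ℝ)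
          - (q : ℝ) ^ (-(u : ℝ)) / (1 + (q : ℝ) ^ (-(u : ℝ)))|
        ≤ C * (q : ℝ) ^ ((ε - 1) * d)) := by
  have hu' : u = (minpoly K (αX / αZ)).natDegree := by
    rw [hu]
    split_ifs with h
    · rw [h, div_zero, minpoly.zero, Polynomial.natDegree_X]
    · rfl
  clear hu
  obtain ⟨γ, hγ, hv⟩ : ∃ γ : L, γ ≠ 0 ∧ (![αX, αZ] = ![γ * (αX / αZ), γ] ∨
      ![αX, αZ] = ![γ, γ * (αX / αZ)]) := by
    by_cases hZ : αZ = 0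
    · refine ⟨αX, fun hX => hα (by simp [hX, hZ]), Or.inr (by simp [hZ])⟩
    · exact ⟨αZ, hZ, Or.inl (by rw [mul_div_cancel₀ _ hZ])⟩
  have hq2 : 2 ≤ q := hK ▸ Fintype.one_lt_card
  have hq1 : (1 : ℝ) ≤ q := by
    exact_mod_cast (by omega : 1 ≤ q)
  have hmain : (q : ℝ) ^ (-(u : ℝ)) / (1 + (q : ℝ) ^ (-(u : ℝ))) =
      1 / ((q : ℝ) ^ u + 1) := by
    rw [Real.rpow_neg (by positivity), Real.rpow_natCast]
    have : (q : ℝ) ^ u ≠ 0 := by positivity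
    field_simp
  have hexp : ∀ (ε : ℝ) (d : ℕ), 0 < ε → 1 / (q : ℝ) ^ d ≤ (q : ℝ) ^ ((ε - 1) * d) := by
    intro ε d hε
    rw [one_div, ← Real.rpow_natCast, ← Real.rpow_neg (by positivity)]
    apply Real.rpow_le_rpow_of_exponent_le hq1
    nlinarith [(Nat.cast_nonneg d : (0 : ℝ) ≤ d)]
  have hden : ∀ d, Nat.card {gh : MvPolynomial (Fin 2) K × MvPolynomial (Fin 2) K //
      gh.1.IsHomogeneous d ∧ gh.2.IsHomogeneous d ∧ IsRelPrime gh.1 gh.2} =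
      (coprimeForms K d).card := fun d => Nat.subtype_card _ fun x => mem_coprimeForms
  rw [hmain]
  simp only [hden]
  subst hK hu'
  refine ⟨fun ε hε => ?_, fun β hβ ε hε => ?_⟩
  · obtain ⟨C, hC, h⟩ := exists_bound_coprimeForms_proportion (K := K) hγ hv (zero_mem _) (one_mem _)
      (Or.inr rfl)
    refine ⟨C, hC, fun d => ?_⟩
    rw [Nat.subtype_card ({x ∈ coprimeForms K d |
      0 * aeval ![αX, αZ] x.1 + 1 * aeval ![αX, αZ] x.2 = 0})
      fun x => by simp [mem_coprimeForms, and_assoc]]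
    refine (h d).trans ?_
    rw [div_eq_mul_one_div]
    refine mul_le_mul_of_nonneg_left ((hexp ε d hε).trans ?_) hC.le
    exact Real.rpow_le_rpow_of_exponent_le hq1 (by simp)
  · obtain ⟨C, hC, h⟩ := exists_bound_coprimeForms_proportion (K := K) hγ hv
      (neg_mem (one_mem _)) hβ (Or.inl rfl)
    refine ⟨C, hC, fun d => ?_⟩
    rw [Nat.subtype_card ({x ∈ coprimeForms K d |
      -1 * aeval ![αX, αZ] x.1 + β * aeval ![αX, αZ] x.2 = 0})
      fun x => by simp [mem_coprimeForms, and_assoc, sub_eq_neg_add]]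
    refine (h d).trans ?_
    rw [div_eq_mul_one_div]
    exact mul_le_mul_of_nonneg_left (hexp ε d hε) hC.le
end

section
/- Fix α ∈ P^1(F_{q^k}) of degree u over F_q and β ∈ P^1(F_{q^u}). For the family F_d^{ord} of pairs (g,h) of homogeneous degree-d polynomials with h square-free and gcd(g,h) = 1, the proportion |F_d^{ord}(α,β)|/|F_d^{ord}| equals q^{−u}(1 − q^{−u})/(1 + q^{−u} − q^{−2u}) + O(q^{(−1/2+ε)d + u}) if β = ∞, and q^{−u}/(1 + q^{−u} − q^{−2u}) + O(q^{(−1/2+ε)d}) if β ∈ F_{q^u}. -/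
namespace SquarefreeCount

open Polynomial UniqueFactorizationMonoid
open scoped Classical

section Avoids

variable {K : Type} [Field K]

/-- No element of `s` divides `f`. -/
def Avoids (s : Finset K[X]) (f : K[X]) : Prop := ∀ P ∈ s, ¬ P ∣ f

theorem avoids_insert {s : Finset K[X]} {P f : K[X]} :
    Avoids (insert P s) f ↔ ¬ P ∣ f ∧ Avoids s f := by
  simp [Avoids]

theorem avoids_mul {s : Finset K[X]} (hs : ∀ Q ∈ s, Irreducible Q ∧ Q.Monic) {P : K[X]}
    (hP : Irreducible P ∧ P.Monic) (hPs : P ∉ s) (f : K[X]) :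
    Avoids s (P * f) ↔ Avoids s f := by
  refine forall₂_congr fun Q hQ => not_congr ⟨fun h => ?_, fun h => h.mul_left P⟩
  refine ((hs Q hQ).1.prime.dvd_or_dvd h).resolve_left fun h' => hPs ?_
  rwa [eq_of_monic_of_associated hP.2 (hs Q hQ).2
    ((hs Q hQ).1.associated_of_dvd hP.1 h').symm]

end Avoids

section Counting

variable (K : Type) [Field K] [Fintype K]

theorem finite_setOf_degree_lt (m : ℕ) : {f : K[X] | f.degree < m}.Finite := by
  have : Finite (degreeLT K m) := Finite.of_equiv _ (degreeLTEquiv K m).toEquiv.symm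
  refine (Set.toFinite (degreeLT K m : Set K[X])).subset fun f hf => ?_
  simpa [mem_degreeLT] using hf

/-- The polynomials of degree less than `m`. -/
noncomputable def polysLT (m : ℕ) : Finset K[X] := (finite_setOf_degree_lt K m).toFinset

/-- The nonzero polynomials of degree exactly `n`. -/
noncomputable def polysEq (n : ℕ) : Finset K[X] := {f ∈ polysLT K (n + 1) | f.degree = n}

variable {K}

@[simp] theorem mem_polysLT {m : ℕ} {f : K[X]} : f ∈ polysLT K m ↔ f.degree < m := by
  simp [polysLT]

@[simp] theorem mem_polysEq {n : ℕ} {f : K[X]} : f ∈ polysEq K n ↔ f.degree = n := by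
  simp only [polysEq, Finset.mem_filter, mem_polysLT, and_iff_right_iff_imp]
  intro h
  rw [h]
  exact_mod_cast Nat.lt_succ_self n

theorem ne_zero_of_mem_polysEq {n : ℕ} {f : K[X]} (hf : f ∈ polysEq K n) : f ≠ 0 := by
  rintro rfl
  simp at hf

theorem card_polysLT (m : ℕ) : (polysLT K m).card = Fintype.card K ^ m := by
  have h : Nat.card (degreeLT K m) = Fintype.card K ^ m := by
    rw [Nat.card_congr (degreeLTEquiv K m).toEquiv]
    simp
  rw [← h, polysLT, ← Nat.card_eq_card_finite_toFinset (finite_setOf_degree_lt K m)]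
  exact Nat.card_congr (Equiv.subtypeEquivRight fun f => by simp [mem_degreeLT])

theorem polysLT_succ (m : ℕ) : polysLT K (m + 1) = polysLT K m ∪ polysEq K m := by
  ext f
  simp only [mem_polysLT, Finset.mem_union, mem_polysEq]
  rcases eq_or_ne f 0 with rfl | hf
  · simp
  · rw [degree_eq_natDegree hf]
    norm_cast
    omega

theorem disjoint_polysLT_polysEq (m : ℕ) : Disjoint (polysLT K m) (polysEq K m) := by
  rw [Finset.disjoint_left]
  intro f h1 h2
  rw [mem_polysLT] at h1
  rw [mem_polysEq] at h2
  exact h1.ne h2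

theorem card_polysEq (n : ℕ) :
    ((polysEq K n).card : ℝ) = ((Fintype.card K : ℝ) - 1) * (Fintype.card K : ℝ) ^ n := by
  have h := Finset.card_union_of_disjoint (disjoint_polysLT_polysEq (K := K) n)
  rw [← polysLT_succ, card_polysLT, card_polysLT] at h
  have : (Fintype.card K : ℝ) ^ (n + 1) = (Fintype.card K : ℝ) ^ n + (polysEq K n).card := by
    exact_mod_cast h
  linear_combination -this

end Counting

section GeneratingSeries

variable {K : Type} [Field K] [Fintype K]

/-- The generating series of the sums of `φ` over the polynomials of each degree. -/
noncomputable def genSeries (φ : K[X] → ℝ) : PowerSeries ℝ :=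
  PowerSeries.mk fun n => ∑ f ∈ polysEq K n, φ f

theorem sum_polysEq_dvd (φ : K[X] → ℝ) {P : K[X]} (hP : P ≠ 0) (n : ℕ) :
    ∑ f ∈ polysEq K n, (if P ∣ f then φ f else 0) =
      if P.natDegree ≤ n then ∑ f ∈ polysEq K (n - P.natDegree), φ (P * f) else 0 := by
  rw [← Finset.sum_filter]
  split_ifs with h
  · symm
    refine Finset.sum_bij (fun f _ => P * f) ?_ ?_ ?_ ?_
    · intro f hf
      simp only [mem_polysEq] at hf
      simp only [Finset.mem_filter, mem_polysEq, degree_mul, hf, degree_eq_natDegree hP,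
        dvd_mul_right, and_true]
      exact_mod_cast Nat.add_sub_of_le h
    · intro f _ g _ hfg
      exact mul_left_cancel₀ hP hfg
    · intro f hf
      simp only [Finset.mem_filter, mem_polysEq] at hf
      obtain ⟨h1, g, rfl⟩ := hf
      refine ⟨g, ?_, rfl⟩
      have hg : g ≠ 0 := by
        rintro rfl
        simp at h1
      rw [mem_polysEq, degree_eq_natDegree hg]
      rw [degree_mul, degree_eq_natDegree hP, degree_eq_natDegree hg] at h1
      norm_cast at h1 ⊢
      omega
    · intros
      rfl
  · refine Finset.sum_eq_zero fun f hf => ?_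
    simp only [Finset.mem_filter, mem_polysEq] at hf
    obtain ⟨h1, h2⟩ := hf
    have hf0 : f ≠ 0 := by
      rintro rfl
      simp at h1
    have := natDegree_le_of_dvd h2 hf0
    rw [natDegree_eq_of_degree_eq_some h1] at this
    exact absurd this h

theorem genSeries_dvd (φ : K[X] → ℝ) {P : K[X]} (hP : P ≠ 0) :
    genSeries (fun f => if P ∣ f then φ f else 0) =
      PowerSeries.X ^ P.natDegree * genSeries (fun f => φ (P * f)) := by
  ext n
  simp only [genSeries, PowerSeries.coeff_X_pow_mul', PowerSeries.coeff_mk, sum_polysEq_dvd φ hP]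

theorem genSeries_add (φ ψ : K[X] → ℝ) :
    genSeries (fun f => φ f + ψ f) = genSeries φ + genSeries ψ := by
  ext n
  simp [genSeries, Finset.sum_add_distrib]

theorem genSeries_const_mul (c : ℝ) (φ : K[X] → ℝ) :
    genSeries (fun f => c * φ f) = PowerSeries.C c * genSeries φ := by
  ext n
  simp [genSeries, Finset.mul_sum]

/-- The local weight `1 - |P|⁻¹` of a prime. -/
noncomputable def localWeight (P : K[X]) : ℝ := 1 - ((Fintype.card K : ℝ) ^ P.natDegree)⁻¹

/-- The product of the local weights of the prime factors of `f`. -/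
noncomputable def weight (f : K[X]) : ℝ := ((normalizedFactors f).map localWeight).prod

/-- The weight of `f`, or zero if `f` is not square-free. -/
noncomputable def sqfWeight (f : K[X]) : ℝ := if Squarefree f then weight f else 0

theorem weight_mul {P f : K[X]} (hP : Irreducible P ∧ P.Monic) (hf : f ≠ 0) :
    weight (P * f) = localWeight P * weight f := by
  rw [weight, normalizedFactors_mul hP.1.ne_zero hf, normalizedFactors_irreducible hP.1,
    hP.2.normalize_eq_self]
  simp [weight]

theorem sqfWeight_mul {P f : K[X]} (hP : Irreducible P ∧ P.Monic) :
    sqfWeight (P * f) = localWeight P * (if P ∣ f then 0 else sqfWeight f) := by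
  rcases eq_or_ne f 0 with rfl | hf
  · simp [sqfWeight]
  · by_cases h : P ∣ f
    · have : ¬ Squarefree (P * f) := fun hsq =>
        hP.1.not_isUnit (hsq P (mul_dvd_mul_left P h))
      simp [sqfWeight, h, this]
    · have hc : IsRelPrime P f := (hP.1.coprime_iff_not_dvd.2 h).isRelPrime
      simp only [sqfWeight, h, if_false, squarefree_mul_iff, hc, hP.1.squarefree, true_and,
        weight_mul hP hf]
      split_ifs <;> simp

theorem genSeries_avoids_one (s : Finset K[X]) (hs : ∀ Q ∈ s, Irreducible Q ∧ Q.Monic) :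
    genSeries (fun f => if Avoids s f then 1 else 0) =
      (∏ P ∈ s, (1 - PowerSeries.X ^ P.natDegree)) * genSeries (K := K) (fun _ => 1) := by
  induction s using Finset.induction_on with
  | empty => simp [Avoids]
  | insert P s hPs ih =>
    simp only [Finset.forall_mem_insert] at hs
    have key := genSeries_dvd (fun f => if Avoids s f then 1 else 0) hs.1.1.ne_zero
    simp only [avoids_mul hs.2 hs.1 hPs] at key
    rw [Finset.prod_insert hPs, mul_assoc, ← ih hs.2, sub_mul, one_mul, ← key, eq_sub_iff_add_eq,
      ← genSeries_add]
    congr 1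
    ext f
    simp only [avoids_insert]
    by_cases h1 : P ∣ f <;> by_cases h2 : Avoids s f <;> simp [h1, h2]

theorem genSeries_sqfWeight_eq (s : Finset K[X]) (hs : ∀ Q ∈ s, Irreducible Q ∧ Q.Monic) :
    genSeries (K := K) sqfWeight =
      (∏ P ∈ s, (1 + PowerSeries.C (localWeight P) * PowerSeries.X ^ P.natDegree)) *
        genSeries (K := K) (fun f => if Avoids s f then sqfWeight f else 0) := by
  induction s using Finset.induction_on with
  | empty => simp [Avoids]
  | insert P s hPs ih =>
    simp only [Finset.forall_mem_insert] at hs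
    have key := genSeries_dvd (fun f => if Avoids s f then sqfWeight f else 0) hs.1.1.ne_zero
    have h2 : ∀ f, (if Avoids s (P * f) then sqfWeight (P * f) else 0) =
        localWeight P * if Avoids (insert P s) f then sqfWeight f else 0 := by
      intro f
      rw [avoids_mul hs.2 hs.1 hPs, sqfWeight_mul hs.1, avoids_insert]
      by_cases h1 : P ∣ f <;> by_cases h2 : Avoids s f <;> simp [h1, h2]
    simp only [h2, genSeries_const_mul] at key
    rw [ih hs.2, Finset.prod_insert hPs, mul_comm (_ + _), mul_assoc, add_mul, one_mul,
      mul_comm (PowerSeries.C _), mul_assoc, ← key, ← genSeries_add]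
    congr 2
    ext f
    simp only [avoids_insert]
    by_cases h1 : P ∣ f <;> by_cases h2 : Avoids s f <;> simp [h1, h2]

/-- The monic irreducible polynomials of degree at most `N`. -/
noncomputable def primesLE (K : Type) [Field K] [Fintype K] (N : ℕ) : Finset K[X] :=
  {P ∈ polysLT K (N + 1) | Irreducible P ∧ P.Monic}

theorem primesLE_spec {N : ℕ} : ∀ P ∈ primesLE K N, Irreducible P ∧ P.Monic := fun P hP => by
  simpa using (Finset.mem_filter.1 hP).2

theorem natDegree_eq_zero_of_avoids_primesLE {N n : ℕ} (hn : n ≤ N) {f : K[X]}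
    (hf : f ∈ polysEq K n) (h : Avoids (primesLE K N) f) : n = 0 := by
  have hf0 := ne_zero_of_mem_polysEq hf
  rw [mem_polysEq] at hf
  by_contra hn0
  have hu : ¬ IsUnit f := by
    rw [isUnit_iff_degree_eq_zero, hf]
    exact_mod_cast hn0
  obtain ⟨P, hP⟩ := exists_mem_normalizedFactors hf0 hu
  rw [Polynomial.mem_normalizedFactors_iff hf0] at hP
  refine h P ?_ hP.2.2
  have hdeg := degree_le_of_dvd hP.2.2 hf0
  rw [primesLE, Finset.mem_filter, mem_polysLT]
  refine ⟨hdeg.trans_lt ?_, hP.1, hP.2.1⟩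
  rw [hf]
  exact_mod_cast Nat.lt_succ_of_le hn

theorem coeff_genSeries_avoids {φ : K[X] → ℝ} {N n : ℕ} (hn : n ≤ N) (hn0 : n ≠ 0) :
    PowerSeries.coeff n (genSeries fun f => if Avoids (primesLE K N) f then φ f else 0) = 0 := by
  rw [genSeries, PowerSeries.coeff_mk]
  refine Finset.sum_eq_zero fun f hf => if_neg fun h => hn0 ?_
  exact natDegree_eq_zero_of_avoids_primesLE hn hf h

theorem coeff_zero_genSeries_avoids {φ : K[X] → ℝ} (hφ : ∀ f, IsUnit f → φ f = 1) (N : ℕ) :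
    PowerSeries.coeff 0 (genSeries fun f => if Avoids (primesLE K N) f then φ f else 0) =
      Fintype.card K - 1 := by
  rw [genSeries, PowerSeries.coeff_mk]
  have : ∀ f ∈ polysEq K 0, (if Avoids (primesLE K N) f then φ f else 0) = 1 := by
    intro f hf
    have hu : IsUnit f := by
      rw [isUnit_iff_degree_eq_zero]
      simpa using hf
    rw [if_pos, hφ f hu]
    intro P hP h
    exact (primesLE_spec P hP).1.not_isUnit (isUnit_of_dvd_unit h hu)
  rw [Finset.sum_congr rfl this]
  simp [card_polysEq]

theorem sqfWeight_of_isUnit {f : K[X]} (hf : IsUnit f) : sqfWeight f = 1 := by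
  simp [sqfWeight, weight, hf.squarefree, normalizedFactors_of_isUnit hf]

theorem _root_.PowerSeries.coeff_mul_of_coeff_eq_zero {R : Type*} [CommSemiring R]
    (A B : PowerSeries R) {n : ℕ}
    (hB : ∀ i, i ≤ n → i ≠ 0 → PowerSeries.coeff i B = 0) :
    PowerSeries.coeff n (A * B) = PowerSeries.coeff n A * PowerSeries.coeff 0 B := by
  rw [PowerSeries.coeff_mul]
  refine Finset.sum_eq_single (n, 0) ?_ (by simp)
  rintro ⟨i, j⟩ hij hne
  rw [Finset.HasAntidiagonal.mem_antidiagonal] at hij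
  simp only at hij
  rw [hB j (by omega) fun hj => hne (by ext <;> simp <;> omega), mul_zero]

theorem genSeries_one_mul :
    genSeries (K := K) (fun _ => 1) *
      (1 - PowerSeries.C (Fintype.card K : ℝ) * PowerSeries.X) =
      PowerSeries.C ((Fintype.card K : ℝ) - 1) := by
  ext n
  rw [mul_sub, mul_one, mul_left_comm, map_sub, PowerSeries.coeff_C_mul]
  cases n with
  | zero => simp [genSeries, card_polysEq]
  | succ n =>
    rw [PowerSeries.coeff_succ_mul_X]
    simp only [genSeries, PowerSeries.coeff_mk, Finset.sum_const, nsmul_eq_mul, mul_one,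
      card_polysEq, PowerSeries.coeff_C, Nat.succ_ne_zero, if_false]
    ring

/-- The sum of the weights of the square-free polynomials of degree `n`. -/
noncomputable def sqfSum (K : Type) [Field K] [Fintype K] (n : ℕ) : ℝ :=
  ∑ f ∈ polysEq K n, sqfWeight f

theorem sqfSum_succ_sub (n : ℕ) :
    sqfSum K (n + 1) - Fintype.card K * sqfSum K n = (Fintype.card K - 1) *
      PowerSeries.coeff (n + 1) (∏ P ∈ primesLE K (n + 1), ((1 - PowerSeries.X ^ P.natDegree) *
        (1 + PowerSeries.C (localWeight P) * PowerSeries.X ^ P.natDegree))) := by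
  have h1 := genSeries_avoids_one (primesLE K (n + 1)) primesLE_spec
  have h2 := genSeries_sqfWeight_eq (primesLE K (n + 1)) primesLE_spec
  have h3 := genSeries_one_mul (K := K)
  have c1 := PowerSeries.coeff_mul_of_coeff_eq_zero (n := n + 1)
    (genSeries (K := K) sqfWeight * (1 - PowerSeries.C (Fintype.card K : ℝ) * PowerSeries.X))
    (genSeries fun f => if Avoids (primesLE K (n + 1)) f then 1 else 0)
    fun i hi hi0 => coeff_genSeries_avoids hi hi0
  have c2 := PowerSeries.coeff_mul_of_coeff_eq_zero (n := n + 1)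
    (PowerSeries.C ((Fintype.card K : ℝ) - 1) *
      (∏ P ∈ primesLE K (n + 1), ((1 - PowerSeries.X ^ P.natDegree) *
        (1 + PowerSeries.C (localWeight P) * PowerSeries.X ^ P.natDegree))))
    (genSeries fun f => if Avoids (primesLE K (n + 1)) f then sqfWeight f else 0)
    fun i hi hi0 => coeff_genSeries_avoids hi hi0
  rw [coeff_zero_genSeries_avoids (fun _ _ => rfl)] at c1
  rw [coeff_zero_genSeries_avoids (fun _ => sqfWeight_of_isUnit)] at c2
  have hq : (Fintype.card K : ℝ) - 1 ≠ 0 := by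
    have := Fintype.one_lt_card (α := K)
    have : (1 : ℝ) < Fintype.card K := by exact_mod_cast this
    linarith
  have hcoeff : PowerSeries.coeff (n + 1) (genSeries (K := K) sqfWeight *
      (1 - PowerSeries.C (Fintype.card K : ℝ) * PowerSeries.X)) =
      sqfSum K (n + 1) - Fintype.card K * sqfSum K n := by
    rw [mul_sub, mul_one, mul_left_comm, map_sub, PowerSeries.coeff_C_mul,
      PowerSeries.coeff_succ_mul_X]
    simp [genSeries, sqfSum]
  rw [← hcoeff, ← PowerSeries.coeff_C_mul]
  refine mul_right_cancel₀ hq ?_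
  rw [← c1, ← c2, h1, Finset.prod_mul_distrib, ← h3]
  conv_lhs => rw [h2]
  generalize (∏ P ∈ primesLE K (n + 1), (1 - PowerSeries.X ^ P.natDegree) : PowerSeries ℝ) = A
  generalize (∏ P ∈ primesLE K (n + 1), (1 + PowerSeries.C (localWeight P) *
    PowerSeries.X ^ P.natDegree) : PowerSeries ℝ) = B
  refine congrArg _ ?_
  ring

end GeneratingSeries

section Asymptotics

variable {K : Type} [Field K] [Fintype K]

theorem one_lt_card_real : (1 : ℝ) < Fintype.card K := by
  exact_mod_cast Fintype.one_lt_card (α := K)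

theorem localWeight_nonneg (P : K[X]) : 0 ≤ localWeight P := by
  rw [localWeight, sub_nonneg]
  exact inv_le_one_of_one_le₀ (one_le_pow₀ one_lt_card_real.le)

theorem localWeight_le_one (P : K[X]) : localWeight P ≤ 1 := by
  have : (0 : ℝ) ≤ ((Fintype.card K : ℝ) ^ P.natDegree)⁻¹ := by positivity
  rw [localWeight]
  linarith

theorem abs_coeff_X_pow_mul_le {h : PowerSeries ℝ} {x B : ℝ} (hx : 0 < x)
    (hB : ∀ n, |PowerSeries.coeff n h| * x ^ n ≤ B) (m n : ℕ) :
    |PowerSeries.coeff n (PowerSeries.X ^ m * h)| * x ^ n ≤ x ^ m * B := by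
  have hB0 : 0 ≤ B := (by positivity : (0 : ℝ) ≤ _).trans (hB 0)
  rw [PowerSeries.coeff_X_pow_mul']
  split_ifs with hmn
  · calc |PowerSeries.coeff (n - m) h| * x ^ n
        = x ^ m * (|PowerSeries.coeff (n - m) h| * x ^ (n - m)) := by
          conv_lhs => rw [← Nat.add_sub_of_le hmn, pow_add]
          rw [Nat.add_sub_cancel_left]
          ring
      _ ≤ x ^ m * B := by gcongr; exact hB _
  · simp only [abs_zero, zero_mul]
    positivity

theorem abs_coeff_prod_le (s : Finset K[X]) {x : ℝ} (hx : 0 < x) (n : ℕ) :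
    |PowerSeries.coeff n (∏ P ∈ s, ((1 - PowerSeries.X ^ P.natDegree) *
        (1 + PowerSeries.C (localWeight P) * PowerSeries.X ^ P.natDegree)))| * x ^ n ≤
      ∏ P ∈ s, (1 + (x ^ P.natDegree * ((Fintype.card K : ℝ) ^ P.natDegree)⁻¹ +
        x ^ (2 * P.natDegree))) := by
  induction s using Finset.induction_on generalizing n with
  | empty =>
    rcases n with _ | n <;> simp [PowerSeries.coeff_one]
  | insert P s hP ih =>
    rw [Finset.prod_insert hP, Finset.prod_insert hP]
    generalize (∏ P ∈ s, ((1 - PowerSeries.X ^ P.natDegree) *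
        (1 + PowerSeries.C (localWeight P) * PowerSeries.X ^ P.natDegree)) : PowerSeries ℝ) = h at *
    generalize ∏ P ∈ s, (1 + (x ^ P.natDegree * ((Fintype.card K : ℝ) ^ P.natDegree)⁻¹ +
        x ^ (2 * P.natDegree))) = B at *
    have hB0 : 0 ≤ B := (by positivity : (0 : ℝ) ≤ _).trans (ih 0)
    have e : (1 - PowerSeries.X ^ P.natDegree) *
        (1 + PowerSeries.C (localWeight P) * PowerSeries.X ^ P.natDegree) * h =
        h - PowerSeries.C (1 - localWeight P) * (PowerSeries.X ^ P.natDegree * h) -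
          PowerSeries.C (localWeight P) * (PowerSeries.X ^ (2 * P.natDegree) * h) := by
      rw [map_sub, map_one]
      ring
    rw [e, map_sub, map_sub, PowerSeries.coeff_C_mul, PowerSeries.coeff_C_mul]
    have h1 := ih n
    have h2 := abs_coeff_X_pow_mul_le hx ih P.natDegree n
    have h3 := abs_coeff_X_pow_mul_le hx ih (2 * P.natDegree) n
    have hw0 := localWeight_nonneg P
    have hw1 := localWeight_le_one P
    have hw : 1 - localWeight P = ((Fintype.card K : ℝ) ^ P.natDegree)⁻¹ := by
      rw [localWeight]
      ring
    have hi : (0 : ℝ) ≤ ((Fintype.card K : ℝ) ^ P.natDegree)⁻¹ := by positivity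
    rw [hw]
    generalize PowerSeries.coeff n (PowerSeries.X ^ P.natDegree * h) = a at *
    generalize PowerSeries.coeff n (PowerSeries.X ^ (2 * P.natDegree) * h) = b at *
    generalize ((Fintype.card K : ℝ) ^ P.natDegree)⁻¹ = t at *
    have hxn : 0 < x ^ n := by positivity
    calc |PowerSeries.coeff n h - t * a - localWeight P * b| * x ^ n
        ≤ (|PowerSeries.coeff n h| + |t * a| + |localWeight P * b|) * x ^ n := by
          gcongr
          exact (abs_sub _ _).trans (by gcongr; exact abs_sub _ _)
      _ = |PowerSeries.coeff n h| * x ^ n + t * (|a| * x ^ n) +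
            localWeight P * (|b| * x ^ n) := by
          rw [abs_mul, abs_mul, abs_of_nonneg hi, abs_of_nonneg hw0]
          ring
      _ ≤ B + t * (x ^ P.natDegree * B) + 1 * (x ^ (2 * P.natDegree) * B) := by
          gcongr
      _ = _ := by ring

theorem sum_pow_le_inv_one_sub {x : ℝ} (hx : 0 ≤ x) (hx1 : x < 1) (N : ℕ) :
    ∑ n ∈ Finset.range N, x ^ n ≤ (1 - x)⁻¹ := by
  rw [← tsum_geometric_of_lt_one hx hx1]
  exact (summable_geometric_of_lt_one hx hx1).sum_le_tsum _ fun _ _ => by positivity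

theorem sum_primesLE_le {x : ℝ} (hx : 0 < x) (hx1 : x < 1) (hqx : Fintype.card K * x ^ 2 < 1)
    (N : ℕ) :
    ∑ P ∈ primesLE K N, (x ^ P.natDegree * ((Fintype.card K : ℝ) ^ P.natDegree)⁻¹ +
        x ^ (2 * P.natDegree)) ≤
      (Fintype.card K - 1) * ((1 - x)⁻¹ + (1 - Fintype.card K * x ^ 2)⁻¹) := by
  have hq := one_lt_card_real (K := K)
  rw [← Finset.sum_fiberwise_of_maps_to (s := primesLE K N) (t := Finset.range (N + 1))
    (g := fun P => P.natDegree)]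
  · calc _ ≤ ∑ n ∈ Finset.range (N + 1), ∑ P ∈ polysEq K n,
          (x ^ n * ((Fintype.card K : ℝ) ^ n)⁻¹ + x ^ (2 * n)) := by
          refine Finset.sum_le_sum fun n _ => ?_
          refine (Finset.sum_le_sum_of_subset_of_nonneg
            (t := polysEq K n) ?_ fun _ _ _ => by positivity).trans
            (Finset.sum_le_sum fun P hP => ?_)
          · intro P hP
            rw [Finset.mem_filter] at hP
            rw [mem_polysEq, degree_eq_natDegree (primesLE_spec P hP.1).1.ne_zero, hP.2]
          · rw [mem_polysEq] at hP
            rw [natDegree_eq_of_degree_eq_some hP]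
      _ = (Fintype.card K - 1) * (∑ n ∈ Finset.range (N + 1), x ^ n +
            ∑ n ∈ Finset.range (N + 1), (Fintype.card K * x ^ 2) ^ n) := by
          rw [← Finset.sum_add_distrib, Finset.mul_sum]
          refine Finset.sum_congr rfl fun n _ => ?_
          rw [Finset.sum_const, nsmul_eq_mul, card_polysEq]
          have : (Fintype.card K : ℝ) ^ n ≠ 0 := by positivity
          rw [mul_pow, ← pow_mul]
          field_simp
      _ ≤ _ := by
          have hq1 : (0 : ℝ) ≤ Fintype.card K - 1 := by linarith
          have h3 : (0 : ℝ) ≤ Fintype.card K * x ^ 2 := by positivity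
          gcongr
          · exact sum_pow_le_inv_one_sub hx.le hx1 _
          · exact sum_pow_le_inv_one_sub h3 hqx _
  · intro P hP
    rw [primesLE, Finset.mem_filter, mem_polysLT] at hP
    rw [Finset.mem_range]
    exact (natDegree_lt_iff_degree_lt hP.2.1.ne_zero).2 hP.1

/-- The normalized sum of the weights of the square-free polynomials of degree `n`. -/
noncomputable def sqfMean (K : Type) [Field K] [Fintype K] (n : ℕ) : ℝ :=
  sqfSum K n / (Fintype.card K : ℝ) ^ n

theorem exists_sqfMean_succ_sub_le {r : ℝ} (hr : 0 < r) (hr1 : r < 1)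
    (hqr : 1 < Fintype.card K * r ^ 2) :
    ∃ C : ℝ, ∀ n, |sqfMean K n - sqfMean K (n + 1)| ≤ C * r ^ n := by
  have hq := one_lt_card_real (K := K)
  set q : ℝ := (Fintype.card K : ℝ) with hqdef
  have hq0 : 0 < q := by linarith
  have hqr1 : 1 < q * r := by nlinarith
  set x : ℝ := (q * r)⁻¹ with hxdef
  have hx : 0 < x := by positivity
  have hx1 : x < 1 := inv_lt_one_of_one_lt₀ hqr1
  have hqx : q * x ^ 2 < 1 := by
    have : q * x ^ 2 = (q * r ^ 2)⁻¹ := by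
      rw [hxdef]
      field_simp
    rw [this]
    exact inv_lt_one_of_one_lt₀ hqr
  set E := Real.exp ((q - 1) * ((1 - x)⁻¹ + (1 - q * x ^ 2)⁻¹)) with hE
  refine ⟨(q - 1) * E, fun n => ?_⟩
  have h1 := abs_coeff_prod_le (primesLE K (n + 1)) hx (n + 1)
  have h2 : ∏ P ∈ primesLE K (n + 1), (1 + (x ^ P.natDegree * (q ^ P.natDegree)⁻¹ +
        x ^ (2 * P.natDegree))) ≤ E := by
    refine (Finset.prod_le_prod (fun P _ => by positivity)
      fun P _ => (add_comm _ _).trans_le (Real.add_one_le_exp _)).trans ?_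
    rw [← Real.exp_sum, hE]
    exact Real.exp_le_exp.2 (sum_primesLE_le hx hx1 hqx _)
  have h3 := sqfSum_succ_sub (K := K) n
  rw [← hqdef] at h1 h3
  generalize PowerSeries.coeff (n + 1) (∏ P ∈ primesLE K (n + 1), ((1 - PowerSeries.X ^ P.natDegree) *
        (1 + PowerSeries.C (localWeight P) * PowerSeries.X ^ P.natDegree)) : PowerSeries ℝ) = g at *
  have h4 : sqfMean K n - sqfMean K (n + 1) = -((q - 1) * g / q ^ (n + 1)) := by
    rw [sqfMean, sqfMean, ← h3, ← hqdef]
    field_simp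
    ring
  rw [h4, abs_neg, abs_div, abs_mul, abs_of_pos (by linarith : (0 : ℝ) < q - 1),
    abs_of_pos (by positivity : (0 : ℝ) < q ^ (n + 1))]
  have h5 : |g| ≤ E * (q * r) ^ (n + 1) := by
    have := h1.trans h2
    rw [hxdef, inv_pow, ← div_eq_mul_inv, div_le_iff₀ (by positivity)] at this
    exact this
  rw [div_le_iff₀ (by positivity)]
  have hE0 : 0 < E := Real.exp_pos _
  calc (q - 1) * |g| ≤ (q - 1) * (E * (q * r) ^ (n + 1)) := by
        gcongr
    _ = (q - 1) * E * (r ^ n * r) * q ^ (n + 1) := by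
        rw [mul_pow, pow_succ r]
        ring
    _ ≤ (q - 1) * E * (r ^ n * 1) * q ^ (n + 1) := by
        have : 0 ≤ q - 1 := by linarith
        gcongr
    _ = _ := by ring

theorem exists_sqfMean_limit (hq3 : 3 ≤ Fintype.card K) :
    ∃ c : ℝ, ∀ r : ℝ, 0 < r → r < 1 → 1 < Fintype.card K * r ^ 2 →
      ∃ C : ℝ, ∀ n, |sqfMean K n - c| ≤ C * r ^ n := by
  have hq3' : (3 : ℝ) ≤ Fintype.card K := by exact_mod_cast hq3
  obtain ⟨C₀, hC₀⟩ := exists_sqfMean_succ_sub_le (K := K) (r := 3 / 5) (by norm_num) (by norm_num)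
    (by linarith)
  have hcauchy : CauchySeq (sqfMean K) :=
    cauchySeq_of_le_geometric (3 / 5) C₀ (by norm_num) fun n => by
      rw [Real.dist_eq]
      exact hC₀ n
  obtain ⟨c, hc⟩ := cauchySeq_tendsto_of_complete hcauchy
  refine ⟨c, fun r hr hr1 hqr => ?_⟩
  obtain ⟨C, hC⟩ := exists_sqfMean_succ_sub_le (K := K) hr hr1 hqr
  refine ⟨C / (1 - r), fun n => ?_⟩
  have := dist_le_of_le_geometric_of_tendsto r C hr1
    (fun n => by rw [Real.dist_eq]; exact hC n) hc n
  rw [Real.dist_eq] at this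
  exact this.trans_eq (by ring)

end Asymptotics

section Positivity

variable {K : Type} [Field K]

theorem natDegree_eq_sum_normalizedFactors {f : K[X]} (hf : f ≠ 0) :
    ((normalizedFactors f).map natDegree).sum = f.natDegree := by
  rw [← natDegree_multiset_prod_of_monic _ fun P hP =>
    ((Polynomial.mem_normalizedFactors_iff hf).1 hP).2.1]
  exact natDegree_eq_of_degree_eq (degree_eq_degree_of_associated (prod_normalizedFactors hf))

theorem exists_monic_mul_self_dvd {f : K[X]} (hf : f ≠ 0) (h : ¬ Squarefree f) :
    ∃ M : K[X], Irreducible M ∧ M.Monic ∧ M * M ∣ f := by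
  rw [squarefree_iff_no_irreducibles hf] at h
  push Not at h
  obtain ⟨M, hM, hMf⟩ := h
  have ha : Associated (normalize M) M := normalize_associated M
  exact ⟨normalize M, ha.symm.irreducible hM, monic_normalize hM.ne_zero,
    ((ha.mul_mul ha).dvd_iff_dvd_left).2 hMf⟩

variable [Fintype K]

theorem pow_natDegree_le_localWeight (hq3 : 3 ≤ Fintype.card K) {P : K[X]}
    (hP : Irreducible P) : (2 / 3 : ℝ) ^ P.natDegree ≤ localWeight P := by
  have hq3' : (3 : ℝ) ≤ Fintype.card K := by exact_mod_cast hq3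
  have hdeg := hP.natDegree_pos
  have h1 : ((Fintype.card K : ℝ) ^ P.natDegree)⁻¹ ≤ 3⁻¹ := by
    apply inv_anti₀ (by norm_num)
    exact hq3'.trans (le_self_pow₀ (by linarith) hdeg.ne')
  have h2 : (2 / 3 : ℝ) ^ P.natDegree ≤ 2 / 3 :=
    pow_le_of_le_one (by norm_num) (by norm_num) hdeg.ne'
  rw [localWeight]
  linarith

theorem pow_natDegree_le_weight (hq3 : 3 ≤ Fintype.card K) {f : K[X]} (hf : f ≠ 0) :
    (2 / 3 : ℝ) ^ f.natDegree ≤ weight f := by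
  rw [← natDegree_eq_sum_normalizedFactors hf, weight]
  have : ∀ P ∈ normalizedFactors f, Irreducible P := fun P hP =>
    ((Polynomial.mem_normalizedFactors_iff hf).1 hP).1
  generalize normalizedFactors f = s at this
  induction s using Multiset.induction_on with
  | empty => simp
  | cons P s ih =>
    simp only [Multiset.map_cons, Multiset.sum_cons, Multiset.prod_cons, pow_add]
    have h1 := ih fun Q hQ => this Q (Multiset.mem_cons_of_mem hQ)
    have h2 := pow_natDegree_le_localWeight hq3 (this P (Multiset.mem_cons_self _ _))
    have h3 := localWeight_nonneg P
    gcongr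

theorem card_monic_le (j : ℕ) :
    ({M ∈ polysEq K j | M.Monic} : Finset K[X]).card ≤ Fintype.card K ^ j := by
  rw [← card_polysLT]
  refine Finset.card_le_card_of_injOn (fun M => M - X ^ j) ?_ ?_
  · intro M hM
    simp only [Finset.coe_filter, mem_polysEq, Set.mem_ofPred_eq] at hM
    rw [Finset.mem_coe, mem_polysLT]
    rw [← hM.1]
    refine degree_sub_lt_left (by rw [hM.1, degree_X_pow]) hM.2.ne_zero ?_
    rw [hM.2.leadingCoeff, (monic_X_pow j).leadingCoeff]
  · intro M _ N _ h
    exact sub_left_injective h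

theorem card_polysEq_dvd_mul_self_le {M : K[X]} (hM : M ≠ 0) (n : ℕ) :
    (({f ∈ polysEq K n | M * M ∣ f} : Finset K[X]).card : ℝ) ≤
      (Fintype.card K - 1) * (Fintype.card K : ℝ) ^ n *
        ((Fintype.card K : ℝ) ^ (2 * M.natDegree))⁻¹ := by
  have hq := one_lt_card_real (K := K)
  have h := sum_polysEq_dvd (K := K) (fun _ => 1) (mul_ne_zero hM hM) n
  rw [Finset.sum_boole, natDegree_mul hM hM, ← two_mul] at h
  rw [h]
  have hq1 : (0 : ℝ) ≤ Fintype.card K - 1 := by linarith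
  split_ifs with hn
  · rw [Finset.sum_const, nsmul_eq_mul, mul_one, card_polysEq, mul_assoc]
    gcongr
    rw [pow_sub₀ _ (by positivity) hn]
  · positivity

theorem card_not_squarefree_le (n : ℕ) :
    (({f ∈ polysEq K n | ¬ Squarefree f} : Finset K[X]).card : ℝ) ≤ (Fintype.card K : ℝ) ^ n := by
  have hq := one_lt_card_real (K := K)
  have hq1 : (0 : ℝ) ≤ Fintype.card K - 1 := by linarith
  set q : ℝ := (Fintype.card K : ℝ) with hqdef
  have hsub : ({f ∈ polysEq K n | ¬ Squarefree f} : Finset K[X]) ⊆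
      (Finset.Icc 1 n).biUnion fun j => ({M ∈ polysEq K j | M.Monic} : Finset K[X]).biUnion
        fun M => {f ∈ polysEq K n | M * M ∣ f} := by
    intro f hf
    rw [Finset.mem_filter] at hf
    have hf0 := ne_zero_of_mem_polysEq hf.1
    obtain ⟨M, hM, hMm, hMf⟩ := exists_monic_mul_self_dvd hf0 hf.2
    simp only [Finset.mem_biUnion, Finset.mem_filter, Finset.mem_Icc]
    refine ⟨M.natDegree, ⟨hM.natDegree_pos, ?_⟩, M, ⟨?_, hMm⟩, hf.1, hMf⟩
    · have := natDegree_le_of_dvd ((dvd_mul_right M M).trans hMf) hf0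
      rwa [natDegree_eq_of_degree_eq_some (mem_polysEq.1 hf.1)] at this
    · rw [mem_polysEq, degree_eq_natDegree hM.ne_zero]
  have hcard : ∀ j, ((({M ∈ polysEq K j | M.Monic} : Finset K[X]).biUnion
        fun M => {f ∈ polysEq K n | M * M ∣ f}).card : ℝ) ≤
        (q - 1) * q ^ n * q⁻¹ ^ j := by
    intro j
    have h1 : ((({M ∈ polysEq K j | M.Monic} : Finset K[X]).biUnion
        fun M => {f ∈ polysEq K n | M * M ∣ f}).card : ℝ) ≤
        ∑ M ∈ polysEq K j with M.Monic, (({f ∈ polysEq K n | M * M ∣ f} : Finset K[X]).card : ℝ) := by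
      exact_mod_cast Finset.card_biUnion_le
    have h2 : (({M ∈ polysEq K j | M.Monic} : Finset K[X]).card : ℝ) ≤ q ^ j := by
      rw [hqdef]
      exact_mod_cast card_monic_le j
    calc _ ≤ _ := h1
      _ ≤ ∑ M ∈ polysEq K j with M.Monic, (q - 1) * q ^ n * (q ^ (2 * j))⁻¹ := by
          refine Finset.sum_le_sum fun M hM => ?_
          rw [Finset.mem_filter, mem_polysEq] at hM
          have := card_polysEq_dvd_mul_self_le hM.2.ne_zero n
          rwa [natDegree_eq_of_degree_eq_some hM.1] at this
      _ ≤ q ^ j * ((q - 1) * q ^ n * (q ^ (2 * j))⁻¹) := by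
          rw [Finset.sum_const, nsmul_eq_mul]
          gcongr
      _ = _ := by
          rw [two_mul, pow_add, inv_pow]
          field_simp
  have hq0 : 0 < q := by linarith
  have hqi : q⁻¹ < 1 := inv_lt_one_of_one_lt₀ hq
  calc _ ≤ ∑ j ∈ Finset.Icc 1 n, (q - 1) * q ^ n * q⁻¹ ^ j := by
        refine le_trans ?_ (Finset.sum_le_sum fun j _ => hcard j)
        exact_mod_cast (Finset.card_le_card hsub).trans Finset.card_biUnion_le
    _ = (q - 1) * q ^ n * (q⁻¹ * ∑ j ∈ Finset.range n, q⁻¹ ^ j) := by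
        rw [← Finset.mul_sum, Finset.mul_sum (a := q⁻¹), Finset.range_eq_Ico,
          ← Finset.Ico_add_one_right_eq_Icc]
        congr 1
        rw [Finset.sum_Ico_eq_sum_range, Finset.sum_Ico_eq_sum_range]
        refine Finset.sum_congr (by simp) fun j _ => ?_
        rw [zero_add, add_comm 1 j, pow_succ']
    _ ≤ (q - 1) * q ^ n * (q⁻¹ * (1 - q⁻¹)⁻¹) := by
        gcongr
        exact sum_pow_le_inv_one_sub (by positivity) hqi _
    _ = q ^ n := by
        have : q - 1 ≠ 0 := by linarith
        field_simp

theorem le_sqfMean (hq3 : 3 ≤ Fintype.card K) (n : ℕ) : (2 / 3 : ℝ) ^ n ≤ sqfMean K n := by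
  have hq3' : (3 : ℝ) ≤ Fintype.card K := by exact_mod_cast hq3
  have hq0 : (0 : ℝ) < (Fintype.card K : ℝ) ^ n := by positivity
  have h1 := card_not_squarefree_le (K := K) n
  have h2 := Finset.card_filter_add_card_filter_not (s := polysEq K n) (fun f => Squarefree f)
  have h3 := card_polysEq (K := K) n
  rw [← h2] at h3
  push_cast at h3
  have h4 : (Fintype.card K : ℝ) ^ n ≤
      (({f ∈ polysEq K n | Squarefree f} : Finset K[X]).card : ℝ) := by nlinarith
  rw [sqfMean, le_div_iff₀ hq0, sqfSum]
  simp only [sqfWeight]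
  rw [← Finset.sum_filter]
  calc (2 / 3 : ℝ) ^ n * (Fintype.card K : ℝ) ^ n
      ≤ ∑ f ∈ polysEq K n with Squarefree f, (2 / 3 : ℝ) ^ n := by
        rw [Finset.sum_const, nsmul_eq_mul, mul_comm]
        gcongr
    _ ≤ _ := by
        refine Finset.sum_le_sum fun f hf => ?_
        rw [Finset.mem_filter] at hf
        have := pow_natDegree_le_weight hq3 (ne_zero_of_mem_polysEq hf.1)
        rwa [natDegree_eq_of_degree_eq_some (mem_polysEq.1 hf.1)] at this

theorem exists_sqfMean_limit_pos (hq3 : 3 ≤ Fintype.card K) :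
    ∃ c : ℝ, 0 < c ∧ ∀ r : ℝ, 0 < r → r < 1 → 1 < Fintype.card K * r ^ 2 →
      ∃ C : ℝ, ∀ n, |sqfMean K n - c| ≤ C * r ^ n := by
  have hq3' : (3 : ℝ) ≤ Fintype.card K := by exact_mod_cast hq3
  obtain ⟨c, hc⟩ := exists_sqfMean_limit hq3
  refine ⟨c, ?_, hc⟩
  by_contra hc0
  obtain ⟨C, hC⟩ := hc (3 / 5) (by norm_num) (by norm_num) (by linarith)
  have h1 : ∀ n : ℕ, (10 / 9 : ℝ) ^ n ≤ C := by
    intro n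
    have h2 := hC n
    have h3 := le_sqfMean hq3 n
    have h4 : (2 / 3 : ℝ) ^ n ≤ C * (3 / 5) ^ n := by
      have := (le_abs_self _).trans h2
      linarith
    rw [← div_le_iff₀ (by positivity), ← div_pow] at h4
    have e : (10 / 9 : ℝ) = 2 / 3 / (3 / 5) := by norm_num
    rwa [e]
  obtain ⟨n, hn⟩ := pow_unbounded_of_one_lt C (by norm_num : (1 : ℝ) < 10 / 9)
  exact absurd (h1 n) (not_le.2 hn)

end Positivity

section AvoidOne

variable {K : Type} [Field K] [Fintype K]

/-- The normalized sum of the weights of the square-free polynomials of degree `n` that are not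
divisible by `P`. -/
noncomputable def avoidMean (P : K[X]) (n : ℕ) : ℝ :=
  (∑ f ∈ polysEq K n, if P ∣ f then 0 else sqfWeight f) / (Fintype.card K : ℝ) ^ n

theorem sqfMean_eq_avoidMean {P : K[X]} (hP : Irreducible P ∧ P.Monic) (n : ℕ) :
    sqfMean K n = avoidMean P n + localWeight P * ((Fintype.card K : ℝ) ^ P.natDegree)⁻¹ *
      (if P.natDegree ≤ n then avoidMean P (n - P.natDegree) else 0) := by
  have hq0 : (0 : ℝ) < Fintype.card K := by
    have := one_lt_card_real (K := K)
    linarith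
  have h := congrArg (PowerSeries.coeff n) (genSeries_sqfWeight_eq {P} (by simpa using hP))
  rw [Finset.prod_singleton, add_mul, one_mul, mul_assoc, map_add, PowerSeries.coeff_C_mul,
    PowerSeries.coeff_X_pow_mul'] at h
  simp only [genSeries, PowerSeries.coeff_mk, Avoids, Finset.mem_singleton, forall_eq,
    ite_not] at h
  rw [sqfMean, sqfSum, h, avoidMean, add_div]
  congr 1
  split_ifs with hn
  · rw [avoidMean, pow_sub₀ _ hq0.ne' hn]
    field_simp
  · simp

theorem exists_avoidMean_limit {P : K[X]} (hP : Irreducible P ∧ P.Monic) {c C r : ℝ}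
    (hr : 0 < r) (hr1 : r < 1) (hqr : 1 < Fintype.card K * r ^ 2)
    (hC : ∀ n, |sqfMean K n - c| ≤ C * r ^ n) :
    ∃ M : ℝ, ∀ n, |avoidMean P n - c / (1 + localWeight P *
      ((Fintype.card K : ℝ) ^ P.natDegree)⁻¹)| ≤ M * r ^ n := by
  have hq := one_lt_card_real (K := K)
  set q : ℝ := (Fintype.card K : ℝ) with hqdef
  set u := P.natDegree with hu
  have hu0 : u ≠ 0 := hP.1.natDegree_pos.ne'
  set w := localWeight P
  have hw0 : 0 ≤ w := localWeight_nonneg P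
  have hw1 : w ≤ 1 := localWeight_le_one P
  set Q := (q ^ u)⁻¹ with hQ
  have hq0 : 0 < q := by linarith
  have hQ0 : 0 < Q := by positivity
  set a := c / (1 + w * Q) with ha
  have hac : a * (1 + w * Q) = c := by
    rw [ha]
    field_simp
  have hC0 : 0 ≤ C := by
    have := (abs_nonneg _).trans (hC 0)
    simpa using this
  set ρ := Q * (r ^ u)⁻¹ with hρ
  have hρ1 : ρ < 1 := by
    rw [hρ, hQ, ← mul_inv, ← mul_pow]
    exact inv_lt_one_of_one_lt₀ (one_lt_pow₀ (by nlinarith) hu0)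
  have hρ0 : 0 < ρ := by positivity
  set M := (C + |c - a| * (r ^ u)⁻¹) / (1 - ρ) with hM
  have h1ρ : 0 < 1 - ρ := by linarith
  have hMe : C + |c - a| * (r ^ u)⁻¹ + M * ρ = M := by
    rw [hM]
    field_simp
    ring
  have hM0 : 0 ≤ M := by positivity
  refine ⟨M, fun n => ?_⟩
  induction n using Nat.strong_induction_on with
  | _ n ih =>
    have key := sqfMean_eq_avoidMean hP n
    rw [← hqdef, ← hu, ← hQ] at key
    split_ifs at key with hn
    · have h1 := ih (n - u) (by omega)
      have h2 := hC n
      have e : avoidMean P n - a =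
          (sqfMean K n - c) - w * Q * (avoidMean P (n - u) - a) := by
        rw [key, ← hac]
        ring
      have hrn : r ^ (n - u) = r ^ n * (r ^ u)⁻¹ := pow_sub₀ _ hr.ne' hn
      calc |avoidMean P n - a| ≤ |sqfMean K n - c| + |w * Q * (avoidMean P (n - u) - a)| := by
            rw [e]
            exact abs_sub _ _
        _ ≤ C * r ^ n + 1 * Q * (M * r ^ (n - u)) := by
            rw [abs_mul, abs_of_nonneg (by positivity : 0 ≤ w * Q)]
            gcongr
        _ = (C + M * ρ) * r ^ n := by
            rw [hrn, hρ]
            ring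
        _ ≤ M * r ^ n := by
            gcongr
            have : 0 ≤ |c - a| * (r ^ u)⁻¹ := by positivity
            linarith
    · have h2 := hC n
      have e : avoidMean P n - a = (sqfMean K n - c) + (c - a) := by
        rw [key]
        ring
      have h3 : 1 ≤ (r ^ u)⁻¹ * r ^ n := by
        rw [inv_mul_eq_div, one_le_div (by positivity)]
        exact pow_le_pow_of_le_one hr.le hr1.le (by omega)
      calc |avoidMean P n - a| ≤ C * r ^ n + |c - a| * 1 := by
            rw [e, mul_one]
            exact (abs_add_le _ _).trans (by gcongr)
        _ ≤ C * r ^ n + |c - a| * ((r ^ u)⁻¹ * r ^ n) := by gcongr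
        _ = (C + |c - a| * (r ^ u)⁻¹) * r ^ n := by ring
        _ ≤ M * r ^ n := by
            gcongr
            have : 0 ≤ M * ρ := by positivity
            linarith

end AvoidOne

section Sieve

variable {K : Type} [Field K]

/-- The finset of monic irreducible factors of a polynomial. -/
noncomputable def primes (f : K[X]) : Finset K[X] := (normalizedFactors f).toFinset

theorem mem_primes {f : K[X]} (hf : f ≠ 0) {P : K[X]} :
    P ∈ primes f ↔ Irreducible P ∧ P.Monic ∧ P ∣ f := by
  rw [primes, Multiset.mem_toFinset, Polynomial.mem_normalizedFactors_iff hf]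

theorem isCoprime_iff_forall_mem_primes {f : K[X]} (hf : f ≠ 0) (g : K[X]) :
    IsCoprime f g ↔ ∀ P ∈ primes f, ¬ P ∣ g := by
  constructor
  · intro h P hP hPg
    rw [mem_primes hf] at hP
    exact hP.1.not_isUnit (h.isUnit_of_dvd' hP.2.2 hPg)
  · intro h
    refine isCoprime_of_irreducible_dvd (fun h => hf h.1) fun M hM hMf hMg => ?_
    have ha : Associated (normalize M) M := normalize_associated M
    exact h (normalize M) ((mem_primes hf).2 ⟨ha.symm.irreducible hM, monic_normalize hM.ne_zero,
      ha.dvd_iff_dvd_left.2 hMf⟩) (ha.dvd_iff_dvd_left.2 hMg)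

theorem pairwise_isCoprime_of_monic_irreducible {T : Finset K[X]}
    (hT : ∀ P ∈ T, Irreducible P ∧ P.Monic) :
    (T : Set K[X]).Pairwise (Function.onFun IsCoprime id) := by
  intro P hP Q hQ hne
  refine (hT P hP).1.coprime_iff_not_dvd.2 fun h => hne ?_
  exact eq_of_monic_of_associated (hT P hP).2 (hT Q hQ).2
    ((hT P hP).1.associated_of_dvd (hT Q hQ).1 h)

theorem prod_dvd_iff {T : Finset K[X]} (hT : ∀ P ∈ T, Irreducible P ∧ P.Monic) (g : K[X]) :
    ∏ P ∈ T, P ∣ g ↔ ∀ P ∈ T, P ∣ g :=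
  ⟨fun h _ hP => (Finset.dvd_prod_of_mem _ hP).trans h,
    fun h => Finset.prod_dvd_of_coprime (pairwise_isCoprime_of_monic_irreducible hT) h⟩

theorem monic_prod_primes {f : K[X]} (hf : f ≠ 0) {T : Finset K[X]} (hT : T ⊆ primes f) :
    (∏ P ∈ T, P).Monic :=
  monic_prod_of_monic _ _ fun _ hP => ((mem_primes hf).1 (hT hP)).2.1

theorem prod_primes_dvd {f : K[X]} (hf : f ≠ 0) {T : Finset K[X]} (hT : T ⊆ primes f) :
    ∏ P ∈ T, P ∣ f := by
  rw [prod_dvd_iff fun _ hP => ?_]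
  · exact fun P hP => ((mem_primes hf).1 (hT hP)).2.2
  · exact ⟨((mem_primes hf).1 (hT hP)).1, ((mem_primes hf).1 (hT hP)).2.1⟩

theorem prod_primes_associated {f : K[X]} (hf : Squarefree f) :
    Associated (∏ P ∈ primes f, P) f := by
  have hn := (squarefree_iff_nodup_normalizedFactors hf.ne_zero).1 hf
  have h := prod_normalizedFactors hf.ne_zero
  rw [primes, Finset.prod, Multiset.toFinset_val, hn.dedup, Multiset.map_id']
  exact h

theorem card_coprime_eq_sum {f : K[X]} (hf : f ≠ 0) (V : Finset K[X]) :
    (({g ∈ V | IsCoprime f g} : Finset K[X]).card : ℝ) =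
      ∑ T ∈ (primes f).powerset, (-1) ^ T.card *
        (({g ∈ V | ∏ P ∈ T, P ∣ g} : Finset K[X]).card : ℝ) := by
  have h1 : ∀ g, (if IsCoprime f g then (1 : ℝ) else 0) =
      ∑ T ∈ (primes f).powerset, (-1) ^ T.card * (if ∏ P ∈ T, P ∣ g then 1 else 0) := by
    intro g
    have h2 : (if IsCoprime f g then (1 : ℝ) else 0) =
        ∏ P ∈ primes f, (1 + (-1 : ℝ) * if P ∣ g then 1 else 0) := by
      rw [isCoprime_iff_forall_mem_primes hf]
      split_ifs with h
      · symm
        refine Finset.prod_eq_one fun P hP => ?_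
        simp [h P hP]
      · push Not at h
        obtain ⟨P, hP, hPg⟩ := h
        symm
        refine Finset.prod_eq_zero hP ?_
        simp [hPg]
    rw [h2, Finset.prod_one_add]
    refine Finset.sum_congr rfl fun T hT => ?_
    rw [Finset.mem_powerset] at hT
    rw [Finset.prod_mul_distrib, Finset.prod_const, Finset.prod_ite_zero, Finset.prod_const_one]
    congr 2
    rw [prod_dvd_iff fun P hP => ?_]
    exact ⟨((mem_primes hf).1 (hT hP)).1, ((mem_primes hf).1 (hT hP)).2.1⟩
  rw [← Finset.sum_boole, Finset.sum_congr rfl fun g _ => h1 g, Finset.sum_comm]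
  refine Finset.sum_congr rfl fun T _ => ?_
  rw [← Finset.mul_sum, Finset.sum_boole]

variable [Fintype K]

theorem weight_eq_prod {f : K[X]} (hf : Squarefree f) :
    weight f = ∏ P ∈ primes f, localWeight P := by
  have hn := (squarefree_iff_nodup_normalizedFactors hf.ne_zero).1 hf
  rw [primes, Finset.prod, Multiset.toFinset_val, hn.dedup, weight]

theorem weight_eq_sum {f : K[X]} (hf : Squarefree f) :
    weight f = ∑ T ∈ (primes f).powerset, (-1) ^ T.card *
      ((Fintype.card K : ℝ) ^ (∏ P ∈ T, P).natDegree)⁻¹ := by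
  rw [weight_eq_prod hf]
  have : ∀ P : K[X], localWeight P = 1 + (-1) * ((Fintype.card K : ℝ) ^ P.natDegree)⁻¹ := by
    intro P
    rw [localWeight]
    ring
  simp only [this]
  rw [Finset.prod_one_add]
  refine Finset.sum_congr rfl fun T hT => ?_
  rw [Finset.mem_powerset] at hT
  rw [Finset.prod_mul_distrib, Finset.prod_const, Finset.prod_inv_distrib, Finset.prod_pow_eq_pow_sum,
    natDegree_prod_of_monic]
  exact fun P hP => ((mem_primes hf.ne_zero).1 (hT hP)).2.1

theorem abs_card_coprime_sub_le {f : K[X]} (hf : Squarefree f) (V : Finset K[X]) (W : ℝ)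
    (err : Finset K[X] → ℝ)
    (h : ∀ T ⊆ primes f, |(({g ∈ V | ∏ P ∈ T, P ∣ g} : Finset K[X]).card : ℝ) -
      W * ((Fintype.card K : ℝ) ^ (∏ P ∈ T, P).natDegree)⁻¹| ≤ err T) :
    |(({g ∈ V | IsCoprime f g} : Finset K[X]).card : ℝ) - W * weight f| ≤
      ∑ T ∈ (primes f).powerset, err T := by
  rw [card_coprime_eq_sum hf.ne_zero, weight_eq_sum hf, Finset.mul_sum, ← Finset.sum_sub_distrib]
  refine (Finset.abs_sum_le_sum_abs _ _).trans (Finset.sum_le_sum fun T hT => ?_)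
  refine le_trans (le_of_eq ?_) (h T (Finset.mem_powerset.1 hT))
  rw [← mul_left_comm, ← mul_sub, abs_mul, abs_pow, abs_neg, abs_one, one_pow, one_mul]

theorem card_filter_dvd {D : K[X]} (hD : D ≠ 0) {m : ℕ} (hm : D.natDegree ≤ m)
    (φ : K[X] → Prop) :
    ({g ∈ polysLT K m | D ∣ g ∧ φ g} : Finset K[X]).card =
      ({g ∈ polysLT K (m - D.natDegree) | φ (D * g)} : Finset K[X]).card := by
  symm
  have hdeg : ∀ g : K[X], (D * g).degree < m ↔ g.degree < (m - D.natDegree : ℕ) := by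
    intro g
    rcases eq_or_ne g 0 with rfl | hg
    · simp
    · rw [degree_mul, degree_eq_natDegree hD, degree_eq_natDegree hg]
      norm_cast
      omega
  refine Finset.card_bij (fun g _ => D * g) ?_ (fun _ _ _ _ h => mul_left_cancel₀ hD h) ?_
  · intro g hg
    simp only [Finset.mem_filter, mem_polysLT] at hg ⊢
    exact ⟨(hdeg g).2 hg.1, dvd_mul_right _ _, hg.2⟩
  · intro g hg
    simp only [Finset.mem_filter, mem_polysLT] at hg
    obtain ⟨h1, ⟨g, rfl⟩, h2⟩ := hg
    exact ⟨g, by simp [(hdeg g).1 h1, h2], rfl⟩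

theorem card_coprime_polysLT {f : K[X]} (hf : Squarefree f) {m : ℕ} (hm : f.natDegree ≤ m) :
    (({g ∈ polysLT K m | IsCoprime f g} : Finset K[X]).card : ℝ) =
      (Fintype.card K : ℝ) ^ m * weight f := by
  have hq0 : (0 : ℝ) < Fintype.card K := by
    have := one_lt_card_real (K := K)
    linarith
  have := abs_card_coprime_sub_le hf (polysLT K m) ((Fintype.card K : ℝ) ^ m) (fun _ => 0) ?_
  · rw [Finset.sum_const_zero] at this
    exact sub_eq_zero.1 (abs_nonpos_iff.1 this)
  · intro T hT
    have hD := (monic_prod_primes hf.ne_zero hT).ne_zero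
    have hDm := (natDegree_le_of_dvd (prod_primes_dvd hf.ne_zero hT) hf.ne_zero).trans hm
    have := card_filter_dvd hD hDm fun _ => True
    simp only [and_true, Finset.filter_true, card_polysLT] at this
    rw [this]
    push_cast
    rw [pow_sub₀ _ hq0.ne' hDm, sub_self, abs_zero]

variable {L : Type} [Field L] [Algebra K L]

theorem abs_card_aeval_eq_sub_le {a : L} (ha : IsIntegral K a) {δ : L}
    (hδ : δ ∈ Algebra.adjoin K {a}) (m : ℕ) :
    |(({g ∈ polysLT K m | aeval a g = δ} : Finset K[X]).card : ℝ) -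
      (Fintype.card K : ℝ) ^ m / (Fintype.card K : ℝ) ^ (minpoly K a).natDegree| ≤
      if m < (minpoly K a).natDegree then 1 else 0 := by
  have hq := one_lt_card_real (K := K)
  have hq0 : (0 : ℝ) < Fintype.card K := by linarith
  have hP := minpoly.monic ha
  set P := minpoly K a with hPdef
  rw [Algebra.adjoin_singleton_eq_range_aeval] at hδ
  obtain ⟨p, rfl⟩ := hδ
  have hr : aeval a (p %ₘ P) = aeval a p := by
    conv_rhs => rw [← modByMonic_add_div p P, map_add, map_mul, hPdef, minpoly.aeval, zero_mul,
      add_zero]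
  have hrdeg := degree_modByMonic_lt p hP
  set r := p %ₘ P
  change |(({g ∈ polysLT K m | aeval a g = aeval a p} : Finset K[X]).card : ℝ) - _| ≤ _
  rw [← hr]
  have hdvd : ∀ g, aeval a g = aeval a r ↔ P ∣ g - r := by
    intro g
    rw [hPdef, minpoly.dvd_iff, map_sub, sub_eq_zero]
  simp only [hdvd]
  rw [degree_eq_natDegree hP.ne_zero] at hrdeg
  split_ifs with h
  · have h1 : ({g ∈ polysLT K m | P ∣ g - r} : Finset K[X]).card ≤ 1 := by
      rw [Finset.card_le_one]
      intro g hg g' hg'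
      simp only [Finset.mem_filter, mem_polysLT] at hg hg'
      have h2 : P ∣ g - g' := by
        have := dvd_sub hg.2 hg'.2
        rwa [sub_sub_sub_cancel_right] at this
      refine sub_eq_zero.1 (eq_zero_of_dvd_of_degree_lt h2 ?_)
      refine ((degree_sub_le _ _).trans_lt (max_lt hg.1 hg'.1)).trans ?_
      rw [degree_eq_natDegree hP.ne_zero]
      exact_mod_cast h
    have h2 : (({g ∈ polysLT K m | P ∣ g - r} : Finset K[X]).card : ℝ) ≤ 1 := by
      exact_mod_cast h1
    have h3 : (Fintype.card K : ℝ) ^ m / (Fintype.card K : ℝ) ^ P.natDegree ≤ 1 := by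
      rw [div_le_one (by positivity)]
      exact pow_le_pow_right₀ hq.le h.le
    have h4 : 0 ≤ (Fintype.card K : ℝ) ^ m / (Fintype.card K : ℝ) ^ P.natDegree := by positivity
    rw [abs_le]
    constructor <;> linarith [(Nat.cast_nonneg _ :
      (0 : ℝ) ≤ (({g ∈ polysLT K m | P ∣ g - r} : Finset K[X]).card : ℝ))]
  · rw [not_lt] at h
    have h1 : ({g ∈ polysLT K m | P ∣ g - r} : Finset K[X]).card =
        ({g ∈ polysLT K m | P ∣ g} : Finset K[X]).card := by
      have hrm : r.degree < m := hrdeg.trans_le (by exact_mod_cast h)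
      refine Finset.card_bij (fun g _ => g - r) ?_ (fun _ _ _ _ h => sub_left_injective h) ?_
      · intro g hg
        simp only [Finset.mem_filter, mem_polysLT] at hg ⊢
        exact ⟨(degree_sub_le _ _).trans_lt (max_lt hg.1 hrm), hg.2⟩
      · intro g hg
        simp only [Finset.mem_filter, mem_polysLT] at hg
        refine ⟨g + r, ?_, add_sub_cancel_right g r⟩
        simp only [Finset.mem_filter, mem_polysLT, add_sub_cancel_right, hg.2, and_true]
        exact (degree_add_le _ _).trans_lt (max_lt hg.1 hrm)
    have h2 := card_filter_dvd hP.ne_zero h fun _ => True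
    simp only [and_true, Finset.filter_true, card_polysLT] at h2
    rw [h1, h2]
    push_cast
    rw [pow_sub₀ _ hq0.ne' h, div_eq_mul_inv, sub_self, abs_zero]

theorem card_filter_lt_natDegree_prod_le {f : K[X]} (hf : Squarefree f) {m u : ℕ}
    (hm : f.natDegree ≤ m) :
    ({T ∈ (primes f).powerset | m < (∏ P ∈ T, P).natDegree + u} : Finset (Finset K[X])).card ≤
      Fintype.card K ^ u := by
  rw [← card_polysLT]
  refine Finset.card_le_card_of_injOn (fun T => ∏ P ∈ primes f \ T, P) ?_ ?_
  · intro T hT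
    simp only [Finset.coe_filter, Finset.mem_powerset, Set.mem_ofPred_eq] at hT
    rw [Finset.mem_coe, mem_polysLT]
    have h1 := Finset.prod_sdiff (f := fun P => P) hT.1
    have m1 := monic_prod_primes hf.ne_zero hT.1
    have m2 := monic_prod_primes hf.ne_zero (Finset.sdiff_subset (s := primes f) (t := T))
    have h2 := natDegree_eq_of_degree_eq
      (degree_eq_degree_of_associated (prod_primes_associated hf))
    rw [← h1, m2.natDegree_mul m1] at h2
    rw [degree_eq_natDegree m2.ne_zero]
    norm_cast
    omega
  · intro T hT T' hT' h
    simp only [Finset.coe_filter, Finset.mem_powerset, Set.mem_ofPred_eq] at hT hT'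
    have key : ∀ T ⊆ primes f, ∀ P ∈ primes f, P ∈ T ↔ ¬ P ∣ ∏ P ∈ primes f \ T, P := by
      intro T hT P hP
      have hP' := (mem_primes hf.ne_zero).1 hP
      rw [hP'.1.prime.dvd_finsetProd_iff]
      constructor
      · rintro hPT ⟨Q, hQ, hPQ⟩
        rw [Finset.mem_sdiff] at hQ
        have hQ' := (mem_primes hf.ne_zero).1 hQ.1
        have : P = Q := eq_of_monic_of_associated hP'.2.1 hQ'.2.1
          (hP'.1.associated_of_dvd hQ'.1 hPQ)
        exact hQ.2 (this ▸ hPT)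
      · intro h
        by_contra hPT
        exact h ⟨P, Finset.mem_sdiff.2 ⟨hP, hPT⟩, dvd_rfl⟩
    ext P
    constructor
    · intro hP
      have := (key T hT.1 P (hT.1 hP)).1 hP
      simp only at h
      rw [h] at this
      exact (key T' hT'.1 P (hT.1 hP)).2 this
    · intro hP
      have := (key T' hT'.1 P (hT'.1 hP)).1 hP
      simp only at h
      rw [← h] at this
      exact (key T hT.1 P (hT'.1 hP)).2 this

theorem abs_card_coprime_aeval_eq_sub_le {a : L} (ha : IsIntegral K a) {b : L}
    (hb : b ∈ Algebra.adjoin K {a}) {f : K[X]} (hf : Squarefree f) (hfa : aeval a f ≠ 0) {m : ℕ}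
    (hm : f.natDegree ≤ m) :
    |(({g ∈ polysLT K m | IsCoprime f g ∧ aeval a g = b * aeval a f} : Finset K[X]).card : ℝ) -
      (Fintype.card K : ℝ) ^ m / (Fintype.card K : ℝ) ^ (minpoly K a).natDegree * weight f| ≤
      (Fintype.card K : ℝ) ^ (minpoly K a).natDegree := by
  have hq := one_lt_card_real (K := K)
  have hq0 : (0 : ℝ) < Fintype.card K := by linarith
  have e : ({g ∈ polysLT K m | IsCoprime f g ∧ aeval a g = b * aeval a f} : Finset K[X]) =
      {g ∈ ({g ∈ polysLT K m | aeval a g = b * aeval a f} : Finset K[X]) | IsCoprime f g} := by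
    rw [Finset.filter_filter]
    simp only [and_comm]
  rw [e]
  refine (abs_card_coprime_sub_le hf _ _
    (fun T => if m < (∏ P ∈ T, P).natDegree + (minpoly K a).natDegree then 1 else 0) ?_).trans ?_
  · intro T hT
    have hD := (monic_prod_primes hf.ne_zero hT).ne_zero
    have hDf := prod_primes_dvd hf.ne_zero hT
    have hDm := (natDegree_le_of_dvd hDf hf.ne_zero).trans hm
    generalize ∏ P ∈ T, P = D at *
    obtain ⟨f', rfl⟩ := hDf
    have h1 := card_filter_dvd hD hDm fun g => aeval a g = b * aeval a (D * f')
    rw [map_mul] at hfa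
    have hDa : aeval a D ≠ 0 := left_ne_zero_of_mul hfa
    simp only [map_mul, mul_left_comm b, mul_right_inj' hDa] at h1
    rw [Finset.filter_filter]
    simp only [map_mul, mul_left_comm b, and_comm (b := D ∣ _)]
    rw [h1]
    have h2 := abs_card_aeval_eq_sub_le ha (δ := b * aeval a f')
      (mul_mem hb (Algebra.adjoin_singleton_eq_range_aeval K a ▸ ⟨f', rfl⟩)) (m - D.natDegree)
    have h3 : m < D.natDegree + (minpoly K a).natDegree ↔
        m - D.natDegree < (minpoly K a).natDegree := by omega
    simp only [h3]
    convert h2 using 3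
    rw [pow_sub₀ _ hq0.ne' hDm]
    ring
  · rw [Finset.sum_boole]
    exact_mod_cast card_filter_lt_natDegree_prod_le hf hm

end Sieve

section Homogenization

variable {K : Type} [Field K]

theorem natDegree_aeval_le {d : ℕ} {h : MvPolynomial (Fin 2) K} (hh : h.IsHomogeneous d) :
    (MvPolynomial.aeval ![X, 1] h : K[X]).natDegree ≤ d := by
  rw [h.as_sum, MvPolynomial.aeval_sum]
  refine natDegree_sum_le_of_forall_le _ _ fun s hs => ?_
  have h1 : s 0 + s 1 = d := by
    have := hh.degree_eq_sum_deg_support hs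
    rw [this]
    simp [← Finsupp.degree_apply, Finsupp.degree_eq_sum]
  rw [MvPolynomial.aeval_monomial, Finsupp.prod_fintype _ _ (by simp)]
  simp only [Fin.prod_univ_two, Matrix.cons_val_zero, Matrix.cons_val_one, one_pow, mul_one,
    ← C_eq_algebraMap]
  exact (natDegree_C_mul_X_pow_le _ _).trans (by omega)

theorem aeval_homogenize_pair {L : Type} [Field L] [Algebra K L] {p : K[X]} {n : ℕ}
    (hn : p.natDegree ≤ n) (x z : L) (hz : z ≠ 0) :
    MvPolynomial.aeval ![x, z] (p.homogenize n) = z ^ n * aeval (x / z) p := by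
  rw [MvPolynomial.aeval_def, ← MvPolynomial.eval_map, ← homogenize_map,
    eval_homogenize (natDegree_map_le.trans hn) _ hz, mul_comm, aeval_def, eval_map]
  simp

theorem X_one_dvd_homogenize {p : K[X]} {n : ℕ} (hn : p.natDegree ≤ n) :
    MvPolynomial.X 1 ∣ p.homogenize (n + 1) := by
  have := homogenize_mul p 1 hn (n := 1) (by simp)
  rw [mul_one, homogenize_one, pow_one] at this
  exact ⟨_, this.trans (mul_comm _ _)⟩

theorem coeff_eq_zero_of_X_one_dvd {p : K[X]} {n : ℕ}
    (h : MvPolynomial.X 1 ∣ p.homogenize n) : p.coeff n = 0 := by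
  obtain ⟨y, hy⟩ := h
  have := congrArg (MvPolynomial.coeff (Finsupp.single 0 n)) hy
  simpa [coeff_homogenize, MvPolynomial.coeff_X_mul'] using this

theorem coeff_eq_zero_of_X_one_mul_self_dvd {p : K[X]} {n : ℕ}
    (h : MvPolynomial.X 1 * MvPolynomial.X 1 ∣ p.homogenize (n + 1)) : p.coeff n = 0 := by
  obtain ⟨y, hy⟩ := h
  have := congrArg (MvPolynomial.coeff (Finsupp.single 0 n + Finsupp.single 1 1)) hy
  simpa [coeff_homogenize, mul_assoc, MvPolynomial.coeff_X_mul'] using this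

theorem X_one_dvd_of_isUnit {e : ℕ} (he : e ≠ 0) {x : MvPolynomial (Fin 2) K}
    (hx : x.IsHomogeneous e) (hu : IsUnit (MvPolynomial.aeval ![X, 1] x : K[X])) :
    MvPolynomial.X 1 ∣ x := by
  rw [← homogenize_eq_of_isHomogeneous hx rfl]
  obtain ⟨e, rfl⟩ := Nat.exists_eq_succ_of_ne_zero he
  refine X_one_dvd_homogenize ?_
  rw [natDegree_eq_zero_of_isUnit hu]
  exact Nat.zero_le _

theorem not_isUnit_X_one : ¬ IsUnit (MvPolynomial.X 1 : MvPolynomial (Fin 2) K) := by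
  intro h
  have := h.map (MvPolynomial.aeval (fun _ => (0 : K)) : MvPolynomial (Fin 2) K →ₐ[K] K)
  simp at this

theorem not_isUnit_homogenize {x : K[X]} (hx : ¬ IsUnit x) :
    ¬ IsUnit (x.homogenize x.natDegree) := by
  intro h
  have := h.map (MvPolynomial.aeval ![X, 1] : MvPolynomial (Fin 2) K →ₐ[K] K[X])
  rw [aeval_homogenize_X_one x le_rfl] at this
  exact hx this

theorem totalDegree_ne_zero {x : MvPolynomial (Fin 2) K} (hx0 : x ≠ 0) (hx : ¬ IsUnit x) :
    x.totalDegree ≠ 0 := by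
  intro h
  rw [MvPolynomial.totalDegree_eq_zero_iff_eq_C] at h
  rw [h] at hx hx0
  refine hx (IsUnit.map MvPolynomial.C (isUnit_iff_ne_zero.2 fun h0 => hx0 ?_))
  rw [h0, map_zero]

theorem homogenize_dvd_homogenize {x p : K[X]} (hp : p ≠ 0) {n : ℕ} (hn : p.natDegree ≤ n)
    (h : x ∣ p) : x.homogenize x.natDegree ∣ p.homogenize n := by
  obtain ⟨y, rfl⟩ := h
  have hx := left_ne_zero_of_mul hp
  have hy := right_ne_zero_of_mul hp
  rw [natDegree_mul hx hy] at hn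
  have := homogenize_mul x y le_rfl (n := n - x.natDegree) (by omega)
  rw [Nat.add_sub_of_le (by omega)] at this
  exact ⟨_, this⟩

theorem homogeneousComponent_mul_of_totalDegree_le {x y : MvPolynomial (Fin 2) K} {m n : ℕ}
    (hx : x.totalDegree ≤ m) (hy : y.totalDegree ≤ n) :
    MvPolynomial.homogeneousComponent (m + n) (x * y) =
      MvPolynomial.homogeneousComponent m x * MvPolynomial.homogeneousComponent n y := by
  have hsum : ∀ {x : MvPolynomial (Fin 2) K} {m : ℕ}, x.totalDegree ≤ m →
      ∑ i ∈ Finset.range (m + 1), MvPolynomial.homogeneousComponent i x = x := by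
    intro x m hx
    conv_rhs => rw [← MvPolynomial.sum_homogeneousComponent x]
    symm
    refine Finset.sum_subset (Finset.range_subset_range.2 (by omega)) fun i _ hi => ?_
    exact MvPolynomial.homogeneousComponent_eq_zero _ _ (by simpa using hi)
  conv_lhs => rw [← hsum hx, ← hsum hy, Finset.sum_mul_sum, map_sum]
  rw [Finset.sum_eq_single m]
  · rw [map_sum, Finset.sum_eq_single n]
    · rw [MvPolynomial.homogeneousComponent_of_mem (n := m + n), if_pos rfl]
      exact (MvPolynomial.homogeneousComponent_isHomogeneous m x).mul
        (MvPolynomial.homogeneousComponent_isHomogeneous n y)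
    · intro j hj hne
      rw [MvPolynomial.homogeneousComponent_of_mem (n := m + j), if_neg (by omega)]
      exact (MvPolynomial.homogeneousComponent_isHomogeneous m x).mul
        (MvPolynomial.homogeneousComponent_isHomogeneous j y)
    · simp
  · intro i hi hne
    rw [map_sum]
    refine Finset.sum_eq_zero fun j hj => ?_
    rw [Finset.mem_range] at hi hj
    rw [MvPolynomial.homogeneousComponent_of_mem (n := i + j), if_neg (by omega)]
    exact (MvPolynomial.homogeneousComponent_isHomogeneous i x).mul
      (MvPolynomial.homogeneousComponent_isHomogeneous j y)
  · simp

/-- The homogeneous component of top degree. -/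
noncomputable def top (x : MvPolynomial (Fin 2) K) : MvPolynomial (Fin 2) K :=
  MvPolynomial.homogeneousComponent x.totalDegree x

theorem isHomogeneous_top (x : MvPolynomial (Fin 2) K) : (top x).IsHomogeneous x.totalDegree :=
  MvPolynomial.homogeneousComponent_isHomogeneous _ x

theorem top_mul (x y : MvPolynomial (Fin 2) K) : top (x * y) = top x * top y := by
  rcases eq_or_ne x 0 with rfl | hx
  · simp [top]
  rcases eq_or_ne y 0 with rfl | hy
  · simp [top]
  rw [top, MvPolynomial.totalDegree_mul_of_isDomain hx hy,
    homogeneousComponent_mul_of_totalDegree_le le_rfl le_rfl, top, top]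

theorem top_eq_self {d : ℕ} {h : MvPolynomial (Fin 2) K} (hh : h.IsHomogeneous d) :
    top h = h := by
  rcases eq_or_ne h 0 with rfl | h0
  · simp [top]
  rw [top, hh.totalDegree h0, MvPolynomial.homogeneousComponent_eq_self hh]

theorem top_dvd {d : ℕ} {h x : MvPolynomial (Fin 2) K} (hh : h.IsHomogeneous d) (hx : x ∣ h) :
    top x ∣ h := by
  obtain ⟨y, rfl⟩ := hx
  rw [← top_eq_self hh, top_mul]
  exact dvd_mul_right _ _

theorem squarefree_homogenize_iff {f : K[X]} {n : ℕ} (hf : f.natDegree ≤ n + 1) :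
    Squarefree (f.homogenize (n + 1)) ↔
      Squarefree f ∧ (f.natDegree = n ∨ f.natDegree = n + 1) := by
  have hhom := isHomogeneous_homogenize f (n := n + 1)
  constructor
  · intro h
    have hf0 : f ≠ 0 := by
      rintro rfl
      simp at h
    constructor
    · intro x hx
      by_contra hxu
      refine not_isUnit_homogenize hxu (h _ ?_)
      have hxx := ne_zero_of_dvd_ne_zero hf0 hx
      have := homogenize_dvd_homogenize hf0 hf hx
      have hx0 := left_ne_zero_of_mul hxx
      rwa [natDegree_mul hx0 hx0, homogenize_mul x x le_rfl le_rfl] at this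
    · by_contra hdeg
      obtain ⟨m, rfl⟩ : ∃ m, n = m + 1 := ⟨n - 1, by omega⟩
      refine not_isUnit_X_one (h _ ?_)
      have := homogenize_mul f 1 (m := m) (n := 2) (by omega) (by simp)
      rw [mul_one, homogenize_one, sq] at this
      exact ⟨_, this.trans (mul_comm _ _)⟩
  · rintro ⟨hsq, hdeg⟩ x hx
    by_contra hxu
    have hh0 : f.homogenize (n + 1) ≠ 0 := by
      rw [Ne, homogenize_eq_zero_iff hf]
      exact hsq.ne_zero
    have hx0 := left_ne_zero_of_mul (ne_zero_of_dvd_ne_zero hh0 hx)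
    have ht := top_dvd hhom hx
    rw [top_mul] at ht
    have hu : IsUnit (MvPolynomial.aeval ![X, 1] (top x) : K[X]) := by
      refine hsq _ ?_
      have := map_dvd (MvPolynomial.aeval ![X, 1] : MvPolynomial (Fin 2) K →ₐ[K] K[X]) ht
      rwa [map_mul, aeval_homogenize_X_one f hf] at this
    have hZ := X_one_dvd_of_isUnit (totalDegree_ne_zero hx0 hxu) (isHomogeneous_top x) hu
    have hZZ := (mul_dvd_mul hZ hZ).trans ht
    have c1 := coeff_eq_zero_of_X_one_mul_self_dvd hZZ
    have c2 := coeff_eq_zero_of_X_one_dvd ((dvd_mul_right _ _).trans hZZ)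
    have c3 : f.coeff f.natDegree = 0 := by
      rcases hdeg with h | h <;> rw [h] <;> assumption
    exact hsq.ne_zero (leadingCoeff_eq_zero.1 c3)

theorem isRelPrime_homogenize_iff {f g : K[X]} {n : ℕ} (hf : f.natDegree ≤ n + 1)
    (hg : g.natDegree ≤ n + 1) (hf0 : f ≠ 0) :
    IsRelPrime (g.homogenize (n + 1)) (f.homogenize (n + 1)) ↔
      IsCoprime f g ∧ (f.natDegree = n + 1 ∨ g.natDegree = n + 1) := by
  constructor
  · intro h
    constructor
    · refine isCoprime_of_irreducible_dvd (fun h => hf0 h.1) fun x hx hxf hxg => ?_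
      refine not_isUnit_homogenize hx.not_isUnit (h ?_ (homogenize_dvd_homogenize hf0 hf hxf))
      rcases eq_or_ne g 0 with rfl | hg0
      · simp
      · exact homogenize_dvd_homogenize hg0 hg hxg
    · by_contra hdeg
      push Not at hdeg
      exact not_isUnit_X_one (h (X_one_dvd_homogenize (by omega)) (X_one_dvd_homogenize (by omega)))
  · rintro ⟨hc, hdeg⟩ x hxg hxf
    by_contra hxu
    have hh0 : f.homogenize (n + 1) ≠ 0 := by rwa [Ne, homogenize_eq_zero_iff hf]
    have hx0 := ne_zero_of_dvd_ne_zero hh0 hxf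
    have htf := top_dvd (isHomogeneous_homogenize f) hxf
    have htg := top_dvd (isHomogeneous_homogenize g) hxg
    have hu : IsUnit (MvPolynomial.aeval ![X, 1] (top x) : K[X]) := by
      have h1 := map_dvd (MvPolynomial.aeval ![X, 1] : MvPolynomial (Fin 2) K →ₐ[K] K[X]) htf
      have h2 := map_dvd (MvPolynomial.aeval ![X, 1] : MvPolynomial (Fin 2) K →ₐ[K] K[X]) htg
      rw [aeval_homogenize_X_one f hf] at h1
      rw [aeval_homogenize_X_one g hg] at h2
      exact hc.isUnit_of_dvd' h1 h2
    have hZ := X_one_dvd_of_isUnit (totalDegree_ne_zero hx0 hxu) (isHomogeneous_top x) hu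
    have c1 := coeff_eq_zero_of_X_one_dvd (hZ.trans htf)
    have c2 := coeff_eq_zero_of_X_one_dvd (hZ.trans htg)
    rcases hdeg with h | h
    · rw [← h] at c1
      exact hf0 (leadingCoeff_eq_zero.1 c1)
    · rw [← h] at c2
      have := leadingCoeff_eq_zero.1 c2
      rw [this] at h
      simp at h

end Homogenization

section Bridge

variable {K : Type} [Field K] [Fintype K]

/-- The number of pairs of a square-free polynomial `f` of degree `m` and a polynomial `g` in `V`
coprime to `f` such that `Φ g f`. -/
noncomputable def pairCount (Φ : K[X] → K[X] → Prop) (m : ℕ) (V : Finset K[X]) : ℝ :=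
  ∑ f ∈ polysEq K m with Squarefree f,
    (({g ∈ V | IsCoprime f g ∧ Φ g f} : Finset K[X]).card : ℝ)

theorem card_sigma_eq_pairCount (Φ : K[X] → K[X] → Prop) (m : ℕ) (V : Finset K[X]) :
    ((({f ∈ polysEq K m | Squarefree f} : Finset K[X]).sigma
      fun f => ({g ∈ V | IsCoprime f g ∧ Φ g f} : Finset K[X])).card : ℝ) = pairCount Φ m V := by
  rw [Finset.card_sigma, pairCount]
  push_cast
  rfl

theorem card_pairs_eq (cond : MvPolynomial (Fin 2) K → MvPolynomial (Fin 2) K → Prop)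
    (Φ : K[X] → K[X] → Prop) (n : ℕ)
    (hΦ : ∀ g f : K[X], g.natDegree ≤ n + 1 → f.natDegree ≤ n + 1 →
      (cond (g.homogenize (n + 1)) (f.homogenize (n + 1)) ↔ Φ g f)) :
    (Nat.card {gh : MvPolynomial (Fin 2) K × MvPolynomial (Fin 2) K //
      gh.1.IsHomogeneous (n + 1) ∧ gh.2.IsHomogeneous (n + 1) ∧ Squarefree gh.2 ∧
      IsRelPrime gh.1 gh.2 ∧ cond gh.1 gh.2} : ℝ) =
    pairCount Φ (n + 1) (polysLT K (n + 2)) + pairCount Φ n (polysEq K (n + 1)) := by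
  set S₁ := ({f ∈ polysEq K (n + 1) | Squarefree f} : Finset K[X]).sigma
    fun f => ({g ∈ polysLT K (n + 2) | IsCoprime f g ∧ Φ g f} : Finset K[X]) with hS₁
  set S₂ := ({f ∈ polysEq K n | Squarefree f} : Finset K[X]).sigma
    fun f => ({g ∈ polysEq K (n + 1) | IsCoprime f g ∧ Φ g f} : Finset K[X]) with hS₂
  have hdisj : Disjoint S₁ S₂ := by
    rw [Finset.disjoint_left]
    rintro ⟨f, g⟩ h1 h2
    simp only [hS₁, hS₂, Finset.mem_sigma, Finset.mem_filter, mem_polysEq] at h1 h2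
    have := h1.1.1.symm.trans h2.1.1
    norm_cast at this
    omega
  rw [← card_sigma_eq_pairCount, ← card_sigma_eq_pairCount, ← Nat.cast_add,
    ← Finset.card_union_of_disjoint hdisj, ← Nat.card_eq_finsetCard]
  have hmem : ∀ f g : K[X], (⟨f, g⟩ : (_ : K[X]) × K[X]) ∈ S₁ ∪ S₂ ↔
      (f.natDegree ≤ n + 1 ∧ g.natDegree ≤ n + 1) ∧ Squarefree (f.homogenize (n + 1)) ∧
        IsRelPrime (g.homogenize (n + 1)) (f.homogenize (n + 1)) ∧
        cond (g.homogenize (n + 1)) (f.homogenize (n + 1)) := by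
    intro f g
    rcases eq_or_ne f 0 with rfl | hf0
    · simp [hS₁, hS₂]
    have e1 : g.degree < ((n + 2 : ℕ) : WithBot ℕ) ↔ g.natDegree ≤ n + 1 := by
      rcases eq_or_ne g 0 with rfl | hg0
      · exact iff_of_true (by rw [degree_zero]; exact WithBot.bot_lt_coe _) (by simp)
      · rw [← natDegree_lt_iff_degree_lt hg0]
        omega
    have e2 : g.degree = ((n + 1 : ℕ) : WithBot ℕ) ↔ g.natDegree = n + 1 :=
      degree_eq_iff_natDegree_eq_of_pos (Nat.succ_pos n)
    simp only [hS₁, hS₂, Finset.mem_union, Finset.mem_sigma, Finset.mem_filter, mem_polysEq,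
      mem_polysLT, degree_eq_iff_natDegree_eq hf0, e1, e2]
    constructor
    · rintro (⟨⟨h1, h2⟩, h3, h4, h5⟩ | ⟨⟨h1, h2⟩, h3, h4, h5⟩)
      · refine ⟨⟨h1.le, h3⟩, (squarefree_homogenize_iff h1.le).2 ⟨h2, Or.inr h1⟩,
          (isRelPrime_homogenize_iff h1.le h3 hf0).2 ⟨h4, Or.inl h1⟩, (hΦ g f h3 h1.le).2 h5⟩
      · have h6 : f.natDegree ≤ n + 1 := by omega
        exact ⟨⟨h6, h3.le⟩, (squarefree_homogenize_iff h6).2 ⟨h2, Or.inl h1⟩,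
          (isRelPrime_homogenize_iff h6 h3.le hf0).2 ⟨h4, Or.inr h3⟩, (hΦ g f h3.le h6).2 h5⟩
    · rintro ⟨⟨h1, h2⟩, h3, h4, h5⟩
      rw [squarefree_homogenize_iff h1] at h3
      rw [isRelPrime_homogenize_iff h1 h2 hf0] at h4
      rw [hΦ g f h2 h1] at h5
      rcases h3.2 with h6 | h6
      · exact Or.inr ⟨⟨h6, h3.1⟩, h4.2.resolve_left (by omega), h4.1, h5⟩
      · exact Or.inl ⟨⟨h6, h3.1⟩, h2, h4.1, h5⟩
  symm
  congr 1
  refine Nat.card_eq_of_bijective (fun x => ⟨(x.1.2.homogenize (n + 1), x.1.1.homogenize (n + 1)),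
    isHomogeneous_homogenize _, isHomogeneous_homogenize _, ((hmem _ _).1 x.2).2⟩) ⟨?_, ?_⟩
  · rintro ⟨⟨f, g⟩, hx⟩ ⟨⟨f', g'⟩, hx'⟩ h
    rw [hmem] at hx hx'
    simp only [Subtype.mk.injEq, Prod.mk.injEq] at h
    have h1 := congrArg (MvPolynomial.aeval ![X, 1] : MvPolynomial (Fin 2) K →ₐ[K] K[X]) h.1
    have h2 := congrArg (MvPolynomial.aeval ![X, 1] : MvPolynomial (Fin 2) K →ₐ[K] K[X]) h.2
    rw [aeval_homogenize_X_one _ hx.1.2, aeval_homogenize_X_one _ hx'.1.2] at h1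
    rw [aeval_homogenize_X_one _ hx.1.1, aeval_homogenize_X_one _ hx'.1.1] at h2
    subst h1 h2
    rfl
  · rintro ⟨⟨g, h⟩, hg, hh, hrest⟩
    have e1 := homogenize_eq_of_isHomogeneous hg rfl
    have e2 := homogenize_eq_of_isHomogeneous hh rfl
    refine ⟨⟨⟨MvPolynomial.aeval ![X, 1] h, MvPolynomial.aeval ![X, 1] g⟩, (hmem _ _).2
      ⟨⟨natDegree_aeval_le hh, natDegree_aeval_le hg⟩, ?_⟩⟩, ?_⟩
    · rw [e1, e2]
      exact hrest
    · simp only [e1, e2]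

end Bridge

section GeomLimit

/-- The sequence `x` converges to `l` with error `O(r ^ n)`. -/
def GeomLimit (r : ℝ) (x : ℕ → ℝ) (l : ℝ) : Prop := ∃ C : ℝ, ∀ n, |x n - l| ≤ C * r ^ n

variable {r : ℝ} {x y : ℕ → ℝ} {l m : ℝ}

theorem GeomLimit.add (hx : GeomLimit r x l) (hy : GeomLimit r y m) :
    GeomLimit r (fun n => x n + y n) (l + m) := by
  obtain ⟨C, hC⟩ := hx
  obtain ⟨D, hD⟩ := hy
  refine ⟨C + D, fun n => ?_⟩
  rw [add_mul, add_sub_add_comm]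
  exact (abs_add_le _ _).trans (add_le_add (hC n) (hD n))

theorem GeomLimit.const_mul (c : ℝ) (hx : GeomLimit r x l) :
    GeomLimit r (fun n => c * x n) (c * l) := by
  obtain ⟨C, hC⟩ := hx
  refine ⟨|c| * C, fun n => ?_⟩
  rw [← mul_sub, abs_mul, mul_assoc]
  exact mul_le_mul_of_nonneg_left (hC n) (abs_nonneg c)

theorem GeomLimit.sub (hx : GeomLimit r x l) (hy : GeomLimit r y m) :
    GeomLimit r (fun n => x n - y n) (l - m) := by
  simpa [sub_eq_add_neg] using hx.add (hy.const_mul (-1))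

theorem GeomLimit.succ (hx : GeomLimit r x l) : GeomLimit r (fun n => x (n + 1)) l := by
  obtain ⟨C, hC⟩ := hx
  refine ⟨C * r, fun n => (hC (n + 1)).trans_eq ?_⟩
  ring

theorem GeomLimit.of_abs_sub_le (hx : GeomLimit r x l) {C : ℝ}
    (h : ∀ n, |y n - x n| ≤ C * r ^ n) : GeomLimit r y l := by
  obtain ⟨D, hD⟩ := hx
  refine ⟨C + D, fun n => ?_⟩
  rw [add_mul, ← sub_add_sub_cancel _ (x n)]
  exact (abs_add_le _ _).trans (add_le_add (h n) (hD n))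

theorem GeomLimit.div (hx : GeomLimit r x l) (hy : GeomLimit r y m) (hm : 0 < m)
    (h0 : ∀ n, 0 ≤ x n) (h1 : ∀ n, x n ≤ y n) : GeomLimit r (fun n => x n / y n) (l / m) := by
  obtain ⟨C, hC⟩ := hx
  obtain ⟨D, hD⟩ := hy
  refine ⟨(C + D) / m, fun n => ?_⟩
  have hb : |x n / y n| ≤ 1 := by
    rw [abs_of_nonneg (div_nonneg (h0 n) ((h0 n).trans (h1 n)))]
    exact div_le_one_of_le₀ (h1 n) ((h0 n).trans (h1 n))
  have e : x n / y n - l / m = ((x n - l) + x n / y n * (m - y n)) / m := by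
    rcases eq_or_ne (y n) 0 with hy0 | hy0
    · have : x n = 0 := le_antisymm (hy0 ▸ h1 n) (h0 n)
      rw [this]
      simp [neg_div]
    · field_simp
      ring
  rw [e, abs_div, abs_of_pos hm, div_mul_eq_mul_div (C + D)]
  refine div_le_div_of_nonneg_right ?_ hm.le
  refine (abs_add_le _ _).trans ?_
  rw [add_mul, abs_mul, abs_sub_comm m]
  have := mul_le_mul hb (hD n) (abs_nonneg _) zero_le_one
  rw [one_mul] at this
  exact add_le_add (hC n) this

theorem exists_rpow_bound {q : ℝ} (hq : 1 < q) {X : ℕ → ℝ} {l : ℝ}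
    (h : ∀ r : ℝ, 0 < r → r < 1 → 1 < q * r ^ 2 → GeomLimit r (fun n => X (n + 1)) l)
    {ε : ℝ} (hε : 0 < ε) :
    ∃ C : ℝ, 0 < C ∧ ∀ d : ℕ, |X d - l| ≤ C * q ^ ((-1 / 2 + ε) * d) := by
  have hq0 : 0 < q := by linarith
  set e := min ε (1 / 4) with he
  have he0 : 0 < e := lt_min hε (by norm_num)
  have he1 : e ≤ 1 / 4 := min_le_right _ _
  set r := q ^ (-1 / 2 + e) with hr
  have hr0 : 0 < r := Real.rpow_pos_of_pos hq0 _
  have hr1 : r < 1 := Real.rpow_lt_one_of_one_lt_of_neg hq (by linarith)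
  have hqr : 1 < q * r ^ 2 := by
    have : q * r ^ 2 = q ^ (2 * e) := by
      have h2 := Real.rpow_add hq0 1 ((-1 / 2 + e) * (2 : ℕ))
      rw [Real.rpow_one, Real.rpow_mul hq0.le, Real.rpow_natCast, ← hr] at h2
      rw [← h2]
      congr 1
      push_cast
      ring
    rw [this]
    exact Real.one_lt_rpow hq (by linarith)
  obtain ⟨C, hC⟩ := h r hr0 hr1 hqr
  have hC0 : 0 ≤ C := by
    have := (abs_nonneg _).trans (hC 0)
    simpa using this
  refine ⟨|X 0 - l| + C / r + 1, by positivity, fun d => ?_⟩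
  have h1 : r ^ d ≤ q ^ ((-1 / 2 + ε) * d) := by
    rw [hr, ← Real.rpow_natCast, ← Real.rpow_mul hq0.le]
    refine Real.rpow_le_rpow_of_exponent_le hq.le ?_
    gcongr
    exact min_le_left _ _
  refine le_trans ?_ (mul_le_mul_of_nonneg_left h1 (by positivity))
  rcases d with _ | n
  · rw [pow_zero, mul_one]
    have : 0 ≤ C / r := by positivity
    linarith
  · calc |X (n + 1) - l| ≤ C * r ^ n := hC n
      _ = C / r * r ^ (n + 1) := by
        rw [pow_succ]
        field_simp
      _ ≤ _ := by
        gcongr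
        have := abs_nonneg (X 0 - l)
        linarith

end GeomLimit

section PairCount

variable {K : Type} [Field K] [Fintype K]

theorem card_filter_polysEq (φ : K[X] → Prop) (m : ℕ) :
    (({g ∈ polysEq K m | φ g} : Finset K[X]).card : ℝ) =
      (({g ∈ polysLT K (m + 1) | φ g} : Finset K[X]).card : ℝ) -
        (({g ∈ polysLT K m | φ g} : Finset K[X]).card : ℝ) := by
  rw [polysLT_succ, Finset.filter_union, Finset.card_union_of_disjoint
    (Finset.disjoint_filter_filter (disjoint_polysLT_polysEq m))]
  push_cast
  ring

theorem pairCount_polysEq (Φ : K[X] → K[X] → Prop) (m l : ℕ) :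
    pairCount Φ m (polysEq K l) =
      pairCount Φ m (polysLT K (l + 1)) - pairCount Φ m (polysLT K l) := by
  simp only [pairCount, ← Finset.sum_sub_distrib]
  refine Finset.sum_congr rfl fun f _ => ?_
  convert card_filter_polysEq (fun g => IsCoprime f g ∧ Φ g f) l

theorem pairCount_nonneg (Φ : K[X] → K[X] → Prop) (m : ℕ) (V : Finset K[X]) :
    0 ≤ pairCount Φ m V :=
  Finset.sum_nonneg fun _ _ => Nat.cast_nonneg _

theorem pairCount_mono {Φ Ψ : K[X] → K[X] → Prop} (h : ∀ g f, Φ g f → Ψ g f) (m : ℕ)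
    (V : Finset K[X]) : pairCount Φ m V ≤ pairCount Ψ m V := by
  refine Finset.sum_le_sum fun f _ => Nat.cast_le.2 (Finset.card_le_card fun g hg => ?_)
  rw [Finset.mem_filter] at hg ⊢
  exact ⟨hg.1, hg.2.1, h _ _ hg.2.2⟩

theorem pairCount_polysLT_of_right (φ : K[X] → Prop) {m l : ℕ} (hml : m ≤ l) :
    pairCount (fun _ f => φ f) m (polysLT K l) =
      (Fintype.card K : ℝ) ^ l * ∑ f ∈ polysEq K m, if φ f then sqfWeight f else 0 := by
  simp only [sqfWeight, ← ite_and, and_comm (a := φ _)]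
  simp only [ite_and]
  rw [← Finset.sum_filter, Finset.mul_sum, pairCount]
  refine Finset.sum_congr rfl fun f hf => ?_
  rw [Finset.mem_filter] at hf
  split_ifs with h
  · simp only [h, and_true]
    refine card_coprime_polysLT hf.2 ?_
    rwa [natDegree_eq_of_degree_eq_some (mem_polysEq.1 hf.1)]
  · simp [h]

variable {L : Type} [Field L] [Algebra K L]

theorem abs_pairCount_aeval_sub_le {a : L} (ha : IsIntegral K a) {b : L}
    (hb : b ∈ Algebra.adjoin K {a}) {m l : ℕ} (hml : m ≤ l) :
    |pairCount (fun (g f : K[X]) => aeval a g = b * aeval a f) m (polysLT K l) -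
      (Fintype.card K : ℝ) ^ l / (Fintype.card K : ℝ) ^ (minpoly K a).natDegree *
        ∑ f ∈ polysEq K m, if minpoly K a ∣ f then 0 else sqfWeight f| ≤
      (Fintype.card K : ℝ) ^ (m + 1) * (Fintype.card K : ℝ) ^ (minpoly K a).natDegree := by
  have hq := one_lt_card_real (K := K)
  have e : ∀ f : K[X], (if minpoly K a ∣ f then 0 else sqfWeight f) =
      if Squarefree f then (if minpoly K a ∣ f then 0 else weight f) else 0 := by
    intro f
    rw [sqfWeight]
    split_ifs <;> rfl
  simp only [e]
  rw [← Finset.sum_filter, Finset.mul_sum, pairCount, ← Finset.sum_sub_distrib]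
  refine (Finset.abs_sum_le_sum_abs _ _).trans ?_
  refine (Finset.sum_le_card_nsmul _ _
    ((Fintype.card K : ℝ) ^ (minpoly K a).natDegree) fun f hf => ?_).trans ?_
  · rw [Finset.mem_filter] at hf
    split_ifs with h
    · rw [mul_zero, sub_zero, Finset.filter_false_of_mem]
      · simp
      · rintro g - ⟨⟨s, t, hst⟩, h2⟩
        rw [minpoly.dvd_iff] at h
        have := congrArg (aeval a) hst
        simp [h2, h] at this
    · rw [minpoly.dvd_iff] at h
      refine abs_card_coprime_aeval_eq_sub_le ha hb hf.2 h ?_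
      rwa [natDegree_eq_of_degree_eq_some (mem_polysEq.1 hf.1)]
  · rw [nsmul_eq_mul]
    gcongr
    calc (({f ∈ polysEq K m | Squarefree f} : Finset K[X]).card : ℝ)
        ≤ (polysEq K m).card := by exact_mod_cast Finset.card_filter_le _ _
      _ ≤ _ := by
        rw [card_polysEq, pow_succ']
        gcongr
        linarith

/-- The number of coprime pairs of forms of degree `n + 1` satisfying `Φ`, the second one
square-free, counted through dehomogenization. -/
noncomputable def formCount (Φ : K[X] → K[X] → Prop) (n : ℕ) : ℝ :=
  pairCount Φ (n + 1) (polysLT K (n + 2)) + pairCount Φ n (polysEq K (n + 1))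

theorem formCount_nonneg (Φ : K[X] → K[X] → Prop) (n : ℕ) : 0 ≤ formCount Φ n :=
  add_nonneg (pairCount_nonneg _ _ _) (pairCount_nonneg _ _ _)

theorem formCount_le (Φ : K[X] → K[X] → Prop) (n : ℕ) :
    formCount Φ n ≤ formCount (K := K) (fun _ _ => True) n :=
  add_le_add (pairCount_mono (fun _ _ _ => trivial) _ _)
    (pairCount_mono (fun _ _ _ => trivial) _ _)

theorem formCount_of_right (φ : K[X] → Prop) (n : ℕ) :
    formCount (fun _ f => φ f) n / (Fintype.card K : ℝ) ^ (2 * n + 3) =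
      (∑ f ∈ polysEq K (n + 1), if φ f then sqfWeight f else 0) / (Fintype.card K : ℝ) ^ (n + 1) +
      ((Fintype.card K : ℝ) - 1) / (Fintype.card K : ℝ) ^ 2 *
        ((∑ f ∈ polysEq K n, if φ f then sqfWeight f else 0) / (Fintype.card K : ℝ) ^ n) := by
  have hq := one_lt_card_real (K := K)
  rw [formCount, pairCount_polysEq, pairCount_polysLT_of_right _ (by omega),
    pairCount_polysLT_of_right _ (by omega), pairCount_polysLT_of_right _ (by omega)]
  have hq0 : (Fintype.card K : ℝ) ≠ 0 := by positivity
  field_simp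
  ring

theorem formCount_true (n : ℕ) :
    formCount (K := K) (fun _ _ => True) n / (Fintype.card K : ℝ) ^ (2 * n + 3) =
      sqfMean K (n + 1) + ((Fintype.card K : ℝ) - 1) / (Fintype.card K : ℝ) ^ 2 * sqfMean K n := by
  rw [formCount_of_right (fun _ => True)]
  simp [sqfMean, sqfSum]

theorem formCount_dvd (P : K[X]) (n : ℕ) :
    formCount (fun _ f => P ∣ f) n / (Fintype.card K : ℝ) ^ (2 * n + 3) =
      (sqfMean K (n + 1) - avoidMean P (n + 1)) +
        ((Fintype.card K : ℝ) - 1) / (Fintype.card K : ℝ) ^ 2 *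
          (sqfMean K n - avoidMean P n) := by
  have h : ∀ m, (∑ f ∈ polysEq K m, if P ∣ f then sqfWeight f else 0) /
      (Fintype.card K : ℝ) ^ m = sqfMean K m - avoidMean P m := by
    intro m
    rw [sqfMean, avoidMean, sqfSum, ← sub_div, ← Finset.sum_sub_distrib]
    congr 1
    refine Finset.sum_congr rfl fun f _ => ?_
    split_ifs <;> simp
  rw [formCount_of_right (fun f => P ∣ f), h, h]

theorem abs_formCount_aeval_sub_le {a : L} (ha : IsIntegral K a) {b : L}
    (hb : b ∈ Algebra.adjoin K {a}) (n : ℕ) :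
    |formCount (fun (g f : K[X]) => aeval a g = b * aeval a f) n / (Fintype.card K : ℝ) ^ (2 * n + 3) -
      ((Fintype.card K : ℝ) ^ (minpoly K a).natDegree)⁻¹ * (avoidMean (minpoly K a) (n + 1) +
        ((Fintype.card K : ℝ) - 1) / (Fintype.card K : ℝ) ^ 2 * avoidMean (minpoly K a) n)| ≤
      3 * (Fintype.card K : ℝ) ^ (minpoly K a).natDegree * ((Fintype.card K : ℝ)⁻¹) ^ n := by
  have hq := one_lt_card_real (K := K)
  have h1 := abs_pairCount_aeval_sub_le ha hb (m := n + 1) (l := n + 2) (by omega)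
  have h2 := abs_pairCount_aeval_sub_le ha hb (m := n) (l := n + 2) (by omega)
  have h3 := abs_pairCount_aeval_sub_le ha hb (m := n) (l := n + 1) (by omega)
  rw [formCount, pairCount_polysEq, avoidMean, avoidMean]
  generalize pairCount (fun (g f : K[X]) => aeval a g = b * aeval a f) (n + 1) (polysLT K (n + 2)) = x1 at *
  generalize pairCount (fun (g f : K[X]) => aeval a g = b * aeval a f) n (polysLT K (n + 1 + 1)) = x2 at *
  generalize pairCount (fun (g f : K[X]) => aeval a g = b * aeval a f) n (polysLT K (n + 1)) = x3 at *
  generalize (∑ f ∈ polysEq K (n + 1), if minpoly K a ∣ f then 0 else sqfWeight f) = y1 at *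
  generalize (∑ f ∈ polysEq K n, if minpoly K a ∣ f then 0 else sqfWeight f) = y2 at *
  generalize (minpoly K a).natDegree = u at *
  generalize (Fintype.card K : ℝ) = q at *
  have hq0 : 0 < q := by linarith
  have e : (x1 + (x2 - x3)) / q ^ (2 * n + 3) -
      (q ^ u)⁻¹ * (y1 / q ^ (n + 1) + (q - 1) / q ^ 2 * (y2 / q ^ n)) =
      ((x1 - q ^ (n + 2) / q ^ u * y1) + ((x2 - q ^ (n + 2) / q ^ u * y2) -
        (x3 - q ^ (n + 1) / q ^ u * y2))) / q ^ (2 * n + 3) := by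
    field_simp
    ring
  rw [e, abs_div, abs_of_pos (by positivity : 0 < q ^ (2 * n + 3)), div_le_iff₀ (by positivity)]
  calc _ ≤ q ^ (n + 1 + 1) * q ^ u + (q ^ (n + 1) * q ^ u + q ^ (n + 1) * q ^ u) :=
        (abs_add_le _ _).trans (add_le_add h1 ((abs_sub _ _).trans (add_le_add h2 h3)))
    _ ≤ q ^ (n + 3) * q ^ u + (q ^ (n + 3) * q ^ u + q ^ (n + 3) * q ^ u) := by
        have h4 : q ^ (n + 1 + 1) ≤ q ^ (n + 3) := pow_le_pow_right₀ hq.le (by omega)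
        have h5 : q ^ (n + 1) ≤ q ^ (n + 3) := pow_le_pow_right₀ hq.le (by omega)
        gcongr
    _ = _ := by
        rw [inv_pow]
        field_simp
        ring

end PairCount

section Limits

variable {K L : Type} [Field K] [Fintype K] [Field L] [Algebra K L]

theorem geomLimit_formCount (hq3 : 3 ≤ Fintype.card K) {a : L} (ha : IsIntegral K a) {r : ℝ}
    (hr : 0 < r) (hr1 : r < 1) (hqr : 1 < Fintype.card K * r ^ 2) {Q : ℝ}
    (hQ : Q = ((Fintype.card K : ℝ) ^ (minpoly K a).natDegree)⁻¹) :
    GeomLimit r (fun n => formCount (K := K) (fun _ f => minpoly K a ∣ f) n /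
      formCount (K := K) (fun _ _ => True) n) (Q * (1 - Q) / (1 + Q - Q ^ 2)) ∧
    ∀ b ∈ Algebra.adjoin K {a},
      GeomLimit r (fun n => formCount (K := K) (fun g f => aeval a g = b * aeval a f) n /
        formCount (K := K) (fun _ _ => True) n) (Q / (1 + Q - Q ^ 2)) := by
  have hq := one_lt_card_real (K := K)
  have hP : Irreducible (minpoly K a) ∧ (minpoly K a).Monic :=
    ⟨minpoly.irreducible ha, minpoly.monic ha⟩
  obtain ⟨c, hc0, hc⟩ := exists_sqfMean_limit_pos hq3
  have hy : GeomLimit r (sqfMean K) c := hc r hr hr1 hqr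
  have hx : GeomLimit r (avoidMean (minpoly K a)) (c / (1 + (1 - Q) * Q)) := by
    obtain ⟨C, hC⟩ := hc r hr hr1 hqr
    have := exists_avoidMean_limit hP hr hr1 hqr hC
    rw [localWeight, ← hQ] at this
    exact this
  set κ : ℝ := ((Fintype.card K : ℝ) - 1) / (Fintype.card K : ℝ) ^ 2 with hκ
  have hκ0 : 0 < κ := div_pos (by linarith) (by positivity)
  have hQ0 : 0 < Q := by
    rw [hQ]
    positivity
  have hQ1 : Q ≤ 1 := by
    rw [hQ]
    exact inv_le_one_of_one_le₀ (one_le_pow₀ hq.le)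
  have hD : 0 < 1 + Q - Q ^ 2 := by nlinarith
  have hA := hy.succ.add (hy.const_mul κ)
  have hA0 : 0 < c + κ * c := by positivity
  have hpos : ∀ n : ℕ, 0 < (Fintype.card K : ℝ) ^ (2 * n + 3) := fun n => by positivity
  have key : ∀ {Φ : K[X] → K[X] → Prop} {l : ℝ},
      GeomLimit r (fun n => formCount Φ n / (Fintype.card K : ℝ) ^ (2 * n + 3)) l →
      GeomLimit r (fun n => formCount Φ n / formCount (K := K) (fun _ _ => True) n)
        (l / (c + κ * c)) := by
    intro Φ l h
    have := h.div (y := fun n => formCount (K := K) (fun _ _ => True) n /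
      (Fintype.card K : ℝ) ^ (2 * n + 3)) (m := c + κ * c) (by simpa only [formCount_true] using hA)
      hA0 (fun n => div_nonneg (formCount_nonneg _ _) (hpos n).le)
      (fun n => div_le_div_of_nonneg_right (formCount_le _ _) (hpos n).le)
    simpa only [div_div_div_cancel_right₀ (hpos _).ne'] using this
  have hD' : 1 + (1 - Q) * Q = 1 + Q - Q ^ 2 := by ring
  rw [hD'] at hx
  refine ⟨?_, fun b hb => ?_⟩
  · have h1 := (hy.succ.sub hx.succ).add ((hy.sub hx).const_mul κ)
    simp only [hκ, ← formCount_dvd] at h1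
    convert key h1 using 1
    rw [← hκ]
    field_simp
    ring
  · have h1 := (hx.succ.add (hx.const_mul κ)).const_mul Q
    have hqi : (Fintype.card K : ℝ)⁻¹ ≤ r := by
      rw [inv_le_iff_one_le_mul₀ (by linarith)]
      nlinarith
    have h2 := h1.of_abs_sub_le (y := fun n =>
      formCount (K := K) (fun g f => aeval a g = b * aeval a f) n /
        (Fintype.card K : ℝ) ^ (2 * n + 3))
      (C := 3 * (Fintype.card K : ℝ) ^ (minpoly K a).natDegree) fun n => by
        rw [hQ, hκ]
        refine (abs_formCount_aeval_sub_le ha hb n).trans ?_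
        gcongr
    convert key h2 using 1
    field_simp

end Limits

section Proportion

variable {K : Type} [Field K]

/-- The number of coprime pairs of forms of degree `d` satisfying `cond`, the second one
square-free. -/
noncomputable def ordCard (d : ℕ)
    (cond : MvPolynomial (Fin 2) K → MvPolynomial (Fin 2) K → Prop) : ℝ :=
  (Nat.card {gh : MvPolynomial (Fin 2) K × MvPolynomial (Fin 2) K //
    gh.1.IsHomogeneous d ∧ gh.2.IsHomogeneous d ∧ Squarefree gh.2 ∧
      IsRelPrime gh.1 gh.2 ∧ cond gh.1 gh.2} : ℝ)

theorem ordCard_true (d : ℕ) : ordCard (K := K) d (fun _ _ => True) =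
    (Nat.card {gh : MvPolynomial (Fin 2) K × MvPolynomial (Fin 2) K //
      gh.1.IsHomogeneous d ∧ gh.2.IsHomogeneous d ∧ Squarefree gh.2 ∧
        IsRelPrime gh.1 gh.2} : ℝ) := by
  simp only [ordCard, and_true]

theorem ordCard_congr (d : ℕ) {cond cond' : MvPolynomial (Fin 2) K → MvPolynomial (Fin 2) K → Prop}
    (σ : Equiv.Perm (Fin 2)) (h : ∀ x y, cond' (MvPolynomial.rename σ x) (MvPolynomial.rename σ y) ↔
      cond x y) : ordCard d cond = ordCard d cond' := by
  rw [ordCard, ordCard]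
  congr 1
  set e := MvPolynomial.renameEquiv K σ
  have he : ∀ x, e x = MvPolynomial.rename σ x := fun x => rfl
  refine Nat.card_congr ((e.toEquiv.prodCongr e.toEquiv).subtypeEquiv ?_)
  rintro ⟨x, y⟩
  have h1 : ∀ x : MvPolynomial (Fin 2) K, (e x).IsHomogeneous d ↔ x.IsHomogeneous d := fun x =>
    MvPolynomial.IsHomogeneous.rename_isHomogeneous_iff σ.injective
  have h2 : Squarefree (e y) ↔ Squarefree y := by
    constructor
    · intro h z hz
      exact (MulEquiv.isUnit_map e).1 (h (e z) (by rw [← map_mul]; exact map_dvd e hz))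
    · intro h z hz
      have := map_dvd e.symm hz
      rw [map_mul, AlgEquiv.symm_apply_apply] at this
      exact (MulEquiv.isUnit_map e.symm).1 (h _ this)
  have h3 : IsRelPrime (e x) (e y) ↔ IsRelPrime x y := by
    constructor
    · intro h z hx hy
      exact (MulEquiv.isUnit_map e).1 (h (map_dvd e hx) (map_dvd e hy))
    · intro h z hx hy
      have := h (map_dvd e.symm hx |>.trans (by simp)) (map_dvd e.symm hy |>.trans (by simp))
      exact (MulEquiv.isUnit_map e.symm).1 this
  have h4 : cond' (e x) (e y) ↔ cond x y := h x y
  simp only [Equiv.prodCongr_apply, Prod.map_apply, AlgEquiv.toEquiv_eq_coe, EquivLike.coe_coe,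
    h1, h2, h3, h4]

variable [Fintype K]

theorem ordCard_succ {cond : MvPolynomial (Fin 2) K → MvPolynomial (Fin 2) K → Prop}
    {Φ : K[X] → K[X] → Prop} (hΦ : ∀ (n : ℕ) (g f : K[X]), g.natDegree ≤ n → f.natDegree ≤ n →
      (cond (g.homogenize n) (f.homogenize n) ↔ Φ g f)) (n : ℕ) :
    ordCard (n + 1) cond = formCount Φ n :=
  card_pairs_eq cond Φ n (hΦ (n + 1))

theorem exists_ordCard_bound {cond : MvPolynomial (Fin 2) K → MvPolynomial (Fin 2) K → Prop}
    {Φ : K[X] → K[X] → Prop} (hΦ : ∀ (n : ℕ) (g f : K[X]), g.natDegree ≤ n → f.natDegree ≤ n →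
      (cond (g.homogenize n) (f.homogenize n) ↔ Φ g f)) {l : ℝ}
    (h : ∀ r : ℝ, 0 < r → r < 1 → 1 < Fintype.card K * r ^ 2 →
      GeomLimit r (fun n => formCount Φ n / formCount (K := K) (fun _ _ => True) n) l)
    {ε : ℝ} (hε : 0 < ε) :
    ∃ C : ℝ, 0 < C ∧ ∀ d : ℕ, |ordCard d cond / ordCard (K := K) d (fun _ _ => True) - l| ≤
      C * (Fintype.card K : ℝ) ^ ((-1 / 2 + ε) * d) := by
  refine exists_rpow_bound
    (X := fun d => ordCard d cond / ordCard (K := K) d (fun _ _ => True)) one_lt_card_real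
    (fun r hr hr1 hqr => ?_) hε
  simp only [ordCard_succ hΦ, ordCard_succ (K := K) (cond := fun _ _ => True)
    (Φ := fun _ _ => True) (fun _ _ _ _ _ => Iff.rfl)]
  exact h r hr hr1 hqr

variable {L : Type} [Field L] [Algebra K L]

theorem exists_ordCard_value_bound (hq3 : 3 ≤ Fintype.card K) {x z : L} (hz : z ≠ 0)
    (ha : IsIntegral K (x / z)) {Q : ℝ}
    (hQ : Q = ((Fintype.card K : ℝ) ^ (minpoly K (x / z)).natDegree)⁻¹) {ε : ℝ} (hε : 0 < ε) :
    (∃ C : ℝ, 0 < C ∧ ∀ d : ℕ,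
      |ordCard (K := K) d (fun _ h => MvPolynomial.aeval ![x, z] h = 0) /
        ordCard (K := K) d (fun _ _ => True) - Q * (1 - Q) / (1 + Q - Q ^ 2)| ≤
      C * (Fintype.card K : ℝ) ^ ((-1 / 2 + ε) * d)) ∧
    ∀ β ∈ Algebra.adjoin K {x / z}, ∃ C : ℝ, 0 < C ∧ ∀ d : ℕ,
      |ordCard (K := K) d (fun g h =>
          β * MvPolynomial.aeval ![x, z] h - MvPolynomial.aeval ![x, z] g = 0) /
        ordCard (K := K) d (fun _ _ => True) - Q / (1 + Q - Q ^ 2)| ≤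
      C * (Fintype.card K : ℝ) ^ ((-1 / 2 + ε) * d) := by
  refine ⟨exists_ordCard_bound (Φ := fun _ f => minpoly K (x / z) ∣ f) (fun n g f hg hf => ?_)
    (fun r hr hr1 hqr => (geomLimit_formCount hq3 ha hr hr1 hqr hQ).1) hε,
    fun β hβ => exists_ordCard_bound (Φ := fun g f => aeval (x / z) g = β * aeval (x / z) f)
      (fun n g f hg hf => ?_)
      (fun r hr hr1 hqr => (geomLimit_formCount hq3 ha hr hr1 hqr hQ).2 β hβ) hε⟩
  · rw [aeval_homogenize_pair hf _ _ hz, minpoly.dvd_iff, mul_eq_zero,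
      or_iff_right (pow_ne_zero n hz)]
  · rw [aeval_homogenize_pair hf _ _ hz, aeval_homogenize_pair hg _ _ hz, mul_left_comm, ← mul_sub,
      mul_eq_zero, or_iff_right (pow_ne_zero n hz), sub_eq_zero, eq_comm]

end Proportion

end SquarefreeCount

open Classical MvPolynomial in
/-- For the ordinary family (coprime pairs with `h` square-free) of homogeneous
degree-`d` polynomials, and `α ∈ P¹(F_{q^k})` of degree `u`, the proportion of
pairs with `g/h` taking value `β` at `α` is
`q^{−u}(1−q^{−u})/(1+q^{−u}−q^{−2u}) + O(q^{(−1/2+ε)d+u})` for `β = ∞`, and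
`q^{−u}/(1+q^{−u}−q^{−2u}) + O(q^{(−1/2+ε)d})` for `β ∈ F_{q^u}`. -/
theorem ordinary_family_value_proportion (p q k u : ℕ) (hp : p.Prime) (hodd : Odd p)
    (hq : ∃ a : ℕ, 0 < a ∧ q = p ^ a)
    (K L : Type) [Field K] [Fintype K] [Field L] [Fintype L] [Algebra K L]
    (hK : Fintype.card K = q) (hL : Fintype.card L = q ^ k)
    (αX αZ : L) (hα : (αX, αZ) ≠ 0)
    (hu : u = if αZ = 0 then 1 else (minpoly K (αX / αZ)).natDegree) :
    (∀ ε : ℝ, 0 < ε → ∃ C : ℝ, 0 < C ∧ ∀ d : ℕ,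
      |(Nat.card {gh : MvPolynomial (Fin 2) K × MvPolynomial (Fin 2) K //
            gh.1.IsHomogeneous d ∧ gh.2.IsHomogeneous d ∧ Squarefree gh.2 ∧
            IsRelPrime gh.1 gh.2 ∧ aeval ![αX, αZ] gh.2 = 0} : ℝ) /
          (Nat.card {gh : MvPolynomial (Fin 2) K × MvPolynomial (Fin 2) K //
            gh.1.IsHomogeneous d ∧ gh.2.IsHomogeneous d ∧ Squarefree gh.2 ∧
            IsRelPrime gh.1 gh.2} : ℝ)
          - (q : ℝ) ^ (-(u : ℝ)) * (1 - (q : ℝ) ^ (-(u : ℝ))) /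
              (1 + (q : ℝ) ^ (-(u : ℝ)) - (q : ℝ) ^ (-(2 * u : ℝ)))|
        ≤ C * (q : ℝ) ^ ((-1 / 2 + ε) * d + u)) ∧
    (∀ β : L, β ∈ Algebra.adjoin K ({αX / αZ} : Set L) →
      ∀ ε : ℝ, 0 < ε → ∃ C : ℝ, 0 < C ∧ ∀ d : ℕ,
      |(Nat.card {gh : MvPolynomial (Fin 2) K × MvPolynomial (Fin 2) K //
            gh.1.IsHomogeneous d ∧ gh.2.IsHomogeneous d ∧ Squarefree gh.2 ∧
            IsRelPrime gh.1 gh.2 ∧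
            β * aeval ![αX, αZ] gh.2 - aeval ![αX, αZ] gh.1 = 0} : ℝ) /
          (Nat.card {gh : MvPolynomial (Fin 2) K × MvPolynomial (Fin 2) K //
            gh.1.IsHomogeneous d ∧ gh.2.IsHomogeneous d ∧ Squarefree gh.2 ∧
            IsRelPrime gh.1 gh.2} : ℝ)
          - (q : ℝ) ^ (-(u : ℝ)) /
              (1 + (q : ℝ) ^ (-(u : ℝ)) - (q : ℝ) ^ (-(2 * u : ℝ)))|
        ≤ C * (q : ℝ) ^ ((-1 / 2 + ε) * d)) := by
  have hq3 : 3 ≤ Fintype.card K := by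
    obtain ⟨a, ha, rfl⟩ := hq
    have h2 : p ≠ 2 := by
      rintro rfl
      exact absurd hodd (by decide)
    have h3 : 3 ≤ p := by
      have := hp.two_le
      omega
    rw [hK]
    exact h3.trans (Nat.le_self_pow ha.ne' p)
  have hq1 : (1 : ℝ) < q := by
    rw [← hK]
    exact_mod_cast (by omega : 1 < Fintype.card K)
  have hq0 : (0 : ℝ) < q := zero_lt_one.trans hq1
  obtain ⟨Q, hQ⟩ : ∃ Q : ℝ, Q = ((q : ℝ) ^ u)⁻¹ := ⟨_, rfl⟩
  have e1 : (q : ℝ) ^ (-(u : ℝ)) = Q := by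
    rw [Real.rpow_neg hq0.le, Real.rpow_natCast, hQ]
  have e2 : (q : ℝ) ^ (-(2 * u : ℝ)) = Q ^ 2 := by
    rw [← e1, ← Real.rpow_natCast, ← Real.rpow_mul hq0.le]
    congr 1
    push_cast
    ring
  have key : ∀ ε : ℝ, 0 < ε → (∃ C : ℝ, 0 < C ∧ ∀ d : ℕ,
      |SquarefreeCount.ordCard (K := K) d (fun _ h => aeval ![αX, αZ] h = 0) /
        SquarefreeCount.ordCard (K := K) d (fun _ _ => True) - Q * (1 - Q) / (1 + Q - Q ^ 2)| ≤
      C * (q : ℝ) ^ ((-1 / 2 + ε) * d)) ∧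
    ∀ β ∈ Algebra.adjoin K {αX / αZ}, ∃ C : ℝ, 0 < C ∧ ∀ d : ℕ,
      |SquarefreeCount.ordCard (K := K) d
          (fun g h => β * aeval ![αX, αZ] h - aeval ![αX, αZ] g = 0) /
        SquarefreeCount.ordCard (K := K) d (fun _ _ => True) - Q / (1 + Q - Q ^ 2)| ≤
      C * (q : ℝ) ^ ((-1 / 2 + ε) * d) := by
    intro ε hε
    have : FiniteDimensional K L := Module.Finite.of_finite
    by_cases hz : αZ = 0
    · have hx : αX ≠ 0 := by
        rintro rfl
        exact hα (by rw [hz]; rfl)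
      subst hz
      have hswap : ∀ f : MvPolynomial (Fin 2) K,
          aeval ![0, αX] (rename (Equiv.swap 0 1) f) = aeval ![αX, 0] f := by
        intro f
        rw [aeval_rename]
        congr 2
        funext i
        fin_cases i <;> simp
      have := SquarefreeCount.exists_ordCard_value_bound (K := K) hq3 (x := 0) hx
        (Algebra.IsIntegral.isIntegral _) (Q := Q)
        (by rw [hQ, hu, hK, zero_div, minpoly.zero]; simp) hε
      rw [hK] at this
      simp only [zero_div] at this
      simp only [div_zero]
      refine ⟨?_, fun β hβ => ?_⟩
      · convert this.1 using 8 with C d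
        exact SquarefreeCount.ordCard_congr _ (Equiv.swap 0 1) fun x y => by rw [hswap]
      · convert this.2 β hβ using 8 with C d
        exact SquarefreeCount.ordCard_congr _ (Equiv.swap 0 1) fun x y => by rw [hswap, hswap]
    · rw [if_neg hz] at hu
      have := SquarefreeCount.exists_ordCard_value_bound (K := K) hq3 (x := αX) hz
        (Algebra.IsIntegral.isIntegral _) (Q := Q) (by rw [hQ, hu, hK]) hε
      rwa [hK] at this
  simp only [e1, e2, ← SquarefreeCount.ordCard_true]
  refine ⟨fun ε hε => ?_, fun β hβ ε hε => (key ε hε).2 β hβ⟩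
  obtain ⟨C, hC0, hC⟩ := (key ε hε).1
  refine ⟨C, hC0, fun d => (hC d).trans ?_⟩
  refine mul_le_mul_of_nonneg_left (Real.rpow_le_rpow_of_exponent_le hq1.le ?_) hC0.le
  exact le_add_of_nonneg_right (Nat.cast_nonneg u)
end
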